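/- arXiv:2504.01003 — 7 statements merged into one kernel-verified Lean document; each statement's English description precedes it below -/
import Mathlib

section
/- For every prime p, the number of transfer systems for the elementary abelian group C_p × C_p of rank two equals 2^{p+2} + p + 1. -/
/-- A transfer system for a finite group `G`. -/
def IsTransferSystem {G : Type*} [Group G] (T : Set (Subgroup G × Subgroup G)) : Prop :=
  (∀ p ∈ T, p.1 ≤ p.2) ∧
  (∀ H : Subgroup G, (H, H) ∈ T) ∧
  (∀ H K L : Subgroup G, (H, K) ∈ T → (K, L) ∈ T → (H, L) ∈ T) ∧
  (∀ H K : Subgroup G, (H, K) ∈ T → ∀ g : G,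
    (Subgroup.map (MulAut.conj g).toMonoidHom H, Subgroup.map (MulAut.conj g).toMonoidHom K) ∈ T) ∧
  (∀ H K L : Subgroup G, (H, K) ∈ T → L ≤ K → (H ⊓ L, L) ∈ T)

theorem isTransferSystem_iff_of_comm {G : Type*} [CommGroup G]
    {T : Set (Subgroup G × Subgroup G)} :
    IsTransferSystem T ↔ (∀ H K, (H, K) ∈ T → H ≤ K) ∧ (∀ H, (H, H) ∈ T) ∧
      (∀ H K L, (H, K) ∈ T → (K, L) ∈ T → (H, L) ∈ T) ∧
      (∀ H K L, (H, K) ∈ T → L ≤ K → (H ⊓ L, L) ∈ T) := by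
  have conj_map (g : G) (H : Subgroup G) : H.map (MulAut.conj g).toMonoidHom = H := by
    have : (MulAut.conj g).toMonoidHom = MonoidHom.id G := by
      ext x
      simp
    rw [this, Subgroup.map_id]
  simp only [IsTransferSystem, conj_map, Prod.forall]
  tauto

section RankTwo

variable {G : Type*} [CommGroup G]

/-- The transfers that contain every pair `(⊥, K)`, together with `(H, ⊤)` for `H` in a given set
of atoms. -/
def fullTransfers (S : Set {H : Subgroup G // IsAtom H}) : Set (Subgroup G × Subgroup G) :=
  {q | q.1 = q.2 ∨ q.1 = ⊥ ∨ q.1 ∈ Subtype.val '' S ∧ q.2 = ⊤}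

/-- The transfers from `⊥` to the members of a given set of atoms. -/
def bottomTransfers (S : Set {H : Subgroup G // IsAtom H}) : Set (Subgroup G × Subgroup G) :=
  {q | q.1 = q.2 ∨ q.1 = ⊥ ∧ q.2 ∈ Subtype.val '' S}

/-- The transfer from a given atom to `⊤`, together with the transfers from `⊥` to the other
atoms. -/
def atomTransfers (A : {H : Subgroup G // IsAtom H}) : Set (Subgroup G × Subgroup G) :=
  {q | q.1 = q.2 ∨ (q.1 = ⊥ ∧ IsAtom q.2 ∧ q.2 ≠ A) ∨ q.1 = A ∧ q.2 = ⊤}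

/-- The three families of transfers, as a single map. -/
def rankTwoTransfers :
    Set {H : Subgroup G // IsAtom H} ⊕ Set {H : Subgroup G // IsAtom H} ⊕
      {H : Subgroup G // IsAtom H} → Set (Subgroup G × Subgroup G) :=
  Sum.elim fullTransfers (Sum.elim bottomTransfers atomTransfers)

theorem isTransferSystem_bottomTransfers (S : Set {H : Subgroup G // IsAtom H}) :
    IsTransferSystem (bottomTransfers S) := by
  rw [isTransferSystem_iff_of_comm]
  refine ⟨?_, fun H ↦ Or.inl rfl, ?_, ?_⟩
  · rintro H K (h | ⟨h, -⟩) <;> dsimp only at h <;> subst h <;> simp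
  · rintro H K L (h₁ | ⟨h₁, h₂⟩) (h₃ | ⟨h₃, h₄⟩) <;> dsimp only at *
    · exact Or.inl (h₁.trans h₃)
    · exact Or.inr ⟨h₁.trans h₃, h₄⟩
    · exact Or.inr ⟨h₁, h₃ ▸ h₂⟩
    · exact Or.inr ⟨h₁, h₄⟩
  · rintro H K L (h | ⟨h, A, hA, h'⟩) hL <;> dsimp only at *
    · subst h
      exact Or.inl (inf_eq_right.2 hL)
    · subst h h'
      rcases A.2.le_iff.1 hL with rfl | rfl
      · exact Or.inl (bot_inf_eq _)
      · exact Or.inr ⟨bot_inf_eq _, A, hA, rfl⟩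

variable (hG : ∀ H : Subgroup G, H = ⊥ ∨ IsAtom H ∨ H = ⊤)
include hG

theorem isTransferSystem_fullTransfers (S : Set {H : Subgroup G // IsAtom H}) :
    IsTransferSystem (fullTransfers S) := by
  rw [isTransferSystem_iff_of_comm]
  refine ⟨?_, fun H ↦ Or.inl rfl, ?_, ?_⟩
  · rintro H K (h | h | ⟨-, h⟩) <;> dsimp only at h <;> subst h <;> simp
  · rintro H K L (h₁ | h₁ | ⟨h₁, h₂⟩) (h₃ | h₃ | ⟨h₃, h₄⟩) <;> dsimp only at *
    · exact Or.inl (h₁.trans h₃)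
    · exact Or.inr (Or.inl (h₁.trans h₃))
    · exact Or.inr (Or.inr ⟨h₁ ▸ h₃, h₄⟩)
    · exact Or.inr (Or.inl h₁)
    · exact Or.inr (Or.inl h₁)
    · exact Or.inr (Or.inl h₁)
    · exact Or.inr (Or.inr ⟨h₁, h₃ ▸ h₂⟩)
    · exact Or.inr (Or.inl (le_bot_iff.1 (h₃ ▸ h₂ ▸ le_top)))
    · exact Or.inr (Or.inr ⟨h₁, h₄⟩)
  · rintro H K L (h | h | ⟨⟨A, hA, h⟩, h'⟩) hL <;> dsimp only at *
    · subst h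
      exact Or.inl (inf_eq_right.2 hL)
    · subst h
      exact Or.inr (Or.inl (bot_inf_eq _))
    · subst h h'
      rcases hG L with rfl | hLa | rfl
      · exact Or.inl (inf_bot_eq _)
      · by_cases hAL : A.1 = L
        · exact Or.inl (by simp [hAL])
        · exact Or.inr (Or.inl (A.2.disjoint_of_ne hLa hAL).eq_bot)
      · exact Or.inr (Or.inr ⟨⟨A, hA, (inf_top_eq _).symm⟩, rfl⟩)

theorem isTransferSystem_atomTransfers (A : {H : Subgroup G // IsAtom H}) :
    IsTransferSystem (atomTransfers A) := by
  have hA0 : A.1 ≠ ⊥ := A.2.1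
  rw [isTransferSystem_iff_of_comm]
  refine ⟨?_, fun H ↦ Or.inl rfl, ?_, ?_⟩
  · rintro H K (h | ⟨h, -⟩ | ⟨-, h⟩) <;> dsimp only at h <;> subst h <;> simp
  · rintro H K L (h₁ | ⟨h₁, h₂, h₂'⟩ | ⟨h₁, h₂⟩) (h₃ | ⟨h₃, h₄, h₄'⟩ | ⟨h₃, h₄⟩) <;>
      dsimp only at *
    · exact Or.inl (h₁.trans h₃)
    · exact Or.inr (Or.inl ⟨h₁.trans h₃, h₄, h₄'⟩)
    · exact Or.inr (Or.inr ⟨h₁.trans h₃, h₄⟩)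
    · exact Or.inr (Or.inl ⟨h₁, h₃ ▸ h₂, h₃ ▸ h₂'⟩)
    · exact absurd h₃ h₂.1
    · exact absurd h₃ h₂'
    · exact Or.inr (Or.inr ⟨h₁, h₃ ▸ h₂⟩)
    · exact absurd (le_bot_iff.1 ((le_top : A.1 ≤ ⊤).trans (h₂ ▸ h₃).le)) hA0
    · exact Or.inr (Or.inr ⟨h₁, h₄⟩)
  · rintro H K L (h | ⟨h, hK, hKA⟩ | ⟨h, h'⟩) hL <;> dsimp only at *
    · subst h
      exact Or.inl (inf_eq_right.2 hL)
    · subst h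
      rcases hK.le_iff.1 hL with rfl | rfl
      · exact Or.inl (bot_inf_eq _)
      · exact Or.inr (Or.inl ⟨bot_inf_eq _, hK, hKA⟩)
    · subst h h'
      rcases hG L with rfl | hLa | rfl
      · exact Or.inl (inf_bot_eq _)
      · by_cases hAL : L = A.1
        · exact Or.inl (by simp [hAL])
        · exact Or.inr (Or.inl ⟨(A.2.disjoint_of_ne hLa (Ne.symm hAL)).eq_bot, hLa, hAL⟩)
      · exact Or.inr (Or.inr ⟨inf_top_eq _, rfl⟩)

theorem isTransferSystem_rankTwoTransfers (x) :
    IsTransferSystem (rankTwoTransfers (G := G) x) := by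
  rcases x with S | S | A
  · exact isTransferSystem_fullTransfers hG S
  · exact isTransferSystem_bottomTransfers S
  · exact isTransferSystem_atomTransfers hG A

theorem IsTransferSystem.ext_of_atoms {T T' : Set (Subgroup G × Subgroup G)}
    (hT : IsTransferSystem T) (hT' : IsTransferSystem T')
    (h_bot : ∀ A : Subgroup G, IsAtom A → ((⊥, A) ∈ T ↔ (⊥, A) ∈ T'))
    (h_top : ∀ A : Subgroup G, IsAtom A → ((A, ⊤) ∈ T ↔ (A, ⊤) ∈ T'))
    (h_bot_top : (⊥, ⊤) ∈ T ↔ (⊥, ⊤) ∈ T') : T = T' := by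
  ext ⟨H, K⟩
  by_cases hHK : H = K
  · subst hHK
    exact iff_of_true (hT.2.1 H) (hT'.2.1 H)
  by_cases hle : H ≤ K
  · rcases hG K with rfl | hK | rfl
    · exact absurd (le_bot_iff.1 hle) hHK
    · rcases hK.le_iff.1 hle with rfl | rfl
      · exact h_bot K hK
      · exact absurd rfl hHK
    · rcases hG H with rfl | hH | rfl
      · exact h_bot_top
      · exact h_top H hH
      · exact absurd rfl hHK
  · exact iff_of_false (fun h ↦ hle (hT.1 _ h)) (fun h ↦ hle (hT'.1 _ h))

omit hG in
theorem rankTwoTransfers_injective [Nontrivial G] (ht : ¬ IsAtom (⊤ : Subgroup G)) :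
    Function.Injective (rankTwoTransfers (G := G)) := by
  have hbt : (⊥ : Subgroup G) ≠ ⊤ := bot_ne_top
  have hb (A : {H : Subgroup G // IsAtom H}) : A.1 ≠ ⊥ := A.2.1
  have hb' (A : {H : Subgroup G // IsAtom H}) : ⊥ ≠ A.1 := A.2.1.symm
  have htop (A : {H : Subgroup G // IsAtom H}) : A.1 ≠ ⊤ := fun h ↦ ht (h ▸ A.2)
  have htop' (A : {H : Subgroup G // IsAtom H}) : ⊤ ≠ A.1 := (htop A).symm
  have bot_top (x y) (h : rankTwoTransfers (G := G) x = rankTwoTransfers y) :=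
    Set.ext_iff.1 h (⊥, ⊤)
  have atom_top (x y) (h : rankTwoTransfers (G := G) x = rankTwoTransfers y)
    (A : {H : Subgroup G // IsAtom H}) := Set.ext_iff.1 h (A.1, ⊤)
  have bot_atom (x y) (h : rankTwoTransfers (G := G) x = rankTwoTransfers y)
    (A : {H : Subgroup G // IsAtom H}) := Set.ext_iff.1 h (⊥, A.1)
  rintro (S | S | A) (S' | S' | A') h <;>
    have h₁ := bot_top _ _ h <;> have h₂ := atom_top _ _ h <;> have h₃ := bot_atom _ _ h <;>
    simp [rankTwoTransfers, fullTransfers, bottomTransfers, atomTransfers, hbt, hb, hb', htop,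
      htop', ht, ← Subtype.ext_iff] at h₁ h₂ h₃
  · congr
    ext A
    exact h₂ A A.2
  · congr
    ext A
    exact h₃ A A.2
  · rw [h₂]

theorem exists_rankTwoTransfers_eq [Nontrivial G] (ht : ¬ IsAtom (⊤ : Subgroup G))
    {T : Set (Subgroup G × Subgroup G)} (hT : IsTransferSystem T) :
    ∃ x, rankTwoTransfers x = T := by
  have hbt : (⊥ : Subgroup G) ≠ ⊤ := bot_ne_top
  obtain ⟨-, -, trans, restrict⟩ := isTransferSystem_iff_of_comm.1 hT
  have ne_bot (A : Subgroup G) (hA : IsAtom A) : A ≠ ⊥ := hA.1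
  have ne_top (A : Subgroup G) (hA : IsAtom A) : A ≠ ⊤ := fun h ↦ ht (h ▸ hA)
  have bot_atom (h : (⊥, ⊤) ∈ T) (A : Subgroup G) : (⊥, A) ∈ T := by
    simpa using restrict _ _ A h le_top
  by_cases hc : (⊥, ⊤) ∈ T
  · refine ⟨.inl {A | (A.1, ⊤) ∈ T}, (isTransferSystem_fullTransfers hG _).ext_of_atoms hG hT
      (fun A hA ↦ ?_) (fun A hA ↦ ?_) ?_⟩
    · simp [fullTransfers, bot_atom hc]
    · simp [fullTransfers, hA, ne_bot A hA, ne_top A hA]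
    · simp [fullTransfers, hc]
  by_cases hex : ∃ A : Subgroup G, IsAtom A ∧ (A, ⊤) ∈ T
  · obtain ⟨A, hA, hAT⟩ := hex
    have not_mem : (⊥, A) ∉ T := fun h ↦ hc (trans _ _ _ h hAT)
    have mem (B : Subgroup G) (hB : IsAtom B) (hBA : B ≠ A) : (⊥, B) ∈ T := by
      simpa [(hA.disjoint_of_ne hB hBA.symm).eq_bot] using restrict _ _ B hAT le_top
    refine ⟨.inr (.inr ⟨A, hA⟩), (isTransferSystem_atomTransfers hG _).ext_of_atoms hG hT
      (fun B hB ↦ ?_) (fun B hB ↦ ?_) ?_⟩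
    · by_cases hBA : B = A
      · simp [atomTransfers, hBA, not_mem, (ne_bot A hA).symm]
      · simp [atomTransfers, hBA, hB, mem B hB hBA]
    · by_cases hBA : B = A
      · simp [atomTransfers, hBA, hAT]
      · have : (B, ⊤) ∉ T := fun h ↦ hc (trans _ _ _ (mem B hB hBA) h)
        simp [atomTransfers, hBA, this, ne_top B hB, ne_bot B hB]
    · simp [atomTransfers, hbt, hc, ht, (ne_bot A hA).symm]
  · push Not at hex
    refine ⟨.inr (.inl {A | (⊥, A.1) ∈ T}), (isTransferSystem_bottomTransfers _).ext_of_atoms hG hT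
      (fun A hA ↦ ?_) (fun A hA ↦ ?_) ?_⟩
    · simp [bottomTransfers, hA, (ne_bot A hA).symm]
    · simp [bottomTransfers, ne_bot A hA, ne_top A hA, hex A hA]
    · simp [bottomTransfers, hbt, ht, hc]

theorem card_isTransferSystem_of_atoms [Finite G] [Nontrivial G]
    (ht : ¬ IsAtom (⊤ : Subgroup G)) :
    Nat.card {T : Set (Subgroup G × Subgroup G) // IsTransferSystem T} =
      2 ^ (Nat.card {H : Subgroup G // IsAtom H} + 1) + Nat.card {H : Subgroup G // IsAtom H} := by
  have card_set : Nat.card (Set {H : Subgroup G // IsAtom H}) =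
      2 ^ Nat.card {H : Subgroup G // IsAtom H} := by
    classical
    have := Fintype.ofFinite {H : Subgroup G // IsAtom H}
    rw [Nat.card_eq_fintype_card, Nat.card_eq_fintype_card, Fintype.card_set]
  let f (x) : {T : Set (Subgroup G × Subgroup G) // IsTransferSystem T} :=
    ⟨rankTwoTransfers x, isTransferSystem_rankTwoTransfers hG x⟩
  have hf : Function.Bijective f := by
    refine ⟨fun x y h ↦ rankTwoTransfers_injective ht (congrArg Subtype.val h), fun T ↦ ?_⟩
    obtain ⟨x, hx⟩ := exists_rankTwoTransfers_eq hG ht T.2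
    exact ⟨x, Subtype.ext hx⟩
  rw [← Nat.card_eq_of_bijective f hf, Nat.card_sum, Nat.card_sum, card_set]
  ring

end RankTwo

/-- The subgroups of `C_p × C_p` are the subspaces of the plane over `ZMod p`. -/
def subgroupOrderIsoSubmodule (p : ℕ) :
    Subgroup (Multiplicative (ZMod p × ZMod p)) ≃o Submodule (ZMod p) (ZMod p × ZMod p) :=
  AddSubgroup.toSubgroup.symm.trans (AddSubgroup.toZModSubmodule p)

/-- The number of transfer systems for the rank-two elementary abelian group
`C_p × C_p` equals `2^(p+2) + p + 1`. -/
theorem card_transferSystems_elementary_abelian_rank_two (p : ℕ) (hp : p.Prime) :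
    Nat.card {T : Set (Subgroup (Multiplicative (ZMod p × ZMod p)) ×
        Subgroup (Multiplicative (ZMod p × ZMod p))) // IsTransferSystem T} =
      2 ^ (p + 2) + p + 1 := by
  have : Fact p.Prime := ⟨hp⟩
  have : Finite (Multiplicative (ZMod p × ZMod p)) :=
    inferInstanceAs (Finite (ZMod p × ZMod p))
  have finrank_plane : Module.finrank (ZMod p) (ZMod p × ZMod p) = 2 := by simp
  let e := subgroupOrderIsoSubmodule p
  have isAtom_iff (H : Subgroup (Multiplicative (ZMod p × ZMod p))) :
      IsAtom H ↔ Module.finrank (ZMod p) (e H) = 1 := by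
    rw [← e.isAtom_iff, Submodule.isAtom_iff_finrank_eq_one]
  have card_atoms :
      Nat.card {H : Subgroup (Multiplicative (ZMod p × ZMod p)) // IsAtom H} = p + 1 := by
    rw [Nat.card_congr (e.toEquiv.subtypeEquiv
        (q := fun W : Submodule (ZMod p) (ZMod p × ZMod p) ↦ Module.finrank (ZMod p) W = 1) isAtom_iff),
      ← Nat.card_congr (Projectivization.equivSubmodule (ZMod p) (ZMod p × ZMod p)),
      Projectivization.card_of_finrank_two _ _ finrank_plane, Nat.card_zmod]
  have trichotomy (H : Subgroup (Multiplicative (ZMod p × ZMod p))) :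
      H = ⊥ ∨ IsAtom H ∨ H = ⊤ := by
    have hle := Submodule.finrank_le (e H)
    rw [finrank_plane] at hle
    rw [isAtom_iff, ← map_eq_bot_iff e, ← map_eq_top_iff e, ← Submodule.finrank_eq_zero]
    have h_top : Module.finrank (ZMod p) (e H) = 2 → e H = ⊤ := fun h ↦
      Submodule.eq_top_of_finrank_eq (h.trans finrank_plane.symm)
    interval_cases Module.finrank (ZMod p) (e H) <;> simp_all
  have not_isAtom_top : ¬ IsAtom (⊤ : Subgroup (Multiplicative (ZMod p × ZMod p))) := by
    rw [isAtom_iff, map_top, finrank_top, finrank_plane]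
    norm_num
  rw [card_isTransferSystem_of_atoms trichotomy not_isAtom_top, card_atoms]
  ring
end

section
/- Let G be a finite abelian group. The width of G equals the number of meet-irreducible proper subgroups of G, that is, the number of proper subgroups H < G that cannot be written as the intersection of two proper subgroups of G each strictly containing H. -/
/-- The transfer system generated by a set `S` of pairs of subgroups: the smallest
transfer system containing `S`. -/
def genTS {G : Type*} [Group G] (S : Set (Subgroup G × Subgroup G)) :
    Set (Subgroup G × Subgroup G) :=
  ⋂₀ {T | IsTransferSystem T ∧ S ⊆ T}

/-- The width of `G`: the minimal cardinality of a set of pairs `(H, K)` with `H < K`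
generating the complete transfer system `{(H, K) | H ≤ K}`. -/
noncomputable def width (G : Type*) [Group G] : ℕ :=
  sInf {n : ℕ | ∃ S : Set (Subgroup G × Subgroup G), (∀ p ∈ S, p.1 < p.2) ∧
    genTS S = {p : Subgroup G × Subgroup G | p.1 ≤ p.2} ∧ S.ncard = n}

/-- A proper subgroup that is not the intersection of two strictly larger proper subgroups. -/
def IsMeetIrreducible {G : Type*} [Group G] (H : Subgroup G) : Prop :=
  H < ⊤ ∧ ¬∃ A B : Subgroup G, A < ⊤ ∧ B < ⊤ ∧ H < A ∧ H < B ∧ A ⊓ B = H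

theorem isTransferSystem_complete (G : Type*) [Group G] :
    IsTransferSystem {p : Subgroup G × Subgroup G | p.1 ≤ p.2} :=
  ⟨fun _ h => h, fun H => le_refl H, fun H K L (h₁ : H ≤ K) (h₂ : K ≤ L) => h₁.trans h₂,
    fun _ _ h _ => Subgroup.map_mono h, fun H _ L _ _ => (inf_le_right : H ⊓ L ≤ L)⟩

theorem map_conj_eq_self {G : Type*} [CommGroup G] (g : G) (H : Subgroup G) :
    H.map (MulAut.conj g).toMonoidHom = H := by
  have h : (MulAut.conj g).toMonoidHom = MonoidHom.id G := by
    ext x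
    simp
  rw [h, Subgroup.map_id]

/-- A transfer system relating every meet-irreducible subgroup to the whole group is complete. -/
theorem IsTransferSystem.mem_of_le {G : Type*} [Group G] [Finite G]
    {T : Set (Subgroup G × Subgroup G)} (hT : IsTransferSystem T)
    (h : ∀ H : Subgroup G, IsMeetIrreducible H → (H, ⊤) ∈ T)
    {H K : Subgroup G} (hHK : H ≤ K) : (H, K) ∈ T := by
  obtain ⟨-, hrefl, htrans, -, hres⟩ := hT
  have htop : ∀ H : Subgroup G, (H, ⊤) ∈ T := by
    intro H
    induction H using WellFoundedGT.induction with
    | ind H ih =>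
      by_cases hH : IsMeetIrreducible H
      · exact h H hH
      · rcases eq_or_lt_of_le (le_top : H ≤ ⊤) with rfl | hlt
        · exact hrefl _
        · obtain ⟨A, B, -, -, hA, hB, rfl⟩ := not_not.mp fun hn => hH ⟨hlt, hn⟩
          exact htrans _ _ _ (hres A ⊤ B (ih A hA) le_top) (ih B hB)
  simpa [inf_eq_left.mpr hHK] using hres H ⊤ K (htop H) le_top

/-- The pairs of subgroups other than those of the form `(M, K)` with `M < K` form a transfer
system when `M` is meet-irreducible. -/
theorem IsMeetIrreducible.isTransferSystem_avoiding {G : Type*} [CommGroup G] {M : Subgroup G}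
    (hM : IsMeetIrreducible M) :
    IsTransferSystem {p : Subgroup G × Subgroup G | p.1 ≤ p.2 ∧ (p.1 = M → p.2 = M)} := by
  refine ⟨fun _ h => h.1, fun _ => ⟨le_rfl, id⟩,
    fun _ _ _ h₁ h₂ => ⟨h₁.1.trans h₂.1, fun h => h₂.2 (h₁.2 h)⟩,
    fun H K h g => by simpa only [map_conj_eq_self] using h,
    fun H K L h hL => ⟨inf_le_right, fun hHL => ?_⟩⟩
  dsimp only at h hHL ⊢
  have hMH : M ≤ H := hHL ▸ inf_le_left
  have hML : M ≤ L := hHL ▸ inf_le_right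
  by_contra hne
  have hML' : M < L := lt_of_le_of_ne hML (Ne.symm hne)
  have hMH' : M < H := lt_of_le_of_ne hMH fun he =>
    hne (le_antisymm (hL.trans (h.2 he.symm).le) hML)
  refine hM.2 ⟨H, L, lt_top_iff_ne_top.mpr ?_, lt_top_iff_ne_top.mpr ?_, hMH', hML', hHL⟩
  · rintro rfl
    exact hne (by simpa using hHL)
  · rintro rfl
    exact hMH'.ne' (by simpa using hHL)

/-- Every generating set of the complete transfer system contains a pair starting at each
meet-irreducible subgroup. -/
theorem IsMeetIrreducible.mem_image_fst {G : Type*} [CommGroup G] {M : Subgroup G}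
    (hM : IsMeetIrreducible M) {S : Set (Subgroup G × Subgroup G)} (hS : ∀ p ∈ S, p.1 < p.2)
    (hgen : genTS S = {p : Subgroup G × Subgroup G | p.1 ≤ p.2}) : M ∈ Prod.fst '' S := by
  by_contra hn
  have hmem : (M, ⊤) ∈ genTS S := by
    rw [hgen]
    exact le_top (a := M)
  have hsub : S ⊆ {p : Subgroup G × Subgroup G | p.1 ≤ p.2 ∧ (p.1 = M → p.2 = M)} :=
    fun p hp => ⟨(hS p hp).le, fun he => (hn ⟨p, hp, he⟩).elim⟩
  exact hM.1.ne' ((hmem _ ⟨hM.isTransferSystem_avoiding, hsub⟩).2 rfl)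

/-- The pairs `(H, ⊤)` with `H` meet-irreducible generate the complete transfer system. -/
theorem genTS_meetIrreducible (G : Type*) [Group G] [Finite G] :
    genTS ((fun H : Subgroup G => (H, (⊤ : Subgroup G))) '' {H | IsMeetIrreducible H}) =
      {p : Subgroup G × Subgroup G | p.1 ≤ p.2} := by
  apply Set.Subset.antisymm
  · refine Set.sInter_subset_of_mem ⟨isTransferSystem_complete G, ?_⟩
    rintro _ ⟨H, -, rfl⟩
    exact le_top (a := H)
  · rintro ⟨H, K⟩ hHK T ⟨hT, hS⟩
    exact hT.mem_of_le (fun M hM => hS ⟨M, hM, rfl⟩) hHK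

/-- For a finite abelian group `G`, the width of `G` equals the number of
meet-irreducible proper subgroups of `G`: proper subgroups `H < G` that cannot be
written as the intersection of two proper subgroups each strictly containing `H`. -/
theorem width_eq_card_meet_irreducible
    {G : Type*} [CommGroup G] [Finite G] :
    width G = Nat.card {H : Subgroup G // H < ⊤ ∧
      ¬∃ A B : Subgroup G, A < ⊤ ∧ B < ⊤ ∧ H < A ∧ H < B ∧ A ⊓ B = H} := by
  change width G = Set.ncard {H : Subgroup G | IsMeetIrreducible H}
  refine IsLeast.csInf_eq (α := ℕ) ⟨?_, ?_⟩
  · refine ⟨_, ?_, genTS_meetIrreducible G, Set.ncard_image_of_injective _ fun _ _ h =>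
      congrArg Prod.fst h⟩
    rintro _ ⟨H, hH, rfl⟩
    exact hH.1
  · rintro n ⟨S, hS, hgen, rfl⟩
    have : {H : Subgroup G | IsMeetIrreducible H} ⊆ Prod.fst '' S :=
      fun M hM => hM.mem_image_fst hS hgen
    exact (Set.ncard_le_ncard this).trans (Set.ncard_image_le S.toFinite)
end

section
/- For every prime p and every natural number n, the number of premodel structures on Sub(C_{p^n}), i.e. the number of pairs (T, T') of transfer systems for the cyclic group C_{p^n} with T ⊆ T', equals 2·(4n+5)! / ((n+2)!·(3n+5)!). -/
open Polynomial

theorem exists_fixedPoint_of_contracting {R : Type*} [CommRing R]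
    (Φ : PowerSeries R → PowerSeries R)
    (h : ∀ (k : ℕ) (a b : PowerSeries R), PowerSeries.X ^ k ∣ a - b →
      PowerSeries.X ^ (k + 1) ∣ Φ a - Φ b) :
    ∃ a, Φ a = a := by
  have hstep : ∀ k, (PowerSeries.X : PowerSeries R) ^ k ∣ Φ^[k + 1] 0 - Φ^[k] 0 := by
    intro k
    induction k with
    | zero => simp
    | succ k ih =>
      rw [Function.iterate_succ_apply' Φ (k + 1), Function.iterate_succ_apply' Φ k]
      exact h _ _ _ (by rwa [← Function.iterate_succ_apply' Φ k])
  have hcauchy : ∀ k m, (PowerSeries.X : PowerSeries R) ^ k ∣ Φ^[k + m] 0 - Φ^[k] 0 := by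
    intro k m
    induction m with
    | zero => simp
    | succ m ih =>
      have := dvd_add ((pow_dvd_pow _ (Nat.le_add_right k m)).trans (hstep (k + m))) ih
      simpa [add_assoc] using this
  let a : PowerSeries R := PowerSeries.mk fun n => PowerSeries.coeff n (Φ^[n + 1] 0)
  have ha : ∀ k, (PowerSeries.X : PowerSeries R) ^ k ∣ a - Φ^[k] 0 := by
    intro k
    rw [PowerSeries.X_pow_dvd_iff]
    intro m hm
    obtain ⟨l, rfl⟩ := Nat.exists_eq_add_of_lt hm
    have := (PowerSeries.X_pow_dvd_iff.1 (hcauchy (m + 1) l)) m (Nat.lt_succ_self m)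
    rw [map_sub, sub_eq_zero] at this ⊢
    rw [show m + l + 1 = m + 1 + l by ring, this]
    simp [a]
  refine ⟨a, ?_⟩
  ext n
  have h1 := h _ _ _ (ha n)
  rw [← Function.iterate_succ_apply' Φ n] at h1
  have h2 := dvd_sub h1 (ha (n + 1))
  rw [sub_sub_sub_cancel_right] at h2
  have := PowerSeries.X_pow_dvd_iff.1 h2 n (Nat.lt_succ_self n)
  rwa [map_sub, sub_eq_zero] at this

theorem exists_eq_one_add_X_mul_pow_four (R : Type*) [CommRing R] :
    ∃ B : PowerSeries R, B = 1 + PowerSeries.X * B ^ 4 := by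
  obtain ⟨B, hB⟩ := exists_fixedPoint_of_contracting
    (fun B : PowerSeries R => 1 + PowerSeries.X * B ^ 4) (by
      intro k a b hab
      rw [add_sub_add_left_eq_sub, ← mul_sub, pow_succ']
      exact mul_dvd_mul_left _ (hab.trans (sub_dvd_pow_sub_pow a b 4)))
  exact ⟨B, hB.symm⟩

theorem exists_eq_add_X_mul_sq {R : Type*} [CommRing R] (c d : PowerSeries R) :
    ∃ V : PowerSeries R, V = c + PowerSeries.X * d * V ^ 2 := by
  obtain ⟨V, hV⟩ := exists_fixedPoint_of_contracting
    (fun V : PowerSeries R => c + PowerSeries.X * d * V ^ 2) (by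
      intro k a b hab
      rw [add_sub_add_left_eq_sub, ← mul_sub, pow_succ', mul_assoc]
      exact mul_dvd_mul_left _ ((hab.trans (sub_dvd_pow_sub_pow a b 2)).mul_left _))
  exact ⟨V, hV.symm⟩

/-- The coefficients of the powers of the generalized binomial series `B = 1 + t * B ^ 4`. -/
theorem coeff_pow_of_eq_one_add_X_mul_pow_four {B : PowerSeries ℚ}
    (hB : B = 1 + PowerSeries.X * B ^ 4) (n r : ℕ) :
    PowerSeries.coeff (n + 1) (B ^ r) * ((n + 1).factorial * (3 * n + 3 + r).factorial) =
      r * (4 * n + 3 + r).factorial := by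
  have h0 : PowerSeries.constantCoeff B = 1 := by rw [hB]; simp
  have hrec : ∀ n r, PowerSeries.coeff (n + 1) (B ^ (r + 1)) =
      PowerSeries.coeff (n + 1) (B ^ r) + PowerSeries.coeff n (B ^ (r + 4)) := by
    intro n r
    have : B ^ (r + 1) = B ^ r + PowerSeries.X * B ^ (r + 4) := by
      calc B ^ (r + 1) = B ^ r * B := pow_succ _ _
        _ = B ^ r * (1 + PowerSeries.X * B ^ 4) := by rw [← hB]
        _ = _ := by ring
    rw [this, map_add, PowerSeries.coeff_succ_X_mul]
  induction n generalizing r with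
  | zero =>
    induction r with
    | zero => simp [PowerSeries.coeff_one]
    | succ r ih =>
      have e : PowerSeries.coeff 0 (B ^ (r + 4)) = 1 := by
        rw [PowerSeries.coeff_zero_eq_constantCoeff_apply, map_pow, h0, one_pow]
      rw [hrec, e]
      have hf : ((3 + r).factorial : ℚ) ≠ 0 := by positivity
      simp only [mul_zero, zero_add, Nat.factorial_one, Nat.cast_one, one_mul] at ih ⊢
      have : PowerSeries.coeff 1 (B ^ r) = r := mul_right_cancel₀ hf ih
      rw [this]; push_cast; ring
  | succ n ihn =>
    induction r with
    | zero => simp [PowerSeries.coeff_one]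
    | succ r ihr =>
      rw [hrec]
      have h4 := ihn (r + 4)
      rw [show 3 * n + 3 + (r + 4) = 3 * n + r + 7 by ring,
        show 4 * n + 3 + (r + 4) = 4 * n + r + 7 by ring] at h4
      rw [show 3 * (n + 1) + 3 + r = 3 * n + r + 6 by ring,
        show 4 * (n + 1) + 3 + r = 4 * n + r + 7 by ring] at ihr
      rw [show 3 * (n + 1) + 3 + (r + 1) = 3 * n + r + 7 by ring,
        show 4 * (n + 1) + 3 + (r + 1) = (4 * n + r + 7) + 1 by ring]
      rw [Nat.factorial_succ (n + 1)] at ihr ⊢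
      rw [show 3 * n + r + 7 = (3 * n + r + 6) + 1 by ring,
        Nat.factorial_succ (3 * n + r + 6)] at h4 ⊢
      rw [Nat.factorial_succ (4 * n + r + 7)]
      push_cast at h4 ihr ⊢
      linear_combination (3 * n + r + 7 : ℚ) * ihr + (n + 2 : ℚ) * h4

/-- A solution of the catalytic functional equation of Tamari intervals specializes at `1`
to `2 * B ^ 2 - B ^ 3`. -/
theorem map_eval_one_of_catalytic_equation {F : PowerSeries ℚ[X]} {B : PowerSeries ℚ}
    (hB : B = 1 + PowerSeries.X * B ^ 4)
    (hF : (PowerSeries.C (X - 1 : ℚ[X])) * (F - PowerSeries.C X) =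
      PowerSeries.X * PowerSeries.C X * F *
        (F - PowerSeries.map C (PowerSeries.map (evalRingHom 1) F))) :
    PowerSeries.map (evalRingHom 1) F = 2 * B ^ 2 - B ^ 3 := by
  set ev : PowerSeries ℚ[X] →+* PowerSeries ℚ := PowerSeries.map (evalRingHom 1) with hev
  set ι : PowerSeries ℚ →+* PowerSeries ℚ[X] := PowerSeries.map C with hι
  have hevι : ∀ s, ev (ι s) = s := by
    intro s; ext n; simp [hev, hι]
  have hevX : ev PowerSeries.X = PowerSeries.X := by simp [hev]
  have hevC : ev (PowerSeries.C X) = 1 := by simp [hev]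
  have hιX : ι PowerSeries.X = PowerSeries.X := by simp [hι]
  obtain ⟨V, hV⟩ := exists_eq_add_X_mul_sq (1 - PowerSeries.X * ι B ^ 3)
    (ι B ^ 3 * PowerSeries.C (X : ℚ[X]))
  have hB' : ι B = 1 + PowerSeries.X * ι B ^ 4 := by
    conv_lhs => rw [hB]
    simp [hιX]
  set W := 1 - PowerSeries.X * ι B ^ 3 with hW
  have hBW : ι B * W = 1 := by rw [hW]; linear_combination hB'
  have hevV : ev V = 1 := by
    have h1 := congrArg ev hV
    simp only [hW, map_add, map_mul, map_pow, map_sub, map_one, hevι, hevX, hevC] at h1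
    have h2 : (ev V - 1) * (1 - PowerSeries.X * (B ^ 3 * (ev V + 1))) = 0 := by
      linear_combination h1
    rcases mul_eq_zero.1 h2 with h3 | h3
    · exact sub_eq_zero.1 h3
    · have := congrArg PowerSeries.constantCoeff h3
      simp at this
  set Ψ := ι B ^ 3 * (W * (1 + PowerSeries.C X * V) - V) with hΨ
  have hevΨ : ev Ψ = 2 * B ^ 2 - B ^ 3 := by
    simp only [hΨ, hW, map_add, map_mul, map_pow, map_sub, map_one, hevι, hevX, hevC, hevV]
    linear_combination (2 * B ^ 2) * hB
  have hΨeq : (PowerSeries.C (X - 1 : ℚ[X])) * (Ψ - PowerSeries.C X) =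
      PowerSeries.X * PowerSeries.C X * Ψ * (Ψ - ι (ev Ψ)) := by
    have h1 : ι (ev Ψ) = ι B ^ 3 * (2 * W - 1) := by
      rw [hevΨ]; simp only [map_sub, map_mul, map_pow, map_ofNat]
      linear_combination (-2 * ι B ^ 2) * hBW
    have hcube : ι B ^ 3 * W ^ 3 = 1 := by rw [← mul_pow, hBW, one_pow]
    have hz : PowerSeries.X * ι B ^ 3 = 1 - W := by rw [hW]; ring
    have hV' : (1 - W) * PowerSeries.C (X : ℚ[X]) * V ^ 2 = V - W := by
      rw [← hz]; linear_combination -hV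
    rw [h1, hΨ, map_sub, map_one]
    generalize ι B = b at *
    generalize PowerSeries.C (X : ℚ[X]) = x at *
    clear_value W
    linear_combination (-(b ^ 3 * (1 - W * x) ^ 2)) * hV' + (x - 1) * x * hcube
      - b ^ 3 * x * (W * (1 + x * V) - V) * (W * (1 + x * V) - V - (2 * W - 1)) * hz
  have hx : (X - 1 : ℚ[X]) ≠ 0 := by
    simpa using (Polynomial.X_sub_C_ne_zero (1 : ℚ))
  have hcoeff : ∀ n, PowerSeries.coeff n F = PowerSeries.coeff n Ψ := by
    intro n
    induction n using Nat.strong_induction_on with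
    | _ n ih =>
      refine mul_left_cancel₀ hx ?_
      have hF' := congrArg (PowerSeries.coeff n) hF
      have hΨ' := congrArg (PowerSeries.coeff n) hΨeq
      rw [PowerSeries.coeff_C_mul, map_sub, mul_sub, sub_eq_iff_eq_add] at hF' hΨ'
      rw [hF', hΨ']
      congr 1
      cases n with
      | zero => simp [mul_assoc]
      | succ n =>
        simp only [mul_assoc, PowerSeries.coeff_succ_X_mul, PowerSeries.coeff_C_mul]
        congr 1
        rw [PowerSeries.coeff_mul, PowerSeries.coeff_mul]
        refine Finset.sum_congr rfl fun ij hij => ?_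
        have h1 := Finset.HasAntidiagonal.mem_antidiagonal.1 hij
        rw [ih _ (by omega)]
        congr 1
        simp only [hι, hev, map_sub, PowerSeries.coeff_map]
        rw [ih _ (by omega)]
  rw [← hevΨ]
  congr 1
  ext1 n
  exact hcoeff n

/-- Read `L` as the list of numbers of descendants, in preorder, of the nodes of a plane forest.
These are the lengths of the prefixes of `L` that are closed under taking descendants. -/
def closedPrefixes : List ℕ → Finset ℕ
  | [] => {0}
  | d :: L => insert 0 (((closedPrefixes L).filter (d ≤ ·)).image Nat.succ)

theorem zero_mem_closedPrefixes (L : List ℕ) : 0 ∈ closedPrefixes L := by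
  cases L <;> simp [closedPrefixes]

theorem succ_mem_closedPrefixes_cons {d c : ℕ} {L : List ℕ} :
    c + 1 ∈ closedPrefixes (d :: L) ↔ c ∈ closedPrefixes L ∧ d ≤ c := by
  simp [closedPrefixes]

theorem card_closedPrefixes_cons (d : ℕ) (L : List ℕ) :
    (closedPrefixes (d :: L)).card = ((closedPrefixes L).filter (d ≤ ·)).card + 1 := by
  rw [closedPrefixes, Finset.card_insert_of_notMem (by simp),
    Finset.card_image_of_injective _ Nat.succ_injective]

theorem mem_closedPrefixes {c : ℕ} {L : List ℕ} :
    c ∈ closedPrefixes L ↔ c ≤ L.length ∧ ∀ j < c, j + L.getD j 0 + 1 ≤ c := by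
  induction L generalizing c with
  | nil =>
    simp only [closedPrefixes, Finset.mem_singleton, List.length_nil]
    constructor
    · rintro rfl; simp
    · intro h; omega
  | cons d L ih =>
    cases c with
    | zero => simp [zero_mem_closedPrefixes]
    | succ c =>
      rw [succ_mem_closedPrefixes_cons, ih]
      constructor
      · rintro ⟨⟨h1, h2⟩, h3⟩
        refine ⟨by simpa using h1, fun j hj => ?_⟩
        cases j with
        | zero => simp; omega
        | succ j =>
          have := h2 j (by omega)
          simp only [List.getD_cons_succ]; omega
      · rintro ⟨h1, h2⟩
        refine ⟨⟨by simpa using h1, fun j hj => ?_⟩, ?_⟩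
        · have := h2 (j + 1) (by omega)
          simp only [List.getD_cons_succ] at this; omega
        · have := h2 0 (by omega)
          simp at this; omega

theorem mem_closedPrefixes_append {c : ℕ} {P Q : List ℕ} (hc : c ≤ P.length) :
    c ∈ closedPrefixes (P ++ Q) ↔ c ∈ closedPrefixes P := by
  rw [mem_closedPrefixes, mem_closedPrefixes, List.length_append]
  refine and_congr (by omega) (forall₂_congr fun j hj => ?_)
  rw [List.getD_append _ _ _ _ (by omega)]

theorem length_add_mem_closedPrefixes_append {c : ℕ} {P Q : List ℕ}
    (hP : P.length ∈ closedPrefixes P) :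
    P.length + c ∈ closedPrefixes (P ++ Q) ↔ c ∈ closedPrefixes Q := by
  rw [mem_closedPrefixes] at hP
  rw [mem_closedPrefixes, mem_closedPrefixes, List.length_append]
  refine and_congr (by omega) ⟨fun h j hj => ?_, fun h j hj => ?_⟩
  · have := h (P.length + j) (by omega)
    rw [List.getD_append_right _ _ _ _ (by omega), Nat.add_sub_cancel_left] at this
    omega
  · by_cases hjP : j < P.length
    · rw [List.getD_append _ _ _ _ hjP]
      have := hP.2 j hjP
      omega
    · rw [List.getD_append_right _ _ _ _ (by omega)]
      have := h (j - P.length) (by omega)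
      omega

theorem card_filter_closedPrefixes_append {d : ℕ} {P Q : List ℕ}
    (hP : P.length ∈ closedPrefixes P) (hd : d ≤ P.length) :
    ((closedPrefixes (P ++ Q)).filter (d ≤ ·)).card + 1 =
      ((closedPrefixes P).filter (d ≤ ·)).card + (closedPrefixes Q).card := by
  have h : (closedPrefixes (P ++ Q)).filter (d ≤ ·) = (closedPrefixes P).filter (d ≤ ·) ∪
      ((closedPrefixes Q).erase 0).image (P.length + ·) := by
    ext c
    simp only [Finset.mem_filter, Finset.mem_union, Finset.mem_image, Finset.mem_erase]
    constructor
    · rintro ⟨hc, hdc⟩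
      by_cases hcP : c ≤ P.length
      · exact Or.inl ⟨(mem_closedPrefixes_append hcP).1 hc, hdc⟩
      · obtain ⟨k, rfl⟩ := Nat.exists_eq_add_of_le (Nat.le_of_not_le hcP)
        exact Or.inr ⟨k, ⟨by omega, (length_add_mem_closedPrefixes_append hP).1 hc⟩, rfl⟩
    · rintro (⟨hc, hdc⟩ | ⟨k, ⟨-, hk⟩, rfl⟩)
      · exact ⟨(mem_closedPrefixes_append (mem_closedPrefixes.1 hc).1).2 hc, hdc⟩
      · exact ⟨(length_add_mem_closedPrefixes_append hP).2 hk, by omega⟩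
  rw [h, Finset.card_union_of_disjoint, Finset.card_image_of_injective _ (add_right_injective _),
    add_assoc, Finset.card_erase_add_one (zero_mem_closedPrefixes Q)]
  rw [Finset.disjoint_left]
  intro c hc hc'
  simp only [Finset.mem_filter, Finset.mem_image, Finset.mem_erase] at hc hc'
  obtain ⟨k, ⟨hk, -⟩, rfl⟩ := hc'
  have := (mem_closedPrefixes.1 hc.1).1
  omega

/-- Lists of numbers of descendants, in preorder, of plane forests. -/
def IsBracketVector : List ℕ → Prop
  | [] => True
  | d :: L => d ∈ closedPrefixes L ∧ IsBracketVector L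

theorem IsBracketVector.length_mem {L : List ℕ} (h : IsBracketVector L) :
    L.length ∈ closedPrefixes L := by
  induction L with
  | nil => simp [closedPrefixes]
  | cons d L ih =>
    exact succ_mem_closedPrefixes_cons.2 ⟨ih h.2, (mem_closedPrefixes.1 h.1).1⟩

theorem isBracketVector_append {P Q : List ℕ} (hP : P.length ∈ closedPrefixes P) :
    IsBracketVector (P ++ Q) ↔ IsBracketVector P ∧ IsBracketVector Q := by
  induction P with
  | nil => simp [IsBracketVector]
  | cons d P ih =>
    obtain ⟨h1, h2⟩ := succ_mem_closedPrefixes_cons.1 hP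
    rw [List.cons_append, IsBracketVector, IsBracketVector, ih h1, mem_closedPrefixes_append h2,
      and_assoc]

theorem isBracketVector_iff {L : List ℕ} :
    IsBracketVector L ↔ ∀ i < L.length, i + L.getD i 0 < L.length ∧
      ∀ j, i ≤ j → j ≤ i + L.getD i 0 → j + L.getD j 0 ≤ i + L.getD i 0 := by
  induction L with
  | nil => simp [IsBracketVector]
  | cons d L ih =>
    rw [IsBracketVector, ih, mem_closedPrefixes]
    constructor
    · rintro ⟨⟨h1, h2⟩, h3⟩ i hi
      cases i with
      | zero =>
        simp only [List.getD_cons_zero, List.length_cons]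
        refine ⟨by omega, fun j _ hj => ?_⟩
        cases j with
        | zero => simp
        | succ j =>
          have := h2 j (by omega)
          simp only [List.getD_cons_succ]; omega
      | succ i =>
        simp only [List.getD_cons_succ, List.length_cons] at hi ⊢
        obtain ⟨h4, h5⟩ := h3 i (by omega)
        refine ⟨by omega, fun j hij hj => ?_⟩
        obtain ⟨j, rfl⟩ := Nat.exists_eq_add_of_le' (show 1 ≤ j by omega)
        have := h5 j (by omega) (by omega)
        simp only [List.getD_cons_succ]; omega
    · intro h
      have h0 := h 0 (by simp)
      simp only [List.getD_cons_zero, List.length_cons] at h0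
      refine ⟨⟨by omega, fun j hj => ?_⟩, fun i hi => ?_⟩
      · have := h0.2 (j + 1) (by omega) (by omega)
        simp only [List.getD_cons_succ] at this; omega
      · have hs := h (i + 1) (by simpa using hi)
        simp only [List.getD_cons_succ, List.length_cons] at hs
        refine ⟨by omega, fun j hij hj => ?_⟩
        have := hs.2 (j + 1) (by omega) (by omega)
        simp only [List.getD_cons_succ] at this; omega

/-- Pairs of comparable bracket vectors, zipped into one list. -/
def IsTamariInterval (w : List (ℕ × ℕ)) : Prop :=
  IsBracketVector (w.map Prod.fst) ∧ IsBracketVector (w.map Prod.snd) ∧ ∀ q ∈ w, q.1 ≤ q.2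

theorem isTamariInterval_cons {q : ℕ × ℕ} {w : List (ℕ × ℕ)} :
    IsTamariInterval (q :: w) ↔ (q.1 ∈ closedPrefixes (w.map Prod.fst) ∧
      q.2 ∈ closedPrefixes (w.map Prod.snd) ∧ q.1 ≤ q.2) ∧ IsTamariInterval w := by
  simp only [IsTamariInterval, List.map_cons, IsBracketVector, List.forall_mem_cons]
  tauto

theorem isTamariInterval_append {P Q : List (ℕ × ℕ)}
    (h1 : P.length ∈ closedPrefixes (P.map Prod.fst))
    (h2 : P.length ∈ closedPrefixes (P.map Prod.snd)) :
    IsTamariInterval (P ++ Q) ↔ IsTamariInterval P ∧ IsTamariInterval Q := by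
  simp only [IsTamariInterval, List.map_append, List.forall_mem_append]
  rw [isBracketVector_append (by simpa using h1), isBracketVector_append (by simpa using h2)]
  tauto

/-- The Tamari intervals of size `N`. -/
def tamariIntervals : ℕ → Finset (List (ℕ × ℕ))
  | 0 => {[]}
  | N + 1 => (tamariIntervals N).biUnion fun w =>
      ((closedPrefixes (w.map Prod.fst) ×ˢ closedPrefixes (w.map Prod.snd)).filter
        fun q => q.1 ≤ q.2).image fun q => q :: w

theorem mem_tamariIntervals {N : ℕ} {w : List (ℕ × ℕ)} :
    w ∈ tamariIntervals N ↔ w.length = N ∧ IsTamariInterval w := by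
  induction N generalizing w with
  | zero =>
    simp only [tamariIntervals, Finset.mem_singleton, List.length_eq_zero_iff]
    constructor
    · rintro rfl; simp [IsTamariInterval, IsBracketVector]
    · exact fun h => h.1
  | succ N ih =>
    cases w with
    | nil => simp [tamariIntervals]
    | cons q w =>
      simp only [tamariIntervals, Finset.mem_biUnion, Finset.mem_image, Finset.mem_filter,
        Finset.mem_product, List.cons.injEq, isTamariInterval_cons, List.length_cons,
        Nat.add_right_cancel_iff, ih]
      constructor
      · rintro ⟨w, h1, q, h2, rfl, rfl⟩
        tauto
      · rintro ⟨h1, h2, h3⟩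
        exact ⟨w, ⟨h1, h3⟩, q, by tauto, rfl, rfl⟩

theorem sum_pow_card_filter_le {R : Type*} [CommRing R] (x : R) (s : Finset ℕ) :
    (x - 1) * ∑ c ∈ s, x ^ (s.filter (c ≤ ·)).card = x * (x ^ s.card - 1) := by
  induction s using Finset.induction_on_min with
  | empty => simp
  | insert a s ha ih =>
    have has : a ∉ s := fun h => lt_irrefl _ (ha a h)
    rw [Finset.sum_insert has, mul_add, Finset.card_insert_of_notMem has]
    have h1 : (insert a s).filter (a ≤ ·) = insert a s := by
      refine Finset.filter_true_of_mem fun c hc => ?_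
      rcases Finset.mem_insert.1 hc with rfl | hc
      exacts [le_rfl, (ha c hc).le]
    have h2 : ∀ c ∈ s, (insert a s).filter (c ≤ ·) = s.filter (c ≤ ·) := fun c hc => by
      rw [Finset.filter_insert, if_neg (not_le.2 (ha c hc))]
    rw [h1, Finset.card_insert_of_notMem has, Finset.sum_congr rfl fun c hc => by rw [h2 c hc], ih]
    ring

/-- The enumerator of Tamari intervals by number of closed prefixes of the lower element. -/
noncomputable def tamariPolynomial (N : ℕ) : ℚ[X] :=
  ∑ w ∈ tamariIntervals N, X ^ (closedPrefixes (w.map Prod.fst)).card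

theorem tamariPolynomial_succ (N : ℕ) :
    tamariPolynomial (N + 1) = ∑ ij ∈ Finset.HasAntidiagonal.antidiagonal N, ∑ A ∈ tamariIntervals ij.1,
      ∑ c ∈ closedPrefixes (A.map Prod.fst), ∑ B ∈ tamariIntervals ij.2,
        X ^ (((closedPrefixes (A.map Prod.fst)).filter (c ≤ ·)).card +
          (closedPrefixes (B.map Prod.fst)).card) := by
  simp only [Finset.sum_sigma']
  symm
  refine Finset.sum_bij' (fun x _ => (x.2.2.1, x.1.1) :: (x.2.1 ++ x.2.2.2))
    (fun w _ => ⟨((w.headD 0).2, N - (w.headD 0).2), w.tail.take (w.headD 0).2, (w.headD 0).1,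
      w.tail.drop (w.headD 0).2⟩) ?_ ?_ ?_ ?_ ?_
  · rintro ⟨⟨i, j⟩, A, c, B⟩ h
    simp only [Finset.mem_sigma, Finset.HasAntidiagonal.mem_antidiagonal,
      mem_tamariIntervals] at h ⊢
    obtain ⟨rfl, ⟨rfl, hA⟩, hc, rfl, hB⟩ := h
    have h1 := hA.1.length_mem
    have h2 := hA.2.1.length_mem
    have hcA := (mem_closedPrefixes.1 hc).1
    rw [List.length_map] at h1 h2 hcA
    refine ⟨by simp, ?_⟩
    rw [isTamariInterval_cons, isTamariInterval_append h1 h2, List.map_append, List.map_append,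
      mem_closedPrefixes_append (by simpa using hcA), mem_closedPrefixes_append (by simp)]
    exact ⟨⟨hc, h2, hcA⟩, hA, hB⟩
  · intro w hw
    cases w with
    | nil => simp [mem_tamariIntervals] at hw
    | cons q w =>
      obtain ⟨d, e⟩ := q
      rw [mem_tamariIntervals, isTamariInterval_cons] at hw
      obtain ⟨hl, ⟨hd, he, hde⟩, hw⟩ := hw
      simp only [List.length_cons, Nat.add_right_cancel_iff] at hl
      simp only at hd he hde
      have heN := (mem_closedPrefixes.1 he).1
      rw [List.length_map] at heN
      obtain ⟨A, B, rfl, rfl⟩ : ∃ A B, w = A ++ B ∧ e = A.length :=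
        ⟨w.take e, w.drop e, (List.take_append_drop e w).symm, by simp [heN]⟩
      rw [List.map_append, mem_closedPrefixes_append (by simpa using hde)] at hd
      rw [List.map_append, mem_closedPrefixes_append (by simp)] at he
      have he1 : A.length ∈ closedPrefixes (A.map Prod.fst) := by
        rw [mem_closedPrefixes] at he ⊢
        refine ⟨by simp, fun j hj => ?_⟩
        have h1 := he.2 j hj
        have h2 := hw.2.2 A[j] (by simp)
        simp only [List.getD_eq_getElem?_getD, List.getElem?_map, List.getElem?_eq_getElem hj,
          Option.map_some, Option.getD_some] at h1 ⊢
        omega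
      rw [isTamariInterval_append he1 he] at hw
      simp only [List.length_append] at hl
      simp [mem_tamariIntervals, hw, hd]
      omega
  · rintro ⟨⟨i, j⟩, A, c, B⟩ h
    simp only [Finset.mem_sigma, Finset.HasAntidiagonal.mem_antidiagonal,
      mem_tamariIntervals] at h
    obtain ⟨rfl, ⟨rfl, hA⟩, hc, rfl, hB⟩ := h
    simp
  · intro w hw
    cases w with
    | nil => simp [mem_tamariIntervals] at hw
    | cons q w => simp
  · rintro ⟨⟨i, j⟩, A, c, B⟩ h
    simp only [Finset.mem_sigma, Finset.HasAntidiagonal.mem_antidiagonal,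
      mem_tamariIntervals] at h
    obtain ⟨rfl, ⟨rfl, hA⟩, hc, rfl, hB⟩ := h
    simp only [List.map_cons, List.map_append]
    rw [card_closedPrefixes_cons,
      card_filter_closedPrefixes_append hA.1.length_mem (mem_closedPrefixes.1 hc).1]

theorem sub_one_mul_tamariPolynomial_succ (N : ℕ) :
    (X - 1) * tamariPolynomial (N + 1) = ∑ ij ∈ Finset.HasAntidiagonal.antidiagonal N,
      X * (tamariPolynomial ij.1 - C ((tamariPolynomial ij.1).eval 1)) *
        tamariPolynomial ij.2 := by
  rw [tamariPolynomial_succ, Finset.mul_sum]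
  refine Finset.sum_congr rfl fun ij _ => ?_
  have h : C ((tamariPolynomial ij.1).eval 1) = ∑ w ∈ tamariIntervals ij.1, (1 : ℚ[X]) := by
    simp [tamariPolynomial, eval_finsetSum]
  rw [h, tamariPolynomial, ← Finset.sum_sub_distrib, Finset.mul_sum, Finset.mul_sum,
    Finset.sum_mul]
  refine Finset.sum_congr rfl fun A _ => ?_
  simp only [pow_add, ← Finset.mul_sum, ← Finset.sum_mul]
  rw [← mul_assoc, sum_pow_card_filter_le]
  rfl

theorem tamariPolynomial_catalytic_equation :
    PowerSeries.C (X - 1 : ℚ[X]) * (PowerSeries.mk tamariPolynomial - PowerSeries.C X) =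
      PowerSeries.X * PowerSeries.C X * PowerSeries.mk tamariPolynomial *
        (PowerSeries.mk tamariPolynomial -
          PowerSeries.map C (PowerSeries.map (evalRingHom 1) (PowerSeries.mk tamariPolynomial))) := by
  ext1 n
  cases n with
  | zero => simp [mul_assoc, tamariPolynomial, tamariIntervals, closedPrefixes]
  | succ n =>
    rw [PowerSeries.coeff_C_mul, map_sub, PowerSeries.coeff_mk, PowerSeries.coeff_C,
      if_neg n.succ_ne_zero, sub_zero, sub_one_mul_tamariPolynomial_succ, mul_assoc, mul_assoc,
      PowerSeries.coeff_succ_X_mul, PowerSeries.coeff_C_mul, mul_comm (PowerSeries.mk tamariPolynomial),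
      PowerSeries.coeff_mul, Finset.mul_sum]
    refine Finset.sum_congr rfl fun ij _ => ?_
    simp [mul_assoc]

theorem exists_orderIso_subgroup_of_card_eq_prime_pow {G : Type*} [CommGroup G] [IsCyclic G]
    [Finite G] {p n : ℕ} (hp : p.Prime) (hG : Nat.card G = p ^ n) :
    Nonempty (Fin (n + 1) ≃o Subgroup G) := by
  let f : Fin (n + 1) → Subgroup G := fun i => (powMonoidHom (p ^ (i : ℕ)) : G →* G).ker
  have hcard : ∀ i, Nat.card (f i) = p ^ (i : ℕ) := fun i => by
    rw [IsCyclic.card_powMonoidHom_ker, hG]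
    exact Nat.gcd_eq_right (pow_dvd_pow p (by omega))
  have hmono : Monotone f := by
    intro i j hij g hg
    obtain ⟨m, hm⟩ := pow_dvd_pow p (show (i : ℕ) ≤ j from hij)
    simp only [f, MonoidHom.mem_ker, powMonoidHom_apply] at hg ⊢
    rw [hm, pow_mul, hg, one_pow]
  have hinj : Function.Injective f := by
    intro i j hij
    have := hcard i
    rw [hij, hcard j] at this
    exact Fin.ext (Nat.pow_right_injective hp.two_le this).symm
  have hsurj : Function.Surjective f := by
    intro H
    obtain ⟨k, hk, hH⟩ := (Nat.dvd_prime_pow hp).1 (hG ▸ H.card_subgroup_dvd_card)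
    refine ⟨⟨k, by omega⟩, (Subgroup.eq_of_le_of_card_ge ?_ ?_).symm⟩
    · intro g hg
      have := pow_card_eq_one' (x := (⟨g, hg⟩ : H))
      rw [hH] at this
      simpa [f, MonoidHom.mem_ker] using congrArg Subtype.val this
    · rw [hcard, hH]
  exact ⟨(hmono.strictMono_of_injective hinj).orderIsoOfSurjective f hsurj⟩

section TransferSystem

variable {G : Type*} [CommGroup G] {N : ℕ} (φ : Fin N ≃o Subgroup G)

/-- The relation on a chain of subgroups relating `i` to `j` for `i ≤ j ≤ i + L i`. -/
def transferSystemOfList (L : List ℕ) : Set (Subgroup G × Subgroup G) :=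
  {q | φ.symm q.1 ≤ φ.symm q.2 ∧ (φ.symm q.2 : ℕ) ≤ φ.symm q.1 + L.getD (φ.symm q.1) 0}

theorem mk_mem_transferSystemOfList {L : List ℕ} {i j : Fin N} :
    (φ i, φ j) ∈ transferSystemOfList φ L ↔ i ≤ j ∧ (j : ℕ) ≤ i + L.getD i 0 := by
  simp [transferSystemOfList]

theorem isTransferSystem_transferSystemOfList {L : List ℕ} (hL : L.length = N)
    (h : IsBracketVector L) : IsTransferSystem (transferSystemOfList φ L) := by
  rw [isBracketVector_iff, hL] at h
  refine ⟨fun q hq => by simpa using hq.1, fun H => by simp [transferSystemOfList], ?_, ?_, ?_⟩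
  · rintro H K L' ⟨h1, h2⟩ ⟨h3, h4⟩
    simp only at h1 h2 h3 h4
    refine ⟨h1.trans h3, ?_⟩
    have := (h (φ.symm H) (φ.symm H).2).2 (φ.symm K) h1 h2
    simp only
    omega
  · intro H K hHK g
    have hconj : ∀ H : Subgroup G, H.map (MulAut.conj g).toMonoidHom = H := by
      intro H
      have : (MulAut.conj g).toMonoidHom = MonoidHom.id G := by ext; simp
      rw [this, Subgroup.map_id]
    rwa [hconj, hconj]
  · rintro H K L' ⟨h1, h2⟩ hLK
    rcases le_total (φ.symm H) (φ.symm L') with hHL | hHL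
    · have hHL' : H ≤ L' := by simpa using hHL
      rw [inf_eq_left.2 hHL']
      have hLK' : φ.symm L' ≤ φ.symm K := by simpa using hLK
      simp only at h2
      exact ⟨hHL, le_trans (show (φ.symm L' : ℕ) ≤ φ.symm K from hLK') h2⟩
    · have hHL' : L' ≤ H := by simpa using hHL
      rw [inf_eq_right.2 hHL']
      simp [transferSystemOfList]

theorem transferSystemOfList_subset_iff {L L' : List ℕ} (hL : L.length = N)
    (h : IsBracketVector L) : transferSystemOfList φ L ⊆ transferSystemOfList φ L' ↔
      ∀ i < N, L.getD i 0 ≤ L'.getD i 0 := by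
  rw [isBracketVector_iff, hL] at h
  constructor
  · intro hsub i hi
    have hlt := (h i hi).1
    have := hsub ((mk_mem_transferSystemOfList φ (i := ⟨i, hi⟩)
      (j := ⟨i + L.getD i 0, hlt⟩)).2 ⟨by simp [Fin.le_def], le_rfl⟩)
    rw [mk_mem_transferSystemOfList] at this
    have := this.2
    simp only at this
    omega
  · rintro hle q ⟨h1, h2⟩
    exact ⟨h1, h2.trans (Nat.add_le_add_left (hle _ (φ.symm q.1).2) _)⟩

theorem exists_eq_transferSystemOfList {T : Set (Subgroup G × Subgroup G)}
    (hT : IsTransferSystem T) : ∃ L : List ℕ, L.length = N ∧ IsBracketVector L ∧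
      transferSystemOfList φ L = T := by
  classical
  obtain ⟨hle, hrefl, htrans, -, hres⟩ := hT
  let R : ℕ → ℕ → Prop := fun i j => ∃ (hi : i < N) (hj : j < N), (φ ⟨i, hi⟩, φ ⟨j, hj⟩) ∈ T
  let f : ℕ → ℕ := fun i => Nat.findGreatest (fun d => R i (i + d)) N
  have hRf : ∀ i < N, R i (i + f i) := fun i hi =>
    Nat.findGreatest_spec (P := fun d => R i (i + d)) (Nat.zero_le N) ⟨hi, hi, hrefl _⟩
  have hfR : ∀ i j, i ≤ j → (R i j → j ≤ i + f i) := by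
    intro i j hij hR
    obtain ⟨d, rfl⟩ := Nat.exists_eq_add_of_le hij
    have : d ≤ N := by have := hR.2.1; omega
    exact Nat.add_le_add_left (Nat.le_findGreatest this hR) i
  have hRiff : ∀ i j, i < N → i ≤ j → (R i j ↔ j ≤ i + f i) := by
    intro i j hi hij
    refine ⟨hfR i j hij, fun hj => ?_⟩
    obtain ⟨_, hk, hmem⟩ := hRf i hi
    have := hres _ _ (φ ⟨j, by omega⟩) hmem (φ.monotone hj)
    rw [inf_eq_left.2 (φ.monotone (show (⟨i, hi⟩ : Fin N) ≤ ⟨j, _⟩ from hij))] at this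
    exact ⟨hi, _, this⟩
  have hget : ∀ i < N, (List.ofFn fun i : Fin N => f i).getD i 0 = f i := by
    intro i hi
    simp [List.getD_eq_getElem?_getD, hi]
  refine ⟨List.ofFn fun i : Fin N => f i, by simp, ?_, ?_⟩
  · rw [isBracketVector_iff, List.length_ofFn]
    intro i hi
    rw [hget i hi]
    have hlt := (hRf i hi).2.1
    refine ⟨hlt, fun j hij hj => ?_⟩
    rw [hget j (by omega)]
    obtain ⟨h1, h2, h3⟩ := (hRiff i j hi hij).2 hj
    obtain ⟨h4, h5, h6⟩ := hRf j (by omega)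
    exact hfR i _ (by omega) ⟨h1, h5, htrans _ _ _ h3 h6⟩
  · ext ⟨H, K⟩
    obtain ⟨i, rfl⟩ := φ.surjective H
    obtain ⟨j, rfl⟩ := φ.surjective K
    rw [mk_mem_transferSystemOfList, hget i i.2]
    constructor
    · rintro ⟨h1, h2⟩
      obtain ⟨_, _, h3⟩ := (hRiff i j i.2 h1).2 h2
      exact h3
    · intro h
      have hij : i ≤ j := by simpa using hle _ h
      exact ⟨hij, hfR i j hij ⟨i.2, j.2, h⟩⟩

theorem isTamariInterval_iff_forall_getD {w : List (ℕ × ℕ)} :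
    IsTamariInterval w ↔ IsBracketVector (w.map Prod.fst) ∧ IsBracketVector (w.map Prod.snd) ∧
      ∀ i < w.length, (w.map Prod.fst).getD i 0 ≤ (w.map Prod.snd).getD i 0 := by
  refine and_congr_right' (and_congr_right' ?_)
  rw [List.forall_mem_iff_forall_getElem]
  refine forall₂_congr fun i hi => ?_
  simp [List.getD_eq_getElem?_getD, List.getElem?_eq_getElem hi]

theorem transferSystemOfList_injOn {L L' : List ℕ} (hL : L.length = N) (hL' : L'.length = N)
    (h : IsBracketVector L) (h' : IsBracketVector L')
    (heq : transferSystemOfList φ L = transferSystemOfList φ L') : L = L' := by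
  refine List.ext_getElem (hL.trans hL'.symm) fun i hi hi' => ?_
  have h1 := (transferSystemOfList_subset_iff φ hL h).1 heq.subset i (by omega)
  have h2 := (transferSystemOfList_subset_iff φ hL' h').1 heq.superset i (by omega)
  rw [List.getD_eq_getElem _ _ hi, List.getD_eq_getElem _ _ hi'] at h1 h2
  exact le_antisymm h1 h2

end TransferSystem

theorem card_premodel_structures_of_orderIso {G : Type*} [CommGroup G] {N : ℕ}
    (φ : Fin N ≃o Subgroup G) :
    Nat.card {P : Set (Subgroup G × Subgroup G) × Set (Subgroup G × Subgroup G) //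
      IsTransferSystem P.1 ∧ IsTransferSystem P.2 ∧ P.1 ⊆ P.2} = (tamariIntervals N).card := by
  have hmem : ∀ w : tamariIntervals N, w.1.length = N ∧ IsBracketVector (w.1.map Prod.fst) ∧
      IsBracketVector (w.1.map Prod.snd) ∧
        ∀ i < N, (w.1.map Prod.fst).getD i 0 ≤ (w.1.map Prod.snd).getD i 0 := by
    rintro ⟨w, hw⟩
    obtain ⟨rfl, h⟩ := mem_tamariIntervals.1 hw
    exact ⟨rfl, isTamariInterval_iff_forall_getD.1 h⟩
  rw [← Fintype.card_coe, ← Nat.card_eq_fintype_card]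
  symm
  refine Nat.card_eq_of_bijective (fun w : tamariIntervals N =>
    ⟨(transferSystemOfList φ (w.1.map Prod.fst), transferSystemOfList φ (w.1.map Prod.snd)),
      isTransferSystem_transferSystemOfList φ (by simp [(hmem w).1]) (hmem w).2.1,
      isTransferSystem_transferSystemOfList φ (by simp [(hmem w).1]) (hmem w).2.2.1,
      (transferSystemOfList_subset_iff φ (by simp [(hmem w).1]) (hmem w).2.1).2 (hmem w).2.2.2⟩)
    ⟨?_, ?_⟩
  · intro w w' h
    simp only [Subtype.mk.injEq, Prod.mk.injEq] at h
    obtain ⟨hl, h1, h2, -⟩ := hmem w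
    obtain ⟨hl', h1', h2', -⟩ := hmem w'
    have e1 := transferSystemOfList_injOn φ (by simp [hl]) (by simp [hl']) h1 h1' h.1
    have e2 := transferSystemOfList_injOn φ (by simp [hl]) (by simp [hl']) h2 h2' h.2
    rw [Subtype.ext_iff]
    exact (List.zip_of_prod e1 e2).trans (List.zip_of_prod rfl rfl).symm
  · rintro ⟨⟨T, T'⟩, hT, hT', hsub⟩
    obtain ⟨L, hL, hbL, rfl⟩ := exists_eq_transferSystemOfList φ hT
    obtain ⟨L', hL', hbL', rfl⟩ := exists_eq_transferSystemOfList φ hT'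
    have e1 : (L.zip L').map Prod.fst = L := List.map_fst_zip (by omega)
    have e2 : (L.zip L').map Prod.snd = L' := List.map_snd_zip (by omega)
    have hlen : (L.zip L').length = N := by simp [hL, hL']
    refine ⟨⟨L.zip L', mem_tamariIntervals.2 ⟨hlen, isTamariInterval_iff_forall_getD.2 ?_⟩⟩, ?_⟩
    · rw [e1, e2, hlen]
      exact ⟨hbL, hbL', (transferSystemOfList_subset_iff φ hL hbL).1 hsub⟩
    · simp only [e1, e2]

theorem card_tamariIntervals_mul (n : ℕ) : (tamariIntervals (n + 1)).card *
    ((n + 2).factorial * (3 * n + 5).factorial) = 2 * (4 * n + 5).factorial := by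
  obtain ⟨B, hB⟩ := exists_eq_one_add_X_mul_pow_four ℚ
  have h := congrArg (PowerSeries.coeff (n + 1))
    (map_eval_one_of_catalytic_equation hB tamariPolynomial_catalytic_equation)
  rw [PowerSeries.coeff_map, PowerSeries.coeff_mk, coe_evalRingHom, map_sub,
    show (2 : PowerSeries ℚ) = PowerSeries.C 2 from (map_ofNat _ 2).symm,
    PowerSeries.coeff_C_mul] at h
  have hcard : (tamariPolynomial (n + 1)).eval 1 = ((tamariIntervals (n + 1)).card : ℚ) := by
    simp [tamariPolynomial, eval_finsetSum]
  rw [hcard] at h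
  have h2 := coeff_pow_of_eq_one_add_X_mul_pow_four hB n 2
  have h3 := coeff_pow_of_eq_one_add_X_mul_pow_four hB n 3
  rw [show 3 * n + 3 + 3 = (3 * n + 5) + 1 by ring, show 4 * n + 3 + 3 = (4 * n + 5) + 1 by ring,
    Nat.factorial_succ (3 * n + 5), Nat.factorial_succ (4 * n + 5)] at h3
  rw [show 3 * n + 3 + 2 = 3 * n + 5 by ring, show 4 * n + 3 + 2 = 4 * n + 5 by ring] at h2
  rw [Nat.factorial_succ (n + 1)]
  have hq : ((tamariIntervals (n + 1)).card : ℚ) * (((n + 1 + 1 : ℕ) * (n + 1).factorial) *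
      (3 * n + 5).factorial) = 2 * (4 * n + 5).factorial := by
    rw [h]
    push_cast at h2 h3 ⊢
    linear_combination (2 * (n + 2) : ℚ) * h2 - (1 / 3 : ℚ) * h3
  exact_mod_cast hq

/-- The number of premodel structures on `Sub(C_{p^n})`, i.e. pairs `(T, T')` of
transfer systems for `C_{p^n}` with `T ⊆ T'`, equals
`2 * (4n+5)! / ((n+2)! * (3n+5)!)` (stated here in multiplied-out form). -/
theorem card_premodel_structures_cyclic_prime_pow (p n : ℕ) (hp : p.Prime) :
    Nat.card {P : Set (Subgroup (Multiplicative (ZMod (p ^ n))) ×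
          Subgroup (Multiplicative (ZMod (p ^ n)))) ×
        Set (Subgroup (Multiplicative (ZMod (p ^ n))) ×
          Subgroup (Multiplicative (ZMod (p ^ n)))) //
        IsTransferSystem P.1 ∧ IsTransferSystem P.2 ∧ P.1 ⊆ P.2} *
      ((n + 2).factorial * (3 * n + 5).factorial) = 2 * (4 * n + 5).factorial := by
  have : NeZero (p ^ n) := ⟨pow_ne_zero n hp.ne_zero⟩
  obtain ⟨φ⟩ := exists_orderIso_subgroup_of_card_eq_prime_pow
    (G := Multiplicative (ZMod (p ^ n))) (n := n) hp (by simp [Nat.card_eq_fintype_card, ZMod.card])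
  rw [card_premodel_structures_of_orderIso φ]
  exact card_tamariIntervals_mul n
end

section
/- For every prime p and every natural number n, the number of composition closed premodel structures on Sub(C_{p^n}) equals the Fuss–Catalan number A_{n+1}(3,1) = (1/(3n+4))·binom(3n+4, n+1). -/
/-- The pairs `(A, B)` with `A ≤ B` having the left lifting property against `T`:
for every `(C, D) ∈ T` with `A ≤ C` and `B ≤ D` one has `B ≤ C`. -/
def leftSet {G : Type*} [Group G] (T : Set (Subgroup G × Subgroup G)) :
    Set (Subgroup G × Subgroup G) :=
  {p | p.1 ≤ p.2 ∧ ∀ q ∈ T, p.1 ≤ q.1 → p.2 ≤ q.2 → p.2 ≤ q.1}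

/-- The weak equivalences of the premodel structure with acyclic fibrations `T` and
fibrations `T'`: pairs `(A, B)` with `A ≤ B` factoring as an acyclic cofibration
followed by an acyclic fibration. -/
def weakEquivalences {G : Type*} [Group G] (T T' : Set (Subgroup G × Subgroup G)) :
    Set (Subgroup G × Subgroup G) :=
  {p | p.1 ≤ p.2 ∧ ∃ M : Subgroup G, p.1 ≤ M ∧ M ≤ p.2 ∧
    (p.1, M) ∈ leftSet T' ∧ (M, p.2) ∈ T}

/-- A premodel structure `(T, T')` is composition closed if its weak equivalences
are closed under composition. -/
def CompositionClosed {G : Type*} [Group G] (T T' : Set (Subgroup G × Subgroup G)) : Prop :=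
  ∀ A B C : Subgroup G, (A, B) ∈ weakEquivalences T T' → (B, C) ∈ weakEquivalences T T' →
    (A, C) ∈ weakEquivalences T T'

namespace NestedChain

open Finset

/-- The coefficient of `x ^ m` in `F ^ r`, where `F = 1 + x * F ^ 3`. -/
def ternaryPowCoeff : ℕ → ℕ → ℕ
  | _, 0 => 1
  | 0, _ + 1 => 0
  | r + 1, m + 1 => ternaryPowCoeff r (m + 1) + ternaryPowCoeff (r + 3) m
termination_by r m => (m, r)

@[simp] theorem ternaryPowCoeff_zero_right (r : ℕ) : ternaryPowCoeff r 0 = 1 := by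
  simp [ternaryPowCoeff]

@[simp] theorem ternaryPowCoeff_zero_succ (m : ℕ) : ternaryPowCoeff 0 (m + 1) = 0 := by
  simp [ternaryPowCoeff]

theorem ternaryPowCoeff_succ_succ (r m : ℕ) :
    ternaryPowCoeff (r + 1) (m + 1) = ternaryPowCoeff r (m + 1) + ternaryPowCoeff (r + 3) m := by
  rw [ternaryPowCoeff]

theorem sum_antidiagonal_ternaryPowCoeff (r s m : ℕ) :
    ∑ ij ∈ antidiagonal m, ternaryPowCoeff r ij.1 * ternaryPowCoeff s ij.2 =
      ternaryPowCoeff (r + s) m := by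
  induction m generalizing r s with
  | zero => simp
  | succ m ihm =>
    induction r with
    | zero => simp [Nat.sum_antidiagonal_succ]
    | succ r ihr =>
      rw [Nat.sum_antidiagonal_succ] at ihr ⊢
      simp only [ternaryPowCoeff_zero_right, ternaryPowCoeff_succ_succ, add_mul,
        sum_add_distrib, ihm] at ihr ⊢
      rw [← add_assoc, ihr, show r + 1 + s = r + s + 1 by ring, ternaryPowCoeff_succ_succ,
        show r + 3 + s = r + s + 3 by ring]

theorem ternaryPowCoeff_mul (r m : ℕ) :
    ternaryPowCoeff r m * (3 * m + r) = r * (3 * m + r).choose m := by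
  induction m generalizing r with
  | zero => simp
  | succ m ihm =>
    induction r with
    | zero => simp
    | succ r ihr =>
      have h := ihm (r + 3)
      have hc := Nat.choose_succ_right_eq (3 * m + r + 3) m
      rw [show 3 * m + r + 3 - m = 2 * m + r + 3 by omega] at hc
      rw [show 3 * (m + 1) + (r + 1) = 3 * m + r + 3 + 1 by ring, ternaryPowCoeff_succ_succ,
        Nat.choose_succ_succ]
      rw [show 3 * (m + 1) + r = 3 * m + r + 3 by ring] at ihr
      rw [show 3 * m + (r + 3) = 3 * m + r + 3 by ring] at h
      apply Nat.eq_of_mul_eq_mul_left (show 0 < 3 * m + r + 3 by omega)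
      zify at *
      linear_combination (3 * (m : ℤ) + r + 4) * (ihr + h) - 3 * hc

theorem ternaryPowCoeff_one_succ (N : ℕ) :
    ternaryPowCoeff 1 (N + 1) = ∑ ij ∈ antidiagonal N, ternaryPowCoeff 1 ij.1 *
      ∑ kl ∈ antidiagonal ij.2, ternaryPowCoeff 1 kl.1 * ternaryPowCoeff 1 kl.2 := by
  simp [sum_antidiagonal_ternaryPowCoeff, ternaryPowCoeff_succ_succ 0]

theorem exists_orderIso_subgroup_fin (p n : ℕ) (hp : p.Prime) :
    Nonempty (Subgroup (Multiplicative (ZMod (p ^ n))) ≃o Fin (n + 1)) := by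
  have : Fact p.Prime := ⟨hp⟩
  have : NeZero (p ^ n) := ⟨(pow_pos hp.pos n).ne'⟩
  have hcard : Nat.card (Multiplicative (ZMod (p ^ n))) = p ^ n := by simp
  have key (H : Subgroup (Multiplicative (ZMod (p ^ n)))) : ∃ k ≤ n, Nat.card H = p ^ k := by
    rw [← Nat.dvd_prime_pow hp]
    exact H.card_subgroup_dvd_card.trans hcard.dvd
  choose f hfn hf using key
  have mem_iff (K : Subgroup (Multiplicative (ZMod (p ^ n)))) (x) : x ^ p ^ f K = 1 ↔ x ∈ K := by
    classical
    have hsub : (K : Set (Multiplicative (ZMod (p ^ n)))).toFinset ⊆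
        univ.filter fun x => x ^ p ^ f K = 1 := by
      intro y hy
      simp only [Set.mem_toFinset, SetLike.mem_coe] at hy
      simp only [mem_filter, mem_univ, true_and, ← hf K]
      exact congrArg Subtype.val (pow_card_eq_one' (x := (⟨y, hy⟩ : K)))
    have := eq_of_subset_of_card_le hsub <| by
      refine (IsCyclic.card_pow_eq_one_le (pow_pos hp.pos _)).trans ?_
      rw [← hf K, Set.toFinset_card, ← Nat.card_eq_fintype_card]
      rfl
    simpa using (Finset.ext_iff.mp this x).symm
  refine ⟨RelIso.ofSurjective (OrderEmbedding.ofMapLEIff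
    (fun H => (⟨f H, Nat.lt_succ_of_le (hfn H)⟩ : Fin (n + 1))) ?_) ?_⟩
  · intro H K
    rw [Fin.mk_le_mk]
    constructor
    · intro h x hx
      rw [← mem_iff] at hx ⊢
      obtain ⟨c, hc⟩ := pow_dvd_pow p h
      rw [hc, pow_mul, hx, one_pow]
    · intro h
      have := Subgroup.card_le_of_le h
      rwa [hf, hf, Nat.pow_le_pow_iff_right hp.one_lt] at this
  · intro k
    obtain ⟨H, hH⟩ := Sylow.exists_subgroup_card_pow_prime p (n := k)
      (hcard ▸ pow_dvd_pow p (Nat.le_of_lt_succ k.2))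
    refine ⟨H, Fin.ext (Nat.pow_right_injective hp.two_le ?_)⟩
    exact (hf H).symm.trans hH

/-- `r` is the identity outside `[a, b)`, preserves `[0, b)`, and the intervals `[i, r i]` are
pairwise nested or disjoint. On a chain, such functions encode transfer systems. -/
structure IsNestedOn (a b : ℕ) (r : ℕ → ℕ) : Prop where
  le_apply : ∀ i, i ≤ r i
  apply_le : ∀ i j, i ≤ j → j ≤ r i → r j ≤ r i
  apply_lt : ∀ i < b, r i < b
  eq_of_lt : ∀ i < a, r i = i
  eq_of_le : ∀ i, b ≤ i → r i = i

/-- Pairs of nested functions on `[a, b)` such that the fibres of the first refine those of the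
second. -/
def nestedPairs (a b : ℕ) : Set ((ℕ → ℕ) × (ℕ → ℕ)) :=
  {P | IsNestedOn a b P.1 ∧ IsNestedOn a b P.2 ∧ ∀ i, P.2 (P.1 i) = P.2 i}

theorem nestedPairs_finite (a b : ℕ) : (nestedPairs a b).Finite := by
  refine Set.Finite.of_injOn (f := fun P (i : Fin b) => (P.1 i, P.2 i))
    (t := {g | ∀ i, g i ∈ Set.Iio b ×ˢ Set.Iio b}) ?_ ?_
    (Set.Finite.pi' fun _ => (Set.finite_Iio b).prod (Set.finite_Iio b))
  · exact fun P hP i => ⟨hP.1.apply_lt i i.2, hP.2.1.apply_lt i i.2⟩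
  · rintro P ⟨h1, h2, -⟩ Q ⟨h1', h2', -⟩ h
    have (i : ℕ) : P.1 i = Q.1 i ∧ P.2 i = Q.2 i := by
      rcases lt_or_ge i b with hi | hi
      · simpa using congrFun h ⟨i, hi⟩
      · exact ⟨(h1.eq_of_le i hi).trans (h1'.eq_of_le i hi).symm,
          (h2.eq_of_le i hi).trans (h2'.eq_of_le i hi).symm⟩
    exact Prod.ext (funext fun i => (this i).1) (funext fun i => (this i).2)

/-- Glues nested functions on `(a, k]`, `(k, k']` and `(k', b)` into one sending `a` to `k`. -/
def glueFine (a k k' : ℕ) (r s t : ℕ → ℕ) (i : ℕ) : ℕ :=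
  if i = a then k else if i ≤ k then r i else if i ≤ k' then s i else t i

/-- Glues nested functions on `(a, k]`, `(k, k']` and `(k', b)` into one sending `a` to `k'`,
merging the fibre of `k` into the fibre of `k'`. -/
def glueCoarse (a k k' : ℕ) (r s t : ℕ → ℕ) (i : ℕ) : ℕ :=
  if i = a then k' else if i ≤ k then if r i = k then k' else r i
  else if i ≤ k' then s i else t i

/-- The truncation of `r` to `[a, b)`. -/
def cut (a b : ℕ) (r : ℕ → ℕ) (i : ℕ) : ℕ :=
  if a ≤ i ∧ i < b then min (r i) (b - 1) else i

variable {a b k k' : ℕ} {r s t r' s' t' : ℕ → ℕ}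

theorem IsNestedOn.glueFine (hr : IsNestedOn (a + 1) (k + 1) r)
    (hs : IsNestedOn (k + 1) (k' + 1) s) (ht : IsNestedOn (k' + 1) b t)
    (hak : a ≤ k) (hkk : k ≤ k') (hkb : k' < b) :
    IsNestedOn a b (glueFine a k k' r s t) := by
  constructor <;> intro i <;> unfold NestedChain.glueFine <;>
    have hr1 := hr.le_apply i <;> have hr3 := hr.apply_lt i <;> have hr4 := hr.eq_of_lt i <;>
    have hs1 := hs.le_apply i <;> have hs3 := hs.apply_lt i <;>
    have ht1 := ht.le_apply i <;> have ht3 := ht.apply_lt i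
  · split_ifs <;> omega
  · intro j
    have hr3' := hr.apply_lt j
    have hs3' := hs.apply_lt j
    have hr2 := hr.apply_le i j
    have hs2 := hs.apply_le i j
    have ht2 := ht.apply_le i j
    split_ifs <;> omega
  · split_ifs <;> omega
  · split_ifs <;> omega
  · have ht5 := ht.eq_of_le i
    split_ifs <;> omega

theorem IsNestedOn.glueCoarse (hr : IsNestedOn (a + 1) (k + 1) r)
    (hs : IsNestedOn (k + 1) (k' + 1) s) (ht : IsNestedOn (k' + 1) b t)
    (hak : a ≤ k) (hkk : k ≤ k') (hkb : k' < b) :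
    IsNestedOn a b (glueCoarse a k k' r s t) := by
  constructor <;> intro i <;> unfold NestedChain.glueCoarse <;>
    have hr1 := hr.le_apply i <;> have hr3 := hr.apply_lt i <;> have hr4 := hr.eq_of_lt i <;>
    have hs1 := hs.le_apply i <;> have hs3 := hs.apply_lt i <;>
    have ht1 := ht.le_apply i <;> have ht3 := ht.apply_lt i
  · split_ifs <;> omega
  · intro j
    have hr1' := hr.le_apply j
    have hr3' := hr.apply_lt j
    have hs3' := hs.apply_lt j
    have hr2 := hr.apply_le i j
    have hs2 := hs.apply_le i j
    have ht2 := ht.apply_le i j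
    split_ifs <;> omega
  · split_ifs <;> omega
  · split_ifs <;> omega
  · have ht5 := ht.eq_of_le i
    split_ifs <;> omega

theorem IsNestedOn.cut (hr : IsNestedOn a b r) (c d : ℕ) : IsNestedOn c d (cut c d r) := by
  constructor <;> intro i <;> unfold NestedChain.cut <;> have hr1 := hr.le_apply i
  · split_ifs <;> omega
  · intro j
    have hr2 := hr.apply_le i j
    split_ifs <;> omega
  all_goals split_ifs <;> omega

theorem glueCoarse_glueFine (hr : IsNestedOn (a + 1) (k + 1) r)
    (hs : IsNestedOn (k + 1) (k' + 1) s) (ht : IsNestedOn (k' + 1) b t)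
    (hr' : IsNestedOn (a + 1) (k + 1) r')
    (hak : a ≤ k) (hkk : k ≤ k') (hrr : ∀ i, r' (r i) = r' i) (hss : ∀ i, s' (s i) = s' i)
    (htt : ∀ i, t' (t i) = t' i) (i : ℕ) :
    glueCoarse a k k' r' s' t' (glueFine a k k' r s t i) = glueCoarse a k k' r' s' t' i := by
  have hr1 := hr.le_apply i
  have hr3 := hr.apply_lt i
  have hr4 := hr.eq_of_lt i
  have hs1 := hs.le_apply i
  have hs3 := hs.apply_lt i
  have ht1 := ht.le_apply i
  rcases eq_or_ne i a with rfl | hia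
  · have hk1 := hr'.le_apply k
    have hk3 := hr'.apply_lt k
    simp only [glueFine, glueCoarse, if_true]
    split_ifs <;> omega
  rcases le_or_gt i k with hik | hik
  · have h : r i ≠ a := by omega
    have h' : r i ≤ k := by omega
    simp [glueFine, glueCoarse, hia, hik, h, h', hrr]
  rcases le_or_gt i k' with hik' | hik'
  · have h : s i ≠ a := by omega
    have h' : ¬ s i ≤ k := by omega
    have h'' : s i ≤ k' := by omega
    simp [glueFine, glueCoarse, hia, hik.not_ge, hik', h, h', h'', hss]
  · have h : t i ≠ a := by omega
    have h' : ¬ t i ≤ k := by omega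
    have h'' : ¬ t i ≤ k' := by omega
    simp [glueFine, glueCoarse, hia, hik.not_ge, hik'.not_ge, h, h', h'', htt]

theorem cut_comp (hr : IsNestedOn a b r) (hr' : IsNestedOn a b r')
    (h : ∀ i, r' (r i) = r' i) (c d i : ℕ) : cut c d r' (cut c d r i) = cut c d r' i := by
  unfold cut
  by_cases hi : c ≤ i ∧ i < d
  · have h1 := hr.le_apply i
    have h2 := h i
    have h3 := hr'.le_apply (r i)
    rcases le_or_gt (r i) (d - 1) with h4 | h4
    · rw [if_pos hi, min_eq_left h4, if_pos (by omega), h2, if_pos hi]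
    · have := hr'.le_apply (d - 1)
      rw [if_pos hi, min_eq_right h4.le, if_pos (by omega), if_pos hi]
      omega
  · simp only [if_neg hi]

theorem glueFine_cut (hr : IsNestedOn a b r) (hr' : IsNestedOn a b r') (h : ∀ i, r' (r i) = r' i)
    (hk : r a = k) (hk' : r' a = k') :
    glueFine a k k' (cut (a + 1) (k + 1) r) (cut (k + 1) (k' + 1) r) (cut (k' + 1) b r) = r := by
  subst hk hk'
  funext i
  have h1 := hr.le_apply i
  have h2 := hr.apply_le a i
  have h3 := hr'.apply_le a i
  have h4 := hr'.le_apply (r i)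
  have h5 := h i
  have h6 := hr.apply_lt i
  have h7 := hr.eq_of_lt i
  have h8 := hr.eq_of_le i
  have h9 := hr'.le_apply (r a)
  have h10 := h a
  rcases eq_or_ne i a with rfl | hia
  · simp [glueFine]
  · simp only [glueFine, cut, if_neg hia]
    split_ifs <;> omega

theorem glueCoarse_cut (hr : IsNestedOn a b r) (hr' : IsNestedOn a b r')
    (h : ∀ i, r' (r i) = r' i) (hk : r a = k) (hk' : r' a = k') :
    glueCoarse a k k' (cut (a + 1) (k + 1) r') (cut (k + 1) (k' + 1) r') (cut (k' + 1) b r') =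
      r' := by
  subst hk hk'
  funext i
  have h1 := hr'.le_apply i
  have h2 := hr'.apply_le a i
  have h3 := hr'.apply_le i (r a)
  have h4 := hr.le_apply a
  have h6 := hr'.apply_lt i
  have h7 := hr'.eq_of_lt i
  have h8 := hr'.eq_of_le i
  have h9 := hr'.le_apply (r a)
  have h10 := h a
  rcases eq_or_ne i a with rfl | hia
  · simp [glueCoarse]
  · simp only [glueCoarse, cut, if_neg hia]
    split_ifs <;> omega

theorem cut_glueFine (hr : IsNestedOn (a + 1) (k + 1) r)
    (hs : IsNestedOn (k + 1) (k' + 1) s) (ht : IsNestedOn (k' + 1) b t)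
    (hak : a ≤ k) (hkk : k ≤ k') :
    cut (a + 1) (k + 1) (glueFine a k k' r s t) = r ∧
      cut (k + 1) (k' + 1) (glueFine a k k' r s t) = s ∧
      cut (k' + 1) b (glueFine a k k' r s t) = t := by
  refine ⟨funext fun i => ?_, funext fun i => ?_, funext fun i => ?_⟩ <;>
    simp only [glueFine, cut]
  · have h1 := hr.apply_lt i
    have h2 := hr.eq_of_lt i
    have h3 := hr.eq_of_le i
    split_ifs <;> omega
  · have h1 := hs.apply_lt i
    have h2 := hs.eq_of_lt i
    have h3 := hs.eq_of_le i
    split_ifs <;> omega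
  · have h1 := ht.apply_lt i
    have h2 := ht.eq_of_lt i
    have h3 := ht.eq_of_le i
    split_ifs <;> omega

theorem cut_glueCoarse (hr : IsNestedOn (a + 1) (k + 1) r)
    (hs : IsNestedOn (k + 1) (k' + 1) s) (ht : IsNestedOn (k' + 1) b t)
    (hak : a ≤ k) (hkk : k ≤ k') :
    cut (a + 1) (k + 1) (glueCoarse a k k' r s t) = r ∧
      cut (k + 1) (k' + 1) (glueCoarse a k k' r s t) = s ∧
      cut (k' + 1) b (glueCoarse a k k' r s t) = t := by
  refine ⟨funext fun i => ?_, funext fun i => ?_, funext fun i => ?_⟩ <;>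
    simp only [glueCoarse, cut]
  · have h1 := hr.apply_lt i
    have h2 := hr.eq_of_lt i
    have h3 := hr.eq_of_le i
    split_ifs <;> omega
  · have h1 := hs.apply_lt i
    have h2 := hs.eq_of_lt i
    have h3 := hs.eq_of_le i
    split_ifs <;> omega
  · have h1 := ht.apply_lt i
    have h2 := ht.eq_of_lt i
    have h3 := ht.eq_of_le i
    split_ifs <;> omega

theorem cut_mem_nestedPairs {P : (ℕ → ℕ) × (ℕ → ℕ)} (hP : P ∈ nestedPairs a b) (c d : ℕ) :
    (cut c d P.1, cut c d P.2) ∈ nestedPairs c d :=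
  ⟨hP.1.cut c d, hP.2.1.cut c d, cut_comp hP.1 hP.2.1 hP.2.2 c d⟩

/-- `nestedPairs a b` as a `Finset`. -/
noncomputable def nestedPairsFinset (a b : ℕ) : Finset ((ℕ → ℕ) × (ℕ → ℕ)) :=
  (nestedPairs_finite a b).toFinset

theorem mem_nestedPairsFinset {P : (ℕ → ℕ) × (ℕ → ℕ)} :
    P ∈ nestedPairsFinset a b ↔ P ∈ nestedPairs a b := by
  simp [nestedPairsFinset]

theorem card_nestedPairsFinset_filter (hak : a ≤ k) (hkk : k ≤ k') (hkb : k' < b) :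
    #{P ∈ nestedPairsFinset a b | P.1 a = k ∧ P.2 a = k'} =
      #(nestedPairsFinset (a + 1) (k + 1)) *
        (#(nestedPairsFinset (k + 1) (k' + 1)) * #(nestedPairsFinset (k' + 1) b)) := by
  rw [← card_product, ← card_product]
  refine card_nbij'
    (fun P => ((cut (a + 1) (k + 1) P.1, cut (a + 1) (k + 1) P.2),
      (cut (k + 1) (k' + 1) P.1, cut (k + 1) (k' + 1) P.2), (cut (k' + 1) b P.1, cut (k' + 1) b P.2)))
    (fun Q => (glueFine a k k' Q.1.1 Q.2.1.1 Q.2.2.1, glueCoarse a k k' Q.1.2 Q.2.1.2 Q.2.2.2))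
    ?_ ?_ ?_ ?_
  · intro P hP
    simp only [coe_filter, Set.mem_ofPred_eq, mem_nestedPairsFinset] at hP
    simp only [coe_product, Set.mem_prod, mem_coe, mem_nestedPairsFinset]
    exact ⟨cut_mem_nestedPairs hP.1 _ _, cut_mem_nestedPairs hP.1 _ _, cut_mem_nestedPairs hP.1 _ _⟩
  · rintro ⟨⟨r, r'⟩, ⟨s, s'⟩, ⟨t, t'⟩⟩ hQ
    simp only [coe_product, Set.mem_prod, mem_coe, mem_nestedPairsFinset] at hQ
    obtain ⟨⟨hr, hr', hrr⟩, ⟨hs, hs', hss⟩, ⟨ht, ht', htt⟩⟩ := hQ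
    simp only [coe_filter, Set.mem_ofPred_eq, mem_nestedPairsFinset]
    exact ⟨⟨hr.glueFine hs ht hak hkk hkb, hr'.glueCoarse hs' ht' hak hkk hkb,
      glueCoarse_glueFine hr hs ht hr' hak hkk hrr hss htt⟩, by simp [glueFine],
      by simp [glueCoarse]⟩
  · intro P hP
    simp only [coe_filter, Set.mem_ofPred_eq, mem_nestedPairsFinset] at hP
    obtain ⟨⟨h, h', hh⟩, hk, hk'⟩ := hP
    exact Prod.ext (glueFine_cut h h' hh hk hk') (glueCoarse_cut h h' hh hk hk')
  · rintro ⟨⟨r, r'⟩, ⟨s, s'⟩, ⟨t, t'⟩⟩ hQ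
    simp only [coe_product, Set.mem_prod, mem_coe, mem_nestedPairsFinset] at hQ
    obtain ⟨⟨hr, hr', hrr⟩, ⟨hs, hs', hss⟩, ⟨ht, ht', htt⟩⟩ := hQ
    obtain ⟨h1, h2, h3⟩ := cut_glueFine hr hs ht hak hkk
    obtain ⟨h1', h2', h3'⟩ := cut_glueCoarse hr' hs' ht' hak hkk
    simp only [h1, h2, h3, h1', h2', h3']

theorem nestedPairs_self (a : ℕ) : nestedPairs a a = {(id, id)} := by
  ext P
  simp only [Set.mem_singleton_iff]
  constructor
  · rintro ⟨h, h', -⟩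
    refine Prod.ext (funext fun i => ?_) (funext fun i => ?_)
    · exact (lt_or_ge i a).elim (h.eq_of_lt i) (h.eq_of_le i)
    · exact (lt_or_ge i a).elim (h'.eq_of_lt i) (h'.eq_of_le i)
  · rintro rfl
    have : IsNestedOn a a id := by constructor <;> simp
    exact ⟨this, this, fun i => rfl⟩

theorem card_nestedPairsFinset (N a : ℕ) :
    #(nestedPairsFinset a (a + N)) = ternaryPowCoeff 1 N := by
  induction N using Nat.strong_induction_on generalizing a with
  | _ N ih =>
  rcases N with _ | N
  · simp [nestedPairsFinset, nestedPairs_self]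
  rw [card_eq_sum_card_fiberwise
    (f := fun P => (⟨(P.1 a - a, a + N - P.1 a), (P.2 a - P.1 a, a + N - P.2 a)⟩ :
      Σ _ : ℕ × ℕ, ℕ × ℕ))
    (t := (antidiagonal N).sigma fun ij => antidiagonal ij.2), sum_sigma, ternaryPowCoeff_one_succ]
  · refine sum_congr rfl fun ij hij => ?_
    rw [mul_sum]
    refine sum_congr rfl fun kl hkl => ?_
    obtain ⟨i, m⟩ := ij
    obtain ⟨j, l⟩ := kl
    simp only [HasAntidiagonal.mem_antidiagonal] at hij hkl
    have := card_nestedPairsFinset_filter (a := a) (k := a + i) (k' := a + i + j)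
      (b := a + (N + 1)) (by omega) (by omega) (by omega)
    rw [show a + i + 1 = a + 1 + i by ring, ih i (by omega),
      show a + i + j + 1 = a + 1 + i + j by ring, ih j (by omega),
      show a + (N + 1) = a + 1 + i + j + l by omega, ih l (by omega)] at this
    rw [← this, show a + 1 + i + j + l = a + (N + 1) by omega]
    congr 1
    refine filter_congr fun P hP => ?_
    rw [mem_nestedPairsFinset] at hP
    obtain ⟨h, h', hh⟩ := hP
    have h1 := h.le_apply a
    have h2 := h'.le_apply (P.1 a)
    have h3 := hh a
    have h4 := h'.apply_lt a
    simp only [Sigma.mk.injEq, Prod.mk.injEq, heq_eq_eq]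
    omega
  · intro P hP
    rw [mem_coe, mem_nestedPairsFinset] at hP
    obtain ⟨h, h', hh⟩ := hP
    have h1 := h.le_apply a
    have h2 := h'.le_apply (P.1 a)
    have h3 := hh a
    have h4 := h'.apply_lt a
    simp only [coe_sigma, Set.mem_sigma_iff, mem_coe, HasAntidiagonal.mem_antidiagonal]
    omega

theorem comp_eq_iff_weak_comp {N : ℕ} (hr : IsNestedOn 0 N r) (hr' : IsNestedOn 0 N r')
    (W : ℕ → ℕ → Prop)
    (hW : ∀ x y, W x y ↔
      ∃ m, x ≤ m ∧ m ≤ y ∧ (∀ i, x ≤ i → i < m → r' i < m) ∧ y ≤ r m) :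
    ((∀ i, r i ≤ r' i) ∧
        ∀ x y z, x < N → y < N → z < N → W x y → W y z → W x z) ↔
      ∀ i, r' (r i) = r' i := by
  constructor
  · rintro ⟨hle, hcomp⟩ i
    refine le_antisymm (hr'.apply_le i (r i) (hr.le_apply i) (hle i)) ?_
    by_contra! hlt
    have h1 := hr.le_apply i
    have h2 := hr'.le_apply (r i)
    have hiN : i < N := by
      by_contra! h
      rw [hr.eq_of_le i h] at hlt
      exact hlt.false
    have hr'N := hr'.apply_lt i hiN
    have hW1 : W i (r i) := (hW _ _).2 ⟨i, le_rfl, h1, fun x _ _ => by omega, le_rfl⟩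
    have hW2 : W (r i) (r' (r i) + 1) := by
      refine (hW _ _).2 ⟨r' (r i) + 1, by omega, le_rfl, fun x hx hx' => ?_, hr.le_apply _⟩
      exact Nat.lt_succ_of_le (hr'.apply_le _ _ hx (by omega))
    obtain ⟨m, hm1, hm2, hm3, hm4⟩ := (hW _ _).1
      (hcomp i (r i) (r' (r i) + 1) hiN (by omega) (by omega) hW1 hW2)
    rcases hm1.eq_or_lt with rfl | h
    · omega
    · have := hm3 i le_rfl h
      omega
  · intro h
    have hle (i) : r i ≤ r' i := (hr'.le_apply (r i)).trans_eq (h i)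
    refine ⟨hle, fun x y z _ _ _ hxy hyz => ?_⟩
    obtain ⟨m₁, h1, h2, h3, h4⟩ := (hW _ _).1 hxy
    obtain ⟨m₂, h5, h6, h7, h8⟩ := (hW _ _).1 hyz
    rw [hW]
    rcases le_or_gt m₂ (r m₁) with hm | hm
    · have := hr.apply_le m₁ m₂ (by omega) hm
      exact ⟨m₁, h1, by omega, h3, by omega⟩
    · refine ⟨m₂, by omega, h6, fun i hxi hi => ?_, h8⟩
      rcases lt_or_ge i m₁ with hi' | hi'
      · have := h3 i hxi hi'
        omega
      rcases lt_or_ge i y with hiy | hiy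
      · have h9 := hle m₁
        have h10 := hr'.apply_le m₁ i hi' (by omega)
        have h11 := h7 (r m₁) h4 hm
        have h12 := h m₁
        omega
      · exact h7 i hiy hi

section Transfer

variable {G : Type*} [CommGroup G] {n : ℕ} (e : Subgroup G ≃o Fin (n + 1))

/-- The relation on `Subgroup G` in which `H` is related to the subgroups from `H` to
position `r (e H)` of the chain. -/
def nestedRel (r : ℕ → ℕ) : Set (Subgroup G × Subgroup G) :=
  {q | q.1 ≤ q.2 ∧ (e q.2 : ℕ) ≤ r (e q.1)}

theorem coe_orderIso_le_iff {H K : Subgroup G} : (e H : ℕ) ≤ e K ↔ H ≤ K := by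
  rw [Fin.val_fin_le, e.le_iff_le]

theorem exists_coe_orderIso_eq {i : ℕ} (hi : i < n + 1) : ∃ H, (e H : ℕ) = i :=
  ⟨e.symm ⟨i, hi⟩, by simp⟩

theorem isTransferSystem_nestedRel (hr : IsNestedOn 0 (n + 1) r) :
    IsTransferSystem (nestedRel e r) := by
  refine ⟨fun q hq => hq.1, fun H => ⟨le_rfl, hr.le_apply _⟩, ?_, ?_, ?_⟩
  · intro H K L hHK hKL
    exact ⟨hHK.1.trans hKL.1, hKL.2.trans
      (hr.apply_le _ _ ((coe_orderIso_le_iff e).2 hHK.1) hHK.2)⟩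
  · intro H K hHK g
    have : (MulAut.conj g).toMonoidHom = MonoidHom.id G := by
      ext x
      simp
    simpa only [this, Subgroup.map_id] using hHK
  · intro H K L hHK hLK
    rcases le_total (e H) (e L) with h | h <;> rw [e.le_iff_le] at h
    · rw [inf_eq_left.2 h]
      exact ⟨h, ((coe_orderIso_le_iff e).2 hLK).trans hHK.2⟩
    · rw [inf_eq_right.2 h]
      exact ⟨le_rfl, hr.le_apply _⟩

theorem exists_nestedRel_eq {T : Set (Subgroup G × Subgroup G)} (hT : IsTransferSystem T) :
    ∃ r, IsNestedOn 0 (n + 1) r ∧ nestedRel e r = T := by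
  obtain ⟨hle, hrefl, htrans, -, hres⟩ := hT
  have : Finite (Subgroup G) := Finite.of_equiv _ e.symm.toEquiv
  have hmax (H : Subgroup G) : ∃ K, (H, K) ∈ T ∧ ∀ L, (H, L) ∈ T → (e L : ℕ) ≤ e K :=
    Set.exists_max_image {K | (H, K) ∈ T} (fun K => (e K : ℕ)) (Set.toFinite _) ⟨H, hrefl H⟩
  choose m hmT hm using hmax
  have hmem (H K : Subgroup G) : (H, K) ∈ T ↔ H ≤ K ∧ (e K : ℕ) ≤ e (m H) := by
    refine ⟨fun h => ⟨hle _ h, hm _ _ h⟩, fun ⟨h, h'⟩ => ?_⟩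
    simpa [inf_eq_left.2 h] using hres H (m H) K (hmT H) ((coe_orderIso_le_iff e).1 h')
  let r (i : ℕ) : ℕ := if h : i < n + 1 then e (m (e.symm ⟨i, h⟩)) else i
  have hr (H : Subgroup G) : r (e H) = e (m H) := dif_pos (e H).2 |>.trans (by simp)
  have hri (i : ℕ) (hi : n + 1 ≤ i) : r i = i := dif_neg hi.not_gt
  refine ⟨r, ⟨fun i => ?_, fun i j hij hj => ?_, fun i hi => ?_, by simp, hri⟩, ?_⟩
  · rcases lt_or_ge i (n + 1) with hi | hi
    · obtain ⟨H, rfl⟩ := exists_coe_orderIso_eq e hi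
      rw [hr, coe_orderIso_le_iff]
      exact hle _ (hmT H)
    · exact (hri i hi).ge
  · rcases lt_or_ge i (n + 1) with hi | hi
    · obtain ⟨H, rfl⟩ := exists_coe_orderIso_eq e hi
      rw [hr] at hj ⊢
      obtain ⟨K, rfl⟩ := exists_coe_orderIso_eq e (hj.trans_lt (e (m H)).2)
      rw [hr]
      exact hm _ _ (htrans H K _ ((hmem H K).2 ⟨(coe_orderIso_le_iff e).1 hij, hj⟩) (hmT K))
    · rw [hri i hi] at hj
      rw [le_antisymm hj hij]
  · obtain ⟨H, rfl⟩ := exists_coe_orderIso_eq e hi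
    rw [hr]
    exact (e (m H)).2
  · ext ⟨H, K⟩
    rw [hmem, ← hr]
    rfl

theorem nestedRel_subset_iff (hr : IsNestedOn 0 (n + 1) r) (hs : IsNestedOn 0 (n + 1) s) :
    nestedRel e r ⊆ nestedRel e s ↔ ∀ i, r i ≤ s i := by
  refine ⟨fun h i => ?_, fun h q hq => ⟨hq.1, hq.2.trans (h _)⟩⟩
  rcases lt_or_ge i (n + 1) with hi | hi
  · obtain ⟨K, hK⟩ := exists_coe_orderIso_eq e (hr.apply_lt i hi)
    obtain ⟨H, rfl⟩ := exists_coe_orderIso_eq e hi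
    rw [← hK]
    refine (@h (H, K) ⟨?_, hK.le⟩).2
    rw [← coe_orderIso_le_iff e, hK]
    exact hr.le_apply _
  · rw [hr.eq_of_le i hi, hs.eq_of_le i hi]

theorem nestedRel_injOn : Set.InjOn (nestedRel e) {r | IsNestedOn 0 (n + 1) r} := by
  intro r hr s hs h
  exact funext fun i => le_antisymm ((nestedRel_subset_iff e hr hs).1 h.subset i)
    ((nestedRel_subset_iff e hs hr).1 h.superset i)

theorem mem_leftSet_nestedRel {A M : Subgroup G} :
    (A, M) ∈ leftSet (nestedRel e r) ↔
      A ≤ M ∧ ∀ i, (e A : ℕ) ≤ i → i < e M → r i < e M := by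
  refine and_congr_right fun hAM => ⟨fun h i hAi hiM => ?_, fun h q hq hAC hMD => ?_⟩
  · obtain ⟨C, rfl⟩ := exists_coe_orderIso_eq e (hiM.trans (e M).2)
    by_contra! hM
    refine hiM.not_ge ((coe_orderIso_le_iff e).2 (h (C, M) ⟨?_, hM⟩ ?_ le_rfl))
    · exact (coe_orderIso_le_iff e).1 hiM.le
    · exact (coe_orderIso_le_iff e).1 hAi
  · by_contra hMC
    rw [← coe_orderIso_le_iff e, not_le] at hMC
    have h1 := h _ ((coe_orderIso_le_iff e).2 hAC) hMC
    have h2 := (coe_orderIso_le_iff e).2 hMD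
    exact (h1.trans_le (h2.trans hq.2)).false

theorem mem_weakEquivalences_nestedRel {A B : Subgroup G} :
    (A, B) ∈ weakEquivalences (nestedRel e r) (nestedRel e r') ↔
      ∃ m, (e A : ℕ) ≤ m ∧ m ≤ e B ∧ (∀ i, (e A : ℕ) ≤ i → i < m → r' i < m) ∧
        (e B : ℕ) ≤ r m := by
  constructor
  · rintro ⟨-, M, hAM, hMB, hL, hR⟩
    exact ⟨e M, (coe_orderIso_le_iff e).2 hAM, (coe_orderIso_le_iff e).2 hMB,
      ((mem_leftSet_nestedRel e).1 hL).2, hR.2⟩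
  · rintro ⟨m, h1, h2, h3, h4⟩
    obtain ⟨M, rfl⟩ := exists_coe_orderIso_eq e (h2.trans_lt (e B).2)
    rw [coe_orderIso_le_iff] at h1 h2
    exact ⟨h1.trans h2, M, h1, h2, (mem_leftSet_nestedRel e).2 ⟨h1, h3⟩, h2, h4⟩

theorem compositionClosed_nestedRel_iff (hr : IsNestedOn 0 (n + 1) r)
    (hr' : IsNestedOn 0 (n + 1) r') :
    (nestedRel e r ⊆ nestedRel e r' ∧ CompositionClosed (nestedRel e r) (nestedRel e r')) ↔
      ∀ i, r' (r i) = r' i := by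
  rw [← comp_eq_iff_weak_comp hr hr' _ fun _ _ => Iff.rfl, nestedRel_subset_iff e hr hr']
  refine and_congr_right fun _ => ⟨fun h x y z hx hy hz => ?_, fun h A B C => ?_⟩
  · obtain ⟨A, rfl⟩ := exists_coe_orderIso_eq e hx
    obtain ⟨B, rfl⟩ := exists_coe_orderIso_eq e hy
    obtain ⟨C, rfl⟩ := exists_coe_orderIso_eq e hz
    simpa only [mem_weakEquivalences_nestedRel] using h A B C
  · simpa only [mem_weakEquivalences_nestedRel] using h _ _ _ (e A).2 (e B).2 (e C).2

theorem card_compositionClosed_eq (e : Subgroup G ≃o Fin (n + 1)) :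
    Nat.card {P : Set (Subgroup G × Subgroup G) × Set (Subgroup G × Subgroup G) //
        IsTransferSystem P.1 ∧ IsTransferSystem P.2 ∧ P.1 ⊆ P.2 ∧
          CompositionClosed P.1 P.2} = #(nestedPairsFinset 0 (n + 1)) := by
  rw [← Nat.card_eq_finsetCard]
  symm
  refine Nat.card_eq_of_bijective (fun Q => ⟨(nestedRel e Q.1.1, nestedRel e Q.1.2), ?_⟩) ⟨?_, ?_⟩
  · obtain ⟨hr, hr', h⟩ := mem_nestedPairsFinset.1 Q.2
    exact ⟨isTransferSystem_nestedRel e hr, isTransferSystem_nestedRel e hr',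
      (compositionClosed_nestedRel_iff e hr hr').2 h⟩
  · rintro ⟨Q, hQ⟩ ⟨Q', hQ'⟩ h
    rw [mem_nestedPairsFinset] at hQ hQ'
    simp only [Subtype.mk.injEq, Prod.mk.injEq] at h
    exact Subtype.ext (Prod.ext (nestedRel_injOn e hQ.1 hQ'.1 h.1)
      (nestedRel_injOn e hQ.2.1 hQ'.2.1 h.2))
  · rintro ⟨⟨T, T'⟩, hT, hT', h⟩
    obtain ⟨r, hr, rfl⟩ := exists_nestedRel_eq e hT
    obtain ⟨r', hr', rfl⟩ := exists_nestedRel_eq e hT'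
    exact ⟨⟨(r, r'), mem_nestedPairsFinset.2
      ⟨hr, hr', (compositionClosed_nestedRel_iff e hr hr').1 h⟩⟩, rfl⟩

end Transfer

end NestedChain

/-- The number of composition closed premodel structures on `Sub(C_{p^n})` equals the
Fuss–Catalan number `A_{n+1}(3,1) = (1/(3n+4)) * binom(3n+4, n+1)`
(stated here in multiplied-out form). -/
theorem card_composition_closed_premodel_cyclic_prime_pow (p n : ℕ) (hp : p.Prime) :
    Nat.card {P : Set (Subgroup (Multiplicative (ZMod (p ^ n))) ×
          Subgroup (Multiplicative (ZMod (p ^ n)))) ×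
        Set (Subgroup (Multiplicative (ZMod (p ^ n))) ×
          Subgroup (Multiplicative (ZMod (p ^ n)))) //
        IsTransferSystem P.1 ∧ IsTransferSystem P.2 ∧ P.1 ⊆ P.2 ∧
          CompositionClosed P.1 P.2} * (3 * n + 4) =
      Nat.choose (3 * n + 4) (n + 1) := by
  obtain ⟨e⟩ := NestedChain.exists_orderIso_subgroup_fin p n hp
  have h := NestedChain.ternaryPowCoeff_mul 1 (n + 1)
  have hc := NestedChain.card_nestedPairsFinset (n + 1) 0
  rw [zero_add] at hc
  rwa [NestedChain.card_compositionClosed_eq e, hc,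
    show 3 * n + 4 = 3 * (n + 1) + 1 by ring, ← one_mul (Nat.choose _ _)]
end

section
/- For every prime p and every natural number n, the number of Quillen model structures on Sub(C_{p^n}) equals the central binomial-type number binom(2n+1, n). -/
/-- A premodel structure `(T, T')` is a Quillen model structure if its weak
equivalences satisfy two-out-of-three. -/
def IsQuillen {G : Type*} [Group G] (T T' : Set (Subgroup G × Subgroup G)) : Prop :=
  ∀ A B C : Subgroup G, A ≤ B → B ≤ C →
    ((A, B) ∈ weakEquivalences T T' → (B, C) ∈ weakEquivalences T T' →
      (A, C) ∈ weakEquivalences T T') ∧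
    ((A, B) ∈ weakEquivalences T T' → (A, C) ∈ weakEquivalences T T' →
      (B, C) ∈ weakEquivalences T T') ∧
    ((B, C) ∈ weakEquivalences T T' → (A, C) ∈ weakEquivalences T T' →
      (A, B) ∈ weakEquivalences T T')

namespace ChainTransfer

open Finset

/-! ### Transfer systems and convex equivalences on a chain -/

/-- A transfer system on a chain. -/
structure IsTransfer {α : Type*} [LinearOrder α] (R : α → α → Prop) : Prop where
  le : ∀ {i j}, R i j → i ≤ j
  refl : ∀ i, R i i
  trans : ∀ {i j k}, R i j → R j k → R i k
  restrict : ∀ {i j k}, R i j → i ≤ k → k ≤ j → R i k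

/-- The `≤`-part of an equivalence relation with convex classes. -/
structure IsConvex {α : Type*} [LinearOrder α] (W : α → α → Prop) : Prop extends IsTransfer W where
  right : ∀ {i j k}, W i j → i ≤ k → k ≤ j → W k j

/-- The left lifting relation of a transfer system on a chain. -/
def LeftRel {α : Type*} [LinearOrder α] (R : α → α → Prop) (a b : α) : Prop :=
  a ≤ b ∧ ∀ c, a ≤ c → c < b → ¬ R c b

/-- The weak equivalences of the premodel structure `(R, R')` on a chain. -/
def WeakRel {α : Type*} [LinearOrder α] (R R' : α → α → Prop) (a b : α) : Prop :=
  ∃ m, LeftRel R' a m ∧ R m b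

/-- Two-out-of-three for a relation contained in `≤`. -/
def TwoOfThree {α : Type*} [LinearOrder α] (W : α → α → Prop) : Prop :=
  ∀ a b c, a ≤ b → b ≤ c →
    (W a b → W b c → W a c) ∧ (W a b → W a c → W b c) ∧ (W b c → W a c → W a b)

/-- The fibrations of the model structure with acyclic fibrations `R` and weak equivalences `W`. -/
def FibRel {α : Type*} [LinearOrder α] (R W : α → α → Prop) (c d : α) : Prop :=
  c ≤ d ∧ ∀ b, c < b → b ≤ d → ¬ (LeftRel R c b ∧ W c b)

section Structure

variable {α : Type*} [LinearOrder α] {R R' W : α → α → Prop}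

lemma LeftRel.mono_left {a b c : α} (h : LeftRel R a b) (hac : a ≤ c) (hcb : c ≤ b) :
    LeftRel R c b :=
  ⟨hcb, fun d hd hdb => h.2 d (hac.trans hd) hdb⟩

lemma LeftRel.anti (hRR' : ∀ i j, R i j → R' i j) {a b : α} (h : LeftRel R' a b) :
    LeftRel R a b :=
  ⟨h.1, fun c hc hcb hR => h.2 c hc hcb (hRR' _ _ hR)⟩

lemma LeftRel.eq_of_rel {a b : α} (h : LeftRel R a b) (hab : R a b) : a = b :=
  h.1.eq_or_lt.resolve_right fun hlt => h.2 a le_rfl hlt hab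

lemma leftRel_refl (a : α) : LeftRel R a a :=
  ⟨le_rfl, fun _ hc hca => absurd hca hc.not_gt⟩

lemma IsTransfer.exists_leftRel_rel [Finite α] (hR : IsTransfer R) {a b : α} (hab : a ≤ b) :
    ∃ m, LeftRel R a m ∧ R m b := by
  have hne : {m | a ≤ m ∧ R m b}.Nonempty := ⟨b, hab, hR.refl b⟩
  obtain ⟨m, hm⟩ := (Set.toFinite {m | a ≤ m ∧ R m b}).exists_minimal hne
  refine ⟨m, ⟨hm.prop.1, fun c hac hcm hRc => ?_⟩, hm.prop.2⟩
  exact hcm.not_ge (hm.le_of_le ⟨hac, hR.trans hRc hm.prop.2⟩ hcm.le)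

lemma weakRel_of_rel {a b : α} (h : R a b) : WeakRel R R' a b :=
  ⟨a, leftRel_refl a, h⟩

lemma IsTransfer.weakRel_of_leftRel (hR : IsTransfer R) {a b : α} (h : LeftRel R' a b) :
    WeakRel R R' a b :=
  ⟨b, h, hR.refl b⟩

lemma WeakRel.le (hR : IsTransfer R) {a b : α} (h : WeakRel R R' a b) : a ≤ b := by
  obtain ⟨m, h₁, h₂⟩ := h
  exact h₁.1.trans (hR.le h₂)

lemma WeakRel.convex (hR : IsTransfer R) (hW : TwoOfThree (WeakRel R R')) {a k b : α}
    (h : WeakRel R R' a b) (hak : a ≤ k) (hkb : k ≤ b) :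
    WeakRel R R' a k ∧ WeakRel R R' k b := by
  have key : WeakRel R R' a k := by
    obtain ⟨m, h₁, h₂⟩ := h
    rcases le_total k m with hkm | hmk
    · exact (hW a k m hak hkm).2.2 (hR.weakRel_of_leftRel (h₁.mono_left hak hkm))
        (hR.weakRel_of_leftRel h₁)
    · exact (hW a m k h₁.1 hmk).1 (hR.weakRel_of_leftRel h₁)
        (weakRel_of_rel (hR.restrict h₂ hmk hkb))
  exact ⟨key, (hW a k b hak hkb).2.1 key h⟩

lemma isConvex_weakRel (hR : IsTransfer R) (hW : TwoOfThree (WeakRel R R')) :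
    IsConvex (WeakRel R R') where
  le h := h.le hR
  refl i := weakRel_of_rel (hR.refl i)
  trans h₁ h₂ := (hW _ _ _ (h₁.le hR) (h₂.le hR)).1 h₁ h₂
  restrict h h₁ h₂ := (h.convex hR hW h₁ h₂).1
  right h h₁ h₂ := (h.convex hR hW h₁ h₂).2

lemma IsConvex.twoOfThree (hW : IsConvex W) : TwoOfThree W := fun _ _ _ hab hbc =>
  ⟨hW.trans, fun _ h => hW.right h hab hbc, fun _ h => hW.restrict h hab hbc⟩

lemma leftRel_and_weakRel_iff (hR : IsTransfer R) (hRR' : ∀ i j, R i j → R' i j) {a b : α} :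
    LeftRel R a b ∧ WeakRel R R' a b ↔ LeftRel R' a b := by
  refine ⟨fun ⟨h, m, h₁, h₂⟩ => ?_, fun h => ⟨h.anti hRR', hR.weakRel_of_leftRel h⟩⟩
  rcases (hR.le h₂).eq_or_lt with rfl | hlt
  · exact h₁
  · exact absurd h₂ (h.2 m h₁.1 hlt)

lemma fibRel_weakRel [Finite α] (hR : IsTransfer R) (hR' : IsTransfer R')
    (hRR' : ∀ i j, R i j → R' i j) : FibRel R (WeakRel R R') = R' := by
  ext c d
  simp only [FibRel, leftRel_and_weakRel_iff hR hRR']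
  constructor
  · rintro ⟨hcd, h⟩
    obtain ⟨m, h₁, h₂⟩ := hR'.exists_leftRel_rel hcd
    rcases h₁.1.eq_or_lt with rfl | hlt
    · exact h₂
    · exact absurd h₁ (h m hlt (hR'.le h₂))
  · exact fun h => ⟨hR'.le h, fun b hcb hbd hL =>
      hcb.ne (hL.eq_of_rel (hR'.restrict h hcb.le hbd))⟩

lemma IsConvex.isTransfer_fibRel (hW : IsConvex W) : IsTransfer (FibRel R W) where
  le h := h.1
  refl i := ⟨le_rfl, fun _ h₁ h₂ => absurd h₁ h₂.not_gt⟩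
  trans {i j k} h₁ h₂ := ⟨h₁.1.trans h₂.1, fun b hib hbk ⟨hL, hWb⟩ => by
    rcases le_or_gt b j with hbj | hjb
    · exact h₁.2 b hib hbj ⟨hL, hWb⟩
    · exact h₂.2 b hjb hbk ⟨hL.mono_left h₁.1 hjb.le, hW.right hWb h₁.1 hjb.le⟩⟩
  restrict h h₁ h₂ := ⟨h₁, fun b hib hbk => h.2 b hib (hbk.trans h₂)⟩

lemma IsTransfer.fibRel (hR : IsTransfer R) {i j : α} (h : R i j) : FibRel R W i j :=
  ⟨hR.le h, fun _ hib hbj ⟨hL, _⟩ => hib.ne (hL.eq_of_rel (hR.restrict h hib.le hbj))⟩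

lemma leftRel_fibRel_iff [Finite α] (hR : IsTransfer R) (hW : IsConvex W) {a b : α} :
    LeftRel (FibRel R W) a b ↔ LeftRel R a b ∧ W a b := by
  constructor
  · intro h
    refine ⟨h.anti fun _ _ => hR.fibRel, ?_⟩
    by_contra hab
    have hne : {c | a ≤ c ∧ c ≤ b ∧ ¬ W c b}.Nonempty := ⟨a, le_rfl, h.1, hab⟩
    obtain ⟨c, hc⟩ := (Set.toFinite {c | a ≤ c ∧ c ≤ b ∧ ¬ W c b}).exists_maximal hne
    obtain ⟨hac, hcb, hWc⟩ := hc.prop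
    have hlt : c < b := hcb.lt_of_ne (by rintro rfl; exact hWc (hW.refl _))
    refine h.2 c hac hlt ⟨hcb, fun d hcd hdb ⟨_, hWd⟩ => ?_⟩
    by_cases hd : W d b
    · exact hWc (hW.trans hWd hd)
    · exact hcd.not_ge (hc.le_of_ge ⟨hac.trans hcd.le, hdb, hd⟩ hcd.le)
  · exact fun ⟨h, hWab⟩ => ⟨h.1, fun c hac hcb hF =>
      hF.2 b hcb le_rfl ⟨h.mono_left hac hcb.le, hW.right hWab hac hcb.le⟩⟩

lemma weakRel_fibRel [Finite α] (hR : IsTransfer R) (hW : IsConvex W)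
    (hRW : ∀ i j, R i j → W i j) : WeakRel R (FibRel R W) = W := by
  ext a b
  simp only [WeakRel, leftRel_fibRel_iff hR hW]
  constructor
  · rintro ⟨m, ⟨_, h₁⟩, h₂⟩
    exact hW.trans h₁ (hRW _ _ h₂)
  · intro h
    obtain ⟨m, h₁, h₂⟩ := hR.exists_leftRel_rel (hW.le h)
    exact ⟨m, ⟨h₁, hW.restrict h h₁.1 (hR.le h₂)⟩, h₂⟩

end Structure

/-- Quillen model structures on a finite chain correspond to pairs of a transfer system and a
convex equivalence relation containing it. -/
def quillenEquiv (α : Type*) [LinearOrder α] [Finite α] :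
    {P : (α → α → Prop) × (α → α → Prop) // IsTransfer P.1 ∧ IsTransfer P.2 ∧
      (∀ i j, P.1 i j → P.2 i j) ∧ TwoOfThree (WeakRel P.1 P.2)} ≃
    (Σ R : {R : α → α → Prop // IsTransfer R},
      {W : α → α → Prop // IsConvex W ∧ ∀ i j, R.1 i j → W i j}) where
  toFun P := ⟨⟨P.1.1, P.2.1⟩, WeakRel P.1.1 P.1.2, isConvex_weakRel P.2.1 P.2.2.2.2,
    fun _ _ => weakRel_of_rel⟩
  invFun Q := ⟨(Q.1.1, FibRel Q.1.1 Q.2.1), Q.1.2, Q.2.2.1.isTransfer_fibRel,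
    fun _ _ => Q.1.2.fibRel, by
      simpa only [weakRel_fibRel Q.1.2 Q.2.2.1 Q.2.2.2] using Q.2.2.1.twoOfThree⟩
  left_inv P := Subtype.ext (Prod.ext rfl (fibRel_weakRel P.2.1 P.2.2.1 P.2.2.2.1))
  right_inv Q := by
    obtain ⟨R, W, hW⟩ := Q
    exact Sigma.ext rfl (heq_of_eq (Subtype.ext (weakRel_fibRel R.2 hW.1 hW.2)))

/-! ### Closed endpoints and convex equivalences -/

open Classical in
/-- The elements `e` such that no relation starts at or before `e` and ends after `e`. -/
noncomputable def endpoints {α : Type*} [LinearOrder α] [Fintype α] (R : α → α → Prop) :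
    Finset α :=
  {e | ∀ i ≤ e, ∀ j, R i j → j ≤ e}

lemma mem_endpoints {α : Type*} [LinearOrder α] [Fintype α] {R : α → α → Prop} {e : α} :
    e ∈ endpoints R ↔ ∀ i ≤ e, ∀ j, R i j → j ≤ e := by
  simp [endpoints]

/-- The convex equivalence whose classes end at the elements of `E`. -/
def sepRel {α : Type*} [LinearOrder α] (E : Finset α) (i j : α) : Prop :=
  i ≤ j ∧ ∀ e ∈ E, i ≤ e → j ≤ e

section Endpoints

variable {α : Type*} [LinearOrder α]

lemma isConvex_sepRel (E : Finset α) : IsConvex (sepRel E) where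
  le h := h.1
  refl _ := ⟨le_rfl, fun _ _ h => h⟩
  trans h₁ h₂ := ⟨h₁.1.trans h₂.1, fun e he hi => h₂.2 e he (h₁.2 e he hi)⟩
  restrict h h₁ h₂ := ⟨h₁, fun e he hi => h₂.trans (h.2 e he hi)⟩
  right h h₁ h₂ := ⟨h₂, fun e he hi => h.2 e he (h₁.trans hi)⟩

variable [Fintype α]

lemma endpoints_sepRel [OrderTop α] {E : Finset α} (hE : ⊤ ∈ E) : endpoints (sepRel E) = E := by
  ext e
  rw [mem_endpoints]
  refine ⟨fun h => ?_, fun he i hi j hij => hij.2 e he hi⟩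
  have hne : {x | x ∈ E ∧ e ≤ x}.Nonempty := ⟨⊤, hE, le_top⟩
  obtain ⟨x, hx⟩ := (Set.toFinite {x | x ∈ E ∧ e ≤ x}).exists_minimal hne
  have hxe : x ≤ e := h e le_rfl x ⟨hx.prop.2, fun y hy hey =>
    (le_total x y).elim id fun hyx => hx.le_of_le ⟨hy, hey⟩ hyx⟩
  exact le_antisymm hxe hx.prop.2 ▸ hx.prop.1

lemma sepRel_endpoints {W : α → α → Prop} (hW : IsConvex W) : sepRel (endpoints W) = W := by
  ext i j
  refine ⟨fun ⟨hij, h⟩ => ?_, fun h => ⟨hW.le h, fun e he hi => mem_endpoints.1 he i hi j h⟩⟩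
  have hne : {x | W i x}.Nonempty := ⟨i, hW.refl i⟩
  obtain ⟨e, he⟩ := (Set.toFinite {x | W i x}).exists_maximal hne
  have hie : i ≤ e := hW.le he.prop
  refine hW.restrict he.prop hij (h e (mem_endpoints.2 fun k hk l hkl => ?_) hie)
  rcases le_or_gt l e with hle | hlt
  · exact hle
  · exact he.le_of_ge (hW.trans he.prop (hW.right hkl hk hlt.le)) hlt.le

lemma top_mem_endpoints [OrderTop α] (R : α → α → Prop) : ⊤ ∈ endpoints R :=
  mem_endpoints.2 fun _ _ _ _ => le_top

/-- Convex equivalences containing `R` correspond to sets of endpoints of `R` containing `⊤`. -/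
noncomputable def convexEquiv [OrderTop α] {R : α → α → Prop} (hR : IsTransfer R) :
    {W : α → α → Prop // IsConvex W ∧ ∀ i j, R i j → W i j} ≃
      (Finset.Icc {⊤} (endpoints R) : Finset (Finset α)) where
  toFun W := ⟨endpoints W.1, Finset.mem_Icc.2 ⟨Finset.singleton_subset_iff.2 (top_mem_endpoints _),
    fun _ he => mem_endpoints.2 fun i hi j hij => mem_endpoints.1 he i hi j (W.2.2 i j hij)⟩⟩
  invFun E := ⟨sepRel E.1, isConvex_sepRel _, fun _ _ hij => ⟨hR.le hij, fun _ he hi =>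
    mem_endpoints.1 ((Finset.mem_Icc.1 E.2).2 he) _ hi _ hij⟩⟩
  left_inv W := Subtype.ext (sepRel_endpoints W.2.1)
  right_inv E := Subtype.ext
    (endpoints_sepRel (Finset.singleton_subset_iff.1 (Finset.mem_Icc.1 E.2).1))

lemma two_mul_card_convex [OrderTop α] {R : α → α → Prop} (hR : IsTransfer R) :
    2 * Nat.card {W : α → α → Prop // IsConvex W ∧ ∀ i j, R i j → W i j} =
      2 ^ #(endpoints R) := by
  have htop := top_mem_endpoints R
  rw [Nat.card_congr (convexEquiv hR), Nat.card_eq_fintype_card, Fintype.card_coe,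
    Finset.card_Icc_finset (Finset.singleton_subset_iff.2 htop), Finset.card_singleton,
    mul_pow_sub_one (Finset.card_ne_zero_of_mem htop)]

end Endpoints

/-! ### Enumerating transfer systems by adjoining a least element -/

section Extension

variable {N : ℕ}

/-- The possible targets of a new least element adjoined to a transfer system. -/
noncomputable def targets (R : Fin N → Fin N → Prop) : Finset (Fin (N + 1)) :=
  insert 0 ((endpoints R).map (Fin.succEmb N))

/-- Adjoin a new least element, related exactly to the elements up to `c`. -/
def extend (R : Fin N → Fin N → Prop) (c : Fin (N + 1)) : Fin (N + 1) → Fin (N + 1) → Prop :=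
  Fin.cases (fun j => j ≤ c) fun i => Fin.cases False (R i)

@[simp] lemma extend_zero (R : Fin N → Fin N → Prop) (c j : Fin (N + 1)) :
    extend R c 0 j ↔ j ≤ c := Iff.rfl

@[simp] lemma extend_succ_zero (R : Fin N → Fin N → Prop) (c : Fin (N + 1)) (i : Fin N) :
    ¬ extend R c i.succ 0 := id

@[simp] lemma extend_succ_succ (R : Fin N → Fin N → Prop) (c : Fin (N + 1)) (i j : Fin N) :
    extend R c i.succ j.succ ↔ R i j := Iff.rfl

@[simp] lemma zero_mem_targets (R : Fin N → Fin N → Prop) : 0 ∈ targets R :=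
  Finset.mem_insert_self _ _

@[simp] lemma succ_mem_targets {R : Fin N → Fin N → Prop} {e : Fin N} :
    e.succ ∈ targets R ↔ e ∈ endpoints R := by
  simp [targets, Fin.succ_ne_zero]

lemma card_targets (R : Fin N → Fin N → Prop) : #(targets R) = #(endpoints R) + 1 := by
  rw [targets, Finset.card_insert_of_notMem (by simp [Fin.succ_ne_zero]), Finset.card_map]

lemma IsTransfer.extend {R : Fin N → Fin N → Prop} (hR : IsTransfer R) {c : Fin (N + 1)}
    (hc : c ∈ targets R) : IsTransfer (extend R c) where
  le {i j} h := by
    cases i using Fin.cases with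
    | zero => exact Fin.zero_le _
    | succ i =>
      cases j using Fin.cases with
      | zero => exact h.elim
      | succ j => exact Fin.succ_le_succ_iff.2 (hR.le h)
  refl i := by
    cases i using Fin.cases with
    | zero => exact Fin.zero_le _
    | succ i => exact hR.refl i
  trans {i j k} h₁ h₂ := by
    cases j using Fin.cases with
    | zero =>
      cases i using Fin.cases with
      | zero => exact h₂
      | succ i => exact h₁.elim
    | succ j =>
      cases k using Fin.cases with
      | zero => exact h₂.elim
      | succ k =>
        cases i using Fin.cases with
        | zero =>
          cases c using Fin.cases with
          | zero => exact absurd h₁ (by simp)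
          | succ c =>
            simp only [extend_zero, extend_succ_succ, Fin.succ_le_succ_iff, succ_mem_targets,
              mem_endpoints] at *
            exact hc j h₁ k h₂
        | succ i => exact hR.trans h₁ h₂
  restrict {i j k} h h₁ h₂ := by
    cases i using Fin.cases with
    | zero => exact h₂.trans h
    | succ i =>
      cases j using Fin.cases with
      | zero => exact h.elim
      | succ j =>
        cases k using Fin.cases with
        | zero => exact absurd h₁ (by simp)
        | succ k => exact hR.restrict h (Fin.succ_le_succ_iff.1 h₁) (Fin.succ_le_succ_iff.1 h₂)

lemma endpoints_extend (R : Fin N → Fin N → Prop) (c : Fin (N + 1)) :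
    endpoints (extend R c) = {e ∈ targets R | c ≤ e} := by
  ext e
  rw [mem_endpoints, Finset.mem_filter, Fin.forall_fin_succ]
  have h₀ : (0 ≤ e → ∀ j, extend R c 0 j → j ≤ e) ↔ c ≤ e :=
    ⟨fun h => h (Fin.zero_le _) c le_rfl, fun h _ j hj => le_trans hj h⟩
  rw [h₀, and_comm]
  refine and_congr_left fun _ => ?_
  cases e using Fin.cases with
  | zero => simp
  | succ e => simp [Fin.forall_fin_succ, mem_endpoints]

/-- Every transfer system on `Fin (N + 1)` arises uniquely by adjoining a least element. -/
lemma bijective_extend (N : ℕ) : Function.Bijective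
    (fun x : (Σ R : {R : Fin N → Fin N → Prop // IsTransfer R}, targets R.1) =>
      (⟨extend x.1.1 x.2.1, x.1.2.extend x.2.2⟩ :
        {R : Fin (N + 1) → Fin (N + 1) → Prop // IsTransfer R})) := by
  constructor
  · rintro ⟨⟨R, hR⟩, c, hc⟩ ⟨⟨R', hR'⟩, c', hc'⟩ h
    have h' : extend R c = extend R' c' := congrArg Subtype.val h
    obtain rfl : R = R' := by
      ext i j
      rw [← extend_succ_succ R c, h', extend_succ_succ]
    obtain rfl : c = c' := by
      apply le_antisymm
      · rw [← extend_zero R c', ← h', extend_zero]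
      · rw [← extend_zero R c, h', extend_zero]
    rfl
  · rintro ⟨R, hR⟩
    let R₀ : Fin N → Fin N → Prop := fun i j => R i.succ j.succ
    have hR₀ : IsTransfer R₀ :=
      { le := fun h => Fin.succ_le_succ_iff.1 (hR.le h)
        refl := fun i => hR.refl _
        trans := fun h₁ h₂ => hR.trans h₁ h₂
        restrict := fun h h₁ h₂ =>
          hR.restrict h (Fin.succ_le_succ_iff.2 h₁) (Fin.succ_le_succ_iff.2 h₂) }
    have hne : {j | R 0 j}.Nonempty := ⟨0, hR.refl 0⟩
    obtain ⟨c, hc⟩ := (Set.toFinite {j | R 0 j}).exists_maximal hne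
    have hmax : ∀ j, R 0 j → j ≤ c := fun j hj =>
      (le_total j c).elim id fun h => hc.le_of_ge hj h
    have hc₀ : c ∈ targets R₀ := by
      cases c using Fin.cases with
      | zero => simp
      | succ c =>
        rw [succ_mem_targets, mem_endpoints]
        intro i hi j hij
        exact Fin.succ_le_succ_iff.1 (hmax _ (hR.trans
          (hR.restrict hc.prop (Fin.zero_le _) (Fin.succ_le_succ_iff.2 hi)) hij))
    refine ⟨⟨⟨R₀, hR₀⟩, c, hc₀⟩, Subtype.ext ?_⟩
    ext i j
    cases i using Fin.cases with
    | zero => exact ⟨fun h => hR.restrict hc.prop (Fin.zero_le _) h, hmax j⟩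
    | succ i =>
      cases j using Fin.cases with
      | zero => exact ⟨False.elim, fun h => absurd (hR.le h) (by simp)⟩
      | succ j => exact Iff.rfl

lemma sum_card_filter_le {β : Type*} [LinearOrder β] (U : Finset β) (φ : ℕ → ℕ) :
    ∑ c ∈ U, φ #{u ∈ U | c ≤ u} = ∑ t ∈ range #U, φ (t + 1) := by
  refine Finset.induction_on_min U (by simp) fun a s ha ih => ?_
  have has : a ∉ s := fun h => (ha a h).false
  rw [Finset.sum_insert has, Finset.card_insert_of_notMem has, Finset.sum_range_succ, ← ih,
    add_comm]
  congr 1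
  · refine Finset.sum_congr rfl fun c hc => ?_
    rw [Finset.filter_insert, if_neg (ha c hc).not_ge]
  · rw [Finset.filter_true_of_mem, Finset.card_insert_of_notMem has]
    intro x hx
    rcases Finset.mem_insert.1 hx with rfl | h
    · exact le_rfl
    · exact (ha x h).le

open Classical in
lemma sum_endpoints_succ (N : ℕ) (φ : ℕ → ℕ) :
    ∑ R : {R : Fin (N + 1) → Fin (N + 1) → Prop // IsTransfer R}, φ #(endpoints R.1) =
      ∑ R : {R : Fin N → Fin N → Prop // IsTransfer R},
        ∑ t ∈ range (#(endpoints R.1) + 1), φ (t + 1) := by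
  rw [← (bijective_extend N).sum_comp, Fintype.sum_sigma]
  refine Finset.sum_congr rfl fun R _ => ?_
  simp only [endpoints_extend]
  rw [Finset.sum_coe_sort (targets R.1) fun c => φ #{u ∈ targets R.1 | c ≤ u},
    sum_card_filter_le, card_targets]

/-- The total weight, with weight `2 ^ s` at the end, of the ways to adjoin `m` elements
successively to a transfer system with `s` endpoints. -/
def weight (m s : ℕ) : ℕ :=
  ∑ k ∈ range (s + 1), (2 * m + s).choose (m + k)

lemma weight_zero (s : ℕ) : weight 0 s = 2 ^ s := by
  simp [weight, Nat.sum_range_choose]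

lemma weight_succ (m s : ℕ) : weight (m + 1) s = ∑ t ∈ range (s + 1), weight m (t + 1) := by
  induction s with
  | zero =>
    simp only [weight, zero_add, Finset.sum_range_succ, Finset.range_zero, Finset.sum_empty,
      add_zero]
    rw [show 2 * (m + 1) = 2 * m + 1 + 1 by ring, Nat.choose_succ_succ]
  | succ s ih =>
    rw [Finset.sum_range_succ, ← ih]
    have h₁ : 2 * (m + 1) + (s + 1) = 2 * m + (s + 1 + 1) + 1 := by ring
    have h₂ : 2 * (m + 1) + s = 2 * m + (s + 1 + 1) := by ring
    have h₃ : ∀ k, m + 1 + k = m + (k + 1) := fun k => by ring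
    simp only [weight, h₁, h₂, h₃, ← add_assoc m, Nat.choose_succ_succ, Finset.sum_add_distrib]
    rw [Finset.sum_range_succ' _ (s + 1), Finset.sum_range_succ' _ (s + 1 + 1)]
    simp only [← add_assoc]
    ring

open Classical in
lemma sum_weight (N : ℕ) : ∀ m,
    ∑ R : {R : Fin N → Fin N → Prop // IsTransfer R}, weight m #(endpoints R.1) =
      weight (m + N) 0 := by
  induction N with
  | zero =>
    intro m
    have : Unique {R : Fin 0 → Fin 0 → Prop // IsTransfer R} :=
      { default := ⟨fun _ _ => True, ⟨fun {i} => i.elim0, fun i => i.elim0, fun {i} => i.elim0,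
          fun {i} => i.elim0⟩⟩
        uniq := fun R => Subtype.ext (Subsingleton.elim _ _) }
    rw [Fintype.sum_unique, Finset.eq_empty_of_isEmpty (endpoints _), Finset.card_empty, add_zero]
  | succ N ih =>
    intro m
    rw [sum_endpoints_succ]
    simp only [← weight_succ]
    rw [ih, add_right_comm, add_assoc]

end Extension

lemma card_chain (n : ℕ) :
    Nat.card {P : (Fin (n + 1) → Fin (n + 1) → Prop) × (Fin (n + 1) → Fin (n + 1) → Prop) //
      IsTransfer P.1 ∧ IsTransfer P.2 ∧ (∀ i j, P.1 i j → P.2 i j) ∧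
        TwoOfThree (WeakRel P.1 P.2)} = (2 * n + 1).choose n := by
  classical
  rw [Nat.card_congr (quillenEquiv _), Nat.card_sigma]
  apply Nat.eq_of_mul_eq_mul_left two_pos
  rw [Finset.mul_sum]
  simp only [fun R : {R : Fin (n + 1) → Fin (n + 1) → Prop // IsTransfer R} =>
    two_mul_card_convex R.2, ← weight_zero]
  rw [sum_weight]
  simp only [weight, zero_add, Finset.sum_range_one, add_zero]
  rw [show 2 * (n + 1) = 2 * n + 1 + 1 by ring, Nat.choose_succ_succ, Nat.choose_symm_half]
  ring

/-! ### Subgroups of a cyclic `p`-group -/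

lemma nonempty_orderIso_subgroup {G : Type*} [CommGroup G] [IsCyclic G] {p n : ℕ} (hp : p.Prime)
    (hG : Nat.card G = p ^ n) : Nonempty (Fin (n + 1) ≃o Subgroup G) := by
  have : Finite G := Nat.finite_of_card_ne_zero (hG ▸ pow_ne_zero _ hp.ne_zero)
  let K : Fin (n + 1) → Subgroup G := fun i => (powMonoidHom (α := G) (p ^ (i : ℕ))).ker
  have hK : ∀ i, Nat.card (K i) = p ^ (i : ℕ) := fun i => by
    rw [IsCyclic.card_powMonoidHom_ker, hG]
    exact Nat.gcd_eq_right (pow_dvd_pow p (Nat.lt_succ_iff.1 i.2))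
  have hmono : StrictMono K := fun i j hij => by
    refine lt_of_le_of_ne (fun x hx => ?_) fun h => ?_
    · have hx' : x ^ p ^ (i : ℕ) = 1 := hx
      obtain ⟨d, hd⟩ := pow_dvd_pow p (show (i : ℕ) ≤ j from hij.le)
      change x ^ p ^ (j : ℕ) = 1
      rw [hd, pow_mul, hx', one_pow]
    · have := congrArg (fun H : Subgroup G => Nat.card H) h
      simp only [hK] at this
      exact hij.ne (Fin.ext (Nat.pow_right_injective hp.two_le this))
  refine ⟨hmono.orderIsoOfSurjective K fun H => ?_⟩
  obtain ⟨i, hi, hH⟩ := (Nat.dvd_prime_pow hp).1 (hG ▸ H.card_subgroup_dvd_card)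
  refine ⟨⟨i, Nat.lt_succ_iff.2 hi⟩, (Subgroup.eq_of_le_of_card_ge (fun x hx => ?_) ?_).symm⟩
  · change x ^ p ^ i = 1
    have h := pow_card_eq_one' (x := (⟨x, hx⟩ : H))
    rw [hH] at h
    exact congrArg Subtype.val h
  · rw [hK, hH]

section Transport

variable {G : Type*} [CommGroup G] {α : Type*} [LinearOrder α] (e : α ≃o Subgroup G)

/-- The relation on a chain corresponding to a set of pairs of subgroups. -/
def pull : Set (Subgroup G × Subgroup G) ≃ (α → α → Prop) where
  toFun T i j := (e i, e j) ∈ T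
  invFun R := {q | R (e.symm q.1) (e.symm q.2)}
  left_inv T := by ext; simp
  right_inv R := by ext; simp

variable {e} {T T' : Set (Subgroup G × Subgroup G)}

lemma pull_apply {i j : α} : pull e T i j ↔ (e i, e j) ∈ T := Iff.rfl

lemma subset_iff_pull : T ⊆ T' ↔ ∀ i j, pull e T i j → pull e T' i j := by
  refine ⟨fun h i j hij => h hij, fun h q hq => ?_⟩
  simpa [pull_apply] using h (e.symm q.1) (e.symm q.2) (by simpa [pull_apply] using hq)

lemma isTransferSystem_iff_pull : IsTransferSystem T ↔ IsTransfer (pull e T) := by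
  have hconj : ∀ (g : G) (H : Subgroup G), H.map (MulAut.conj g).toMonoidHom = H := by
    intro g H
    have : (MulAut.conj g).toMonoidHom = MonoidHom.id G := by ext; simp
    rw [this, Subgroup.map_id]
  simp only [IsTransferSystem, hconj, Prod.forall, e.surjective.forall]
  constructor
  · rintro ⟨h₁, h₂, h₃, -, h₄⟩
    exact ⟨fun h => e.le_iff_le.1 (h₁ _ _ h), h₂, fun h h' => h₃ _ _ _ h h',
      fun {i j k} h hi hj => by
        simpa [pull_apply, ← e.map_inf, inf_eq_left.2 hi] using h₄ i j k h (e.le_iff_le.2 hj)⟩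
  · intro h
    refine ⟨fun i j hij => e.le_iff_le.2 (h.le hij), h.refl, fun i j k h₁ h₂ => h.trans h₁ h₂,
      fun _ _ h _ => h, fun i j k hij hkj => ?_⟩
    rw [← e.map_inf]
    rcases le_total i k with hik | hki
    · rw [inf_eq_left.2 hik]
      exact h.restrict hij hik (e.le_iff_le.1 hkj)
    · rw [inf_eq_right.2 hki]
      exact h.refl k

lemma mem_leftSet_iff (hT : IsTransfer (pull e T)) {a b : α} :
    (e a, e b) ∈ leftSet T ↔ LeftRel (pull e T) a b := by
  simp only [leftSet, LeftRel, Set.mem_ofPred_eq, Prod.forall, e.surjective.forall, e.le_iff_le]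
  refine and_congr_right fun hab => ⟨fun h c hac hcb hc => ?_, fun h c d hcd hac hbd => ?_⟩
  · exact hcb.not_ge (h c b hc hac le_rfl)
  · by_contra hbc
    exact h c hac (not_le.1 hbc) (hT.restrict hcd (not_le.1 hbc).le hbd)

lemma mem_weakEquivalences_iff (hT : IsTransfer (pull e T)) (hT' : IsTransfer (pull e T'))
    {a b : α} :
    (e a, e b) ∈ weakEquivalences T T' ↔ WeakRel (pull e T) (pull e T') a b := by
  simp only [weakEquivalences, WeakRel, Set.mem_ofPred_eq, e.surjective.exists, e.le_iff_le,
    mem_leftSet_iff hT', ← pull_apply (e := e) (T := T)]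
  exact ⟨fun ⟨_, m, _, _, h₁, h₂⟩ => ⟨m, h₁, h₂⟩, fun ⟨m, h₁, h₂⟩ =>
    ⟨h₁.1.trans (hT.le h₂), m, h₁.1, hT.le h₂, h₁, h₂⟩⟩

lemma isQuillen_iff_pull (hT : IsTransfer (pull e T)) (hT' : IsTransfer (pull e T')) :
    IsQuillen T T' ↔ TwoOfThree (WeakRel (pull e T) (pull e T')) := by
  simp only [IsQuillen, TwoOfThree, e.surjective.forall, e.le_iff_le,
    mem_weakEquivalences_iff hT hT']

lemma card_quillen_eq (e : α ≃o Subgroup G) :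
    Nat.card {P : Set (Subgroup G × Subgroup G) × Set (Subgroup G × Subgroup G) //
      IsTransferSystem P.1 ∧ IsTransferSystem P.2 ∧ P.1 ⊆ P.2 ∧ IsQuillen P.1 P.2} =
    Nat.card {P : (α → α → Prop) × (α → α → Prop) // IsTransfer P.1 ∧ IsTransfer P.2 ∧
      (∀ i j, P.1 i j → P.2 i j) ∧ TwoOfThree (WeakRel P.1 P.2)} := by
  refine Nat.card_congr (((pull e).prodCongr (pull e)).subtypeEquiv fun P => ?_)
  rw [isTransferSystem_iff_pull (e := e), isTransferSystem_iff_pull (e := e)]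
  refine and_congr_right fun h₁ => and_congr_right fun h₂ => ?_
  rw [subset_iff_pull (e := e), isQuillen_iff_pull h₁ h₂]
  rfl

end Transport

end ChainTransfer

/-- The number of Quillen model structures on `Sub(C_{p^n})` equals `binom(2n+1, n)`. -/
theorem card_quillen_model_structures_cyclic_prime_pow (p n : ℕ) (hp : p.Prime) :
    Nat.card {P : Set (Subgroup (Multiplicative (ZMod (p ^ n))) ×
          Subgroup (Multiplicative (ZMod (p ^ n)))) ×
        Set (Subgroup (Multiplicative (ZMod (p ^ n))) ×
          Subgroup (Multiplicative (ZMod (p ^ n)))) //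
        IsTransferSystem P.1 ∧ IsTransferSystem P.2 ∧ P.1 ⊆ P.2 ∧ IsQuillen P.1 P.2} =
      Nat.choose (2 * n + 1) n := by
  have hcard : Nat.card (Multiplicative (ZMod (p ^ n))) = p ^ n := by
    rw [Nat.card_congr Multiplicative.toAdd, Nat.card_zmod]
  obtain ⟨e⟩ := ChainTransfer.nonempty_orderIso_subgroup hp hcard
  rw [ChainTransfer.card_quillen_eq e, ChainTransfer.card_chain]
end

section
/- For every prime p and every natural number n, the number of compatible pairs of transfer systems for the cyclic group C_{p^n} equals the Fuss–Catalan number A_{n+1}(3,1) = (1/(3n+4))·binom(3n+4, n+1). -/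
/-- A pair of transfer systems `(T, T')` with `T ⊆ T'` is compatible if whenever
`B, C ≤ A` with `(B, A) ∈ T` and `(B ⊓ C, B) ∈ T'`, then `(C, A) ∈ T'`. -/
def CompatiblePair {G : Type*} [Group G] (T T' : Set (Subgroup G × Subgroup G)) : Prop :=
  T ⊆ T' ∧ ∀ A B C : Subgroup G, B ≤ A → C ≤ A →
    (B, A) ∈ T → (B ⊓ C, B) ∈ T' → (C, A) ∈ T'

open Finset

/-! ### Fuss–Catalan (Raney) numbers -/

/-- The Raney number `A_n(3, r)`: the coefficient of `x ^ n` in `F ^ r`, where `F = 1 + x F ^ 3`. -/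
def raney : ℕ → ℕ → ℕ
  | _, 0 => 1
  | 0, _ + 1 => 0
  | r + 1, n + 1 => raney r (n + 1) + raney (r + 3) n
termination_by r n => (n, r)

theorem raney_zero_right (r : ℕ) : raney r 0 = 1 := by
  cases r <;> simp [raney]

theorem raney_zero_left (n : ℕ) : raney 0 (n + 1) = 0 := by
  simp [raney]

theorem raney_succ_succ (r n : ℕ) :
    raney (r + 1) (n + 1) = raney r (n + 1) + raney (r + 3) n := by
  rw [raney]

theorem raney_mul (r n : ℕ) : raney r n * (3 * n + r) = r * (3 * n + r).choose n := by
  induction n generalizing r with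
  | zero => simp [raney_zero_right]
  | succ n ihn =>
    induction r with
    | zero => simp [raney_zero_left]
    | succ r ihr =>
      have hB := ihn (r + 3)
      have hN : 3 * n + (r + 3) = 3 * (n + 1) + r := by ring
      rw [hN] at hB
      have hC := Nat.choose_succ_right_eq (3 * (n + 1) + r) n
      rw [show 3 * (n + 1) + r - n = 2 * n + 3 + r by omega] at hC
      rw [raney_succ_succ, show 3 * (n + 1) + (r + 1) = 3 * (n + 1) + r + 1 by ring,
        Nat.choose_succ_succ]
      apply Nat.eq_of_mul_eq_mul_left (show 0 < 3 * (n + 1) + r by omega)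
      zify at *
      linear_combination (3 * (n + 1) + r + 1 : ℤ) * ihr + (3 * (n + 1) + r + 1 : ℤ) * hB - 3 * hC

/-- Summation by parts: if `v q = w q + v (q + 1)` and `v` vanishes at the right end. -/
theorem sum_mul_partialSum (w v φ : ℕ → ℕ) (hv : ∀ q, v q = w q + v (q + 1)) (M : ℕ)
    (hM : v M = 0) :
    ∑ s ∈ range M, w s * ∑ i ∈ range (s + 1), φ i = ∑ s ∈ range M, v s * φ s := by
  have key : ∀ M, ∑ s ∈ range M, w s * ∑ i ∈ range (s + 1), φ i + v M * ∑ i ∈ range M, φ i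
      = ∑ s ∈ range M, v s * φ s := by
    intro M
    induction M with
    | zero => simp
    | succ M ih =>
      rw [sum_range_succ, sum_range_succ (fun s => v s * φ s), ← ih, sum_range_succ φ, hv M]
      ring
  simpa [hM] using key M

/-- `raneyTail r m q` is the coefficient of `x ^ m` in `x ^ q * F ^ (2 q + r)`,
where `F = 1 + x F ^ 3`. -/
def raneyTail (r m q : ℕ) : ℕ := if q ≤ m then raney (2 * q + r) (m - q) else 0

theorem raneyTail_of_lt {r m q : ℕ} (h : m < q) : raneyTail r m q = 0 := by
  simp [raneyTail, h]

theorem raneyTail_succ (r m q : ℕ) :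
    raneyTail (r + 1) m q = raneyTail r m q + raneyTail (r + 1) m (q + 1) := by
  rcases lt_trichotomy m q with h | rfl | h
  · simp [raneyTail_of_lt, h, show m < q + 1 by omega]
  · simp [raneyTail, raney_zero_right]
  · obtain ⟨k, rfl⟩ := Nat.exists_eq_add_of_lt h
    have h₁ : q ≤ q + k + 1 := by omega
    have h₂ : q + 1 ≤ q + k + 1 := by omega
    simp only [raneyTail, h₁, h₂, if_true]
    rw [show q + k + 1 - q = k + 1 by omega, show q + k + 1 - (q + 1) = k by omega,
      ← add_assoc, raney_succ_succ]
    congr 2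
    ring

theorem raneyTail_one_succ (m q : ℕ) : raneyTail 1 (m + 1) (q + 1) = raneyTail 3 m q := by
  simp [raneyTail, show 2 * (q + 1) + 1 = 2 * q + 3 by ring]

theorem raneyTail_one_zero (m : ℕ) : raneyTail 1 (m + 1) 0 = raneyTail 3 m 0 := by
  simp [raneyTail, raney_succ_succ, raney_zero_left]

theorem sum_raneyTail_mul_step (m : ℕ) (f : ℕ → ℕ → ℕ) :
    ∑ s ∈ range (m + 1), ∑ l ∈ range (m + 1), raneyTail 1 m (s + l) *
        (f (s + 1) 0 + ∑ i ∈ range (s + 1), ∑ j ∈ range (l + 2), f i j) =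
      ∑ s ∈ range (m + 2), ∑ l ∈ range (m + 2), raneyTail 1 (m + 1) (s + l) * f s l := by
  have inner (s : ℕ) (g : ℕ → ℕ) : ∑ l ∈ range (m + 1), raneyTail 1 m (s + l) *
      ∑ j ∈ range (l + 1), g j = ∑ l ∈ range (m + 1), raneyTail 2 m (s + l) * g l :=
    sum_mul_partialSum _ (fun l => raneyTail 2 m (s + l)) g
      (fun q => raneyTail_succ 1 m (s + q)) _ (raneyTail_of_lt (by omega))
  have outer (l : ℕ) (g : ℕ → ℕ) : ∑ s ∈ range (m + 1), raneyTail 2 m (s + l) *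
      ∑ j ∈ range (s + 1), g j = ∑ s ∈ range (m + 1), raneyTail 3 m (s + l) * g s :=
    sum_mul_partialSum _ (fun s => raneyTail 3 m (s + l)) g
      (fun q => by rw [raneyTail_succ 2 m (q + l), add_right_comm]) _ (raneyTail_of_lt (by omega))
  have const (s : ℕ) : ∑ l ∈ range (m + 1), raneyTail 1 m (s + l) = raneyTail 2 m s := by
    have := inner s (fun j => if j = 0 then 1 else 0)
    simpa using this
  have rhs : ∑ s ∈ range (m + 2), ∑ l ∈ range (m + 2), raneyTail 1 (m + 1) (s + l) * f s l =
      ∑ s ∈ range (m + 1), ∑ l ∈ range (m + 1), raneyTail 3 m (s + l) * f s (l + 1) +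
        (∑ s ∈ range (m + 1), raneyTail 3 m s * f (s + 1) 0 + raneyTail 3 m 0 * f 0 0) := by
    have hl (s : ℕ) : ∑ l ∈ range (m + 2), raneyTail 1 (m + 1) (s + l) * f s l =
        ∑ l ∈ range (m + 1), raneyTail 3 m (s + l) * f s (l + 1) +
          raneyTail 1 (m + 1) s * f s 0 := by
      rw [sum_range_succ']
      simp [← add_assoc, raneyTail_one_succ]
    simp only [hl, sum_add_distrib]
    congr 1
    · rw [sum_range_succ, add_eq_left]
      exact sum_eq_zero fun l _ => by rw [raneyTail_of_lt (by omega), zero_mul]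
    · rw [sum_range_succ']
      simp [raneyTail_one_succ, raneyTail_one_zero]
  have lhs : ∀ s ∈ range (m + 1), ∑ l ∈ range (m + 1), raneyTail 1 m (s + l) *
        (f (s + 1) 0 + ∑ i ∈ range (s + 1), ∑ j ∈ range (l + 2), f i j) =
      raneyTail 2 m s * f (s + 1) 0 + raneyTail 2 m s * ∑ i ∈ range (s + 1), f i 0 +
        ∑ l ∈ range (m + 1), raneyTail 2 m (s + l) * ∑ i ∈ range (s + 1), f i (l + 1) := by
    intro s _
    rw [← inner s, ← const s, sum_mul, sum_mul, ← sum_add_distrib, ← sum_add_distrib]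
    refine sum_congr rfl fun l _ => ?_
    rw [sum_comm (s := range (l + 1)), ← mul_add, ← mul_add, add_assoc, ← sum_add_distrib]
    congr 2
    refine sum_congr rfl fun i _ => ?_
    rw [sum_range_succ', add_comm]
  rw [sum_congr rfl lhs, sum_add_distrib, sum_add_distrib, sum_comm (s := range (m + 1))]
  rw [sum_congr rfl fun l _ => outer l fun i => f i (l + 1)]
  have h0 := outer 0 fun i => f i 0
  simp only [add_zero] at h0
  rw [h0, rhs, sum_comm]
  have hz : ∑ s ∈ range (m + 1), raneyTail 3 m s * f s 0 =
      ∑ s ∈ range (m + 1), raneyTail 3 m (s + 1) * f (s + 1) 0 + raneyTail 3 m 0 * f 0 0 := by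
    rw [← sum_range_succ' (fun s => raneyTail 3 m s * f s 0), sum_range_succ _ (m + 1),
      raneyTail_of_lt (show m < m + 1 by omega)]
    simp
  have hs : ∑ s ∈ range (m + 1), raneyTail 3 m s * f (s + 1) 0 =
      ∑ s ∈ range (m + 1), raneyTail 2 m s * f (s + 1) 0 +
        ∑ s ∈ range (m + 1), raneyTail 3 m (s + 1) * f (s + 1) 0 := by
    rw [← sum_add_distrib]
    exact sum_congr rfl fun s _ => by rw [← add_mul, ← raneyTail_succ]
  rw [hz, hs]
  ring

theorem sum_raneyTail_one (m : ℕ) :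
    ∑ s ∈ range (m + 1), ∑ l ∈ range (m + 1), raneyTail 1 m (s + l) = raney 1 (m + 1) := by
  have := sum_raneyTail_mul_step m (fun i j => if i = 0 ∧ j = 0 then 1 else 0)
  simpa [ite_and, raneyTail] using this

/-! ### Enumeration of compatible pairs of bracket vectors -/

/-- Summing over a finite set a function of the rank from the top. -/
theorem sum_card_filter_le (S : Finset ℕ) (f : ℕ → ℕ) :
    ∑ a ∈ S, f #{b ∈ S | a ≤ b} = ∑ i ∈ range #S, f (i + 1) := by
  induction S using Finset.induction_on_min with
  | empty => simp
  | insert a S ha ih =>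
    have haS : a ∉ S := fun h => lt_irrefl a (ha a h)
    rw [sum_insert haS, card_insert_of_notMem haS, sum_range_succ, ← ih, add_comm]
    congr 1
    · refine sum_congr rfl fun b hb => ?_
      rw [filter_insert, if_neg (by simpa using ha b hb)]
    · rw [filter_true_of_mem, card_insert_of_notMem haS]
      intro b hb
      rcases mem_insert.1 hb with rfl | hb
      · exact le_rfl
      · exact (ha b hb).le

/-- `u` encodes a compatible pair of transfer systems on the chain `Fin m`: the first (second)
transfer system has `i → j` iff `i ≤ j ≤ i + (u i).1` (resp. `i ≤ j ≤ i + (u i).2`). -/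
def IsBracketPair {m : ℕ} (u : Fin m → ℕ × ℕ) : Prop :=
  ∀ i : Fin m, (u i).1 ≤ (u i).2 ∧ (i : ℕ) + (u i).2 < m ∧
    (∀ j : Fin m, i < j → (j : ℕ) ≤ i + (u i).1 →
      (j : ℕ) + (u j).1 ≤ i + (u i).1 ∧ (i : ℕ) + (u i).1 ≤ j + (u j).2) ∧
    ∀ j : Fin m, i < j → (j : ℕ) ≤ i + (u i).2 → (j : ℕ) + (u j).2 ≤ i + (u i).2

/-- The admissible values of the first component of a new initial entry of `u`. -/
def innerPrefixes {m : ℕ} (u : Fin m → ℕ × ℕ) : Finset ℕ :=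
  {d ∈ range (m + 1) | ∀ j : Fin m, (j : ℕ) < d →
    (j : ℕ) + 1 + (u j).1 ≤ d ∧ d ≤ (j : ℕ) + 1 + (u j).2}

/-- The admissible values of the second component of a new initial entry of `u`. -/
def outerPrefixes {m : ℕ} (u : Fin m → ℕ × ℕ) : Finset ℕ :=
  {e ∈ range (m + 1) | ∀ j : Fin m, (j : ℕ) < e → (j : ℕ) + 1 + (u j).2 ≤ e}

theorem zero_mem_innerPrefixes {m : ℕ} (u : Fin m → ℕ × ℕ) : 0 ∈ innerPrefixes u := by
  simp [innerPrefixes]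

theorem zero_mem_outerPrefixes {m : ℕ} (u : Fin m → ℕ × ℕ) : 0 ∈ outerPrefixes u := by
  simp [outerPrefixes]

theorem isBracketPair_cons {m : ℕ} (u : Fin m → ℕ × ℕ) (x : ℕ × ℕ) :
    IsBracketPair (Fin.cons x u : Fin (m + 1) → ℕ × ℕ) ↔
      IsBracketPair u ∧ x.1 ∈ innerPrefixes u ∧ x.2 ∈ outerPrefixes u ∧ x.1 ≤ x.2 := by
  simp only [IsBracketPair, innerPrefixes, outerPrefixes, mem_filter, mem_range,
    Fin.forall_fin_succ, Fin.cons_zero, Fin.cons_succ, Fin.succ_lt_succ_iff, Fin.val_succ,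
    Fin.val_zero, Fin.succ_pos, Fin.not_lt_zero, false_imp_iff, true_and,
    true_imp_iff, zero_add]
  constructor
  · rintro ⟨⟨h1, h2, h3, h4⟩, h5⟩
    refine ⟨fun i => ?_, ⟨by omega, fun j hj => ?_⟩, ⟨by omega, fun j hj => ?_⟩, h1⟩
    · obtain ⟨a1, a2, a3, a4⟩ := h5 i
      refine ⟨a1, by omega, fun j hij hj => ?_, fun j hij hj => ?_⟩
      · have := a3 j hij (by omega)
        omega
      · have := a4 j hij (by omega)
        omega
    · exact h3 j (by omega)
    · exact h4 j (by omega)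
  · rintro ⟨h5, ⟨h2', h3⟩, ⟨h2, h4⟩, h1⟩
    refine ⟨⟨h1, by omega, fun j hj => h3 j (by omega), fun j hj => h4 j (by omega)⟩, fun i => ?_⟩
    obtain ⟨a1, a2, a3, a4⟩ := h5 i
    refine ⟨a1, by omega, fun j hij hj => ?_, fun j hij hj => ?_⟩
    · have := a3 j hij (by omega)
      omega
    · have := a4 j hij (by omega)
      omega

theorem outerPrefixes_cons {m : ℕ} (u : Fin m → ℕ × ℕ) (x : ℕ × ℕ) :
    outerPrefixes (Fin.cons x u : Fin (m + 1) → ℕ × ℕ) =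
      insert 0 (({e ∈ outerPrefixes u | x.2 ≤ e}).image Nat.succ) := by
  ext e
  cases e with
  | zero => simp [zero_mem_outerPrefixes]
  | succ e =>
    simp only [outerPrefixes, mem_filter, mem_range, Fin.forall_fin_succ, Fin.cons_zero,
      Fin.cons_succ, Fin.val_succ, Fin.val_zero, mem_insert, mem_image, Nat.succ_eq_add_one,
      Nat.add_right_cancel_iff, exists_eq_right, Nat.add_eq_zero_iff, one_ne_zero, and_false,
      false_or]
    constructor
    · rintro ⟨h1, h2, h3⟩
      exact ⟨⟨by omega, fun j hj => by have := h3 j (by omega); omega⟩, by omega⟩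
    · rintro ⟨⟨h1, h3⟩, h2⟩
      exact ⟨by omega, by omega, fun j hj => by have := h3 j (by omega); omega⟩

theorem innerPrefixes_cons {m : ℕ} (u : Fin m → ℕ × ℕ) (x : ℕ × ℕ) :
    innerPrefixes (Fin.cons x u : Fin (m + 1) → ℕ × ℕ) =
      insert 0 (({d ∈ innerPrefixes u | x.1 ≤ d ∧ d ≤ x.2}).image Nat.succ) := by
  ext d
  cases d with
  | zero => simp [zero_mem_innerPrefixes]
  | succ d =>
    simp only [innerPrefixes, mem_filter, mem_range, Fin.forall_fin_succ, Fin.cons_zero,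
      Fin.cons_succ, Fin.val_succ, Fin.val_zero, mem_insert, mem_image, Nat.succ_eq_add_one,
      Nat.add_right_cancel_iff, exists_eq_right, Nat.add_eq_zero_iff, one_ne_zero, and_false,
      false_or]
    constructor
    · rintro ⟨h1, h2, h3⟩
      exact ⟨⟨by omega, fun j hj => by have := h3 j (by omega); omega⟩, by omega⟩
    · rintro ⟨⟨h1, h3⟩, h2⟩
      exact ⟨by omega, by omega, fun j hj => by have := h3 j (by omega); omega⟩

theorem card_insert_zero_image_succ (S : Finset ℕ) :
    #(insert 0 (S.image Nat.succ)) = #S + 1 := by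
  rw [card_insert_of_notMem (by simp), card_image_of_injective _ Nat.succ_injective]

theorem card_outerPrefixes_cons {m : ℕ} (u : Fin m → ℕ × ℕ) (x : ℕ × ℕ) :
    #(outerPrefixes (Fin.cons x u : Fin (m + 1) → ℕ × ℕ)) =
      #{e ∈ outerPrefixes u | x.2 ≤ e} + 1 := by
  rw [outerPrefixes_cons, card_insert_zero_image_succ]

theorem card_innerPrefixes_cons {m : ℕ} (u : Fin m → ℕ × ℕ) (x : ℕ × ℕ) :
    #(innerPrefixes (Fin.cons x u : Fin (m + 1) → ℕ × ℕ)) =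
      #{d ∈ innerPrefixes u | x.1 ≤ d ∧ d ≤ x.2} + 1 := by
  rw [innerPrefixes_cons, card_insert_zero_image_succ]

theorem le_of_mem_prefixes {m : ℕ} {u : Fin m → ℕ × ℕ} {d e : ℕ}
    (hd : d ∈ innerPrefixes u) (he : e ∈ outerPrefixes u) (he0 : e ≠ 0) : d ≤ e := by
  simp only [innerPrefixes, outerPrefixes, mem_filter, mem_range] at hd he
  by_contra! h
  have h1 := hd.2 ⟨e - 1, by omega⟩ (by simp only; omega)
  have h2 := he.2 ⟨e - 1, by omega⟩ (by simp only; omega)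
  simp only at h1 h2
  omega

/-- The pairs that may be put in front of `u`. -/
def extensions {m : ℕ} (u : Fin m → ℕ × ℕ) : Finset (ℕ × ℕ) :=
  {x ∈ innerPrefixes u ×ˢ outerPrefixes u | x.1 ≤ x.2}

theorem sum_extensions {m : ℕ} (u : Fin m → ℕ × ℕ) (f : ℕ → ℕ → ℕ) :
    ∑ x ∈ extensions u, f #(outerPrefixes (Fin.cons x u : Fin (m + 1) → ℕ × ℕ))
        #(innerPrefixes (Fin.cons x u : Fin (m + 1) → ℕ × ℕ)) =
      f (#(outerPrefixes u) + 1) 2 + ∑ s ∈ range (#(outerPrefixes u) - 1),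
        ∑ l ∈ range #(innerPrefixes u), f (s + 2) (l + 2) := by
  have h0 := zero_mem_outerPrefixes u
  simp only [card_outerPrefixes_cons, card_innerPrefixes_cons]
  rw [extensions, sum_filter, sum_product_right, ← add_sum_erase _ _ h0]
  congr 1
  · rw [← sum_filter]
    have h : {a ∈ innerPrefixes u | a ≤ 0} = {0} := by
      ext a
      have := zero_mem_innerPrefixes u
      simp only [mem_filter, mem_singleton]
      grind
    simp only [h, sum_singleton, zero_le, filter_true, true_and]
    simp
  · rw [← card_erase_of_mem h0, ← sum_card_filter_le _ fun s => ∑ l ∈ range #(innerPrefixes u),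
      f (s + 1) (l + 2)]
    refine sum_congr rfl fun e he => ?_
    obtain ⟨he0, he⟩ := mem_erase.1 he
    have hle : ∀ d ∈ innerPrefixes u, d ≤ e := fun d hd => le_of_mem_prefixes hd he he0
    have hf : {b ∈ (outerPrefixes u).erase 0 | e ≤ b} = {b ∈ outerPrefixes u | e ≤ b} := by
      ext b
      simp only [mem_filter, mem_erase]
      grind
    rw [hf, ← sum_card_filter_le (innerPrefixes u) fun l => f (_ + 1) (l + 1)]
    refine sum_congr rfl fun d hd => ?_
    rw [if_pos (hle d hd)]
    congr 3
    refine filter_congr fun b hb => ?_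
    simp [hle b hb]

/-- The finite set of all bracket pairs of length `m`. -/
def bracketPairs : (m : ℕ) → Finset (Fin m → ℕ × ℕ)
  | 0 => univ
  | m + 1 => ((bracketPairs m).sigma extensions).image fun y => Fin.cons y.2 y.1

theorem mem_bracketPairs {m : ℕ} (u : Fin m → ℕ × ℕ) : u ∈ bracketPairs m ↔ IsBracketPair u := by
  induction m with
  | zero => exact iff_of_true (mem_univ u) fun i => i.elim0
  | succ m ih =>
    rw [← Fin.cons_self_tail u, isBracketPair_cons, ← ih]
    simp only [bracketPairs, extensions, mem_image, mem_sigma, mem_filter, mem_product, and_assoc]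
    constructor
    · rintro ⟨⟨v, x⟩, hv, hd, he, hde, hvx⟩
      obtain ⟨hx, rfl⟩ := Fin.cons_inj.1 hvx
      rw [← hx]
      exact ⟨hv, hd, he, hde⟩
    · exact fun ⟨hv, hd, he, hde⟩ => ⟨⟨Fin.tail u, u 0⟩, hv, hd, he, hde, rfl⟩

theorem sum_bracketPairs_succ (m : ℕ) (f : ℕ → ℕ → ℕ) :
    ∑ u ∈ bracketPairs (m + 1), f #(outerPrefixes u) #(innerPrefixes u) =
      ∑ u ∈ bracketPairs m, (f (#(outerPrefixes u) + 1) 2 +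
        ∑ s ∈ range (#(outerPrefixes u) - 1), ∑ l ∈ range #(innerPrefixes u),
          f (s + 2) (l + 2)) := by
  rw [bracketPairs, sum_image, sum_sigma]
  · exact sum_congr rfl fun u _ => sum_extensions u f
  · rintro ⟨u, x⟩ _ ⟨v, y⟩ _ h
    obtain ⟨rfl, rfl⟩ := Fin.cons_inj.1 h
    rfl

theorem sum_bracketPairs (m : ℕ) (f : ℕ → ℕ → ℕ) :
    ∑ u ∈ bracketPairs (m + 1), f #(outerPrefixes u) #(innerPrefixes u) =
      ∑ s ∈ range (m + 1), ∑ l ∈ range (m + 1), raneyTail 1 m (s + l) * f (s + 2) (l + 2) := by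
  induction m generalizing f with
  | zero =>
    rw [sum_bracketPairs_succ]
    simp [bracketPairs, outerPrefixes, raneyTail, raney_zero_right]
  | succ m ih =>
    rw [sum_bracketPairs_succ, ih fun a b => f (a + 1) 2 +
      ∑ s ∈ range (a - 1), ∑ l ∈ range b, f (s + 2) (l + 2)]
    exact sum_raneyTail_mul_step m fun s l => f (s + 2) (l + 2)

theorem card_bracketPairs (m : ℕ) : #(bracketPairs (m + 1)) = raney 1 (m + 1) := by
  rw [← sum_raneyTail_one, card_eq_sum_ones]
  simpa using sum_bracketPairs m fun _ _ => 1

/-! ### Transfer systems on a chain of subgroups -/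

section Chain

variable {G : Type*} [CommGroup G] {m : ℕ} (c : Subgroup G ≃o Fin m)

/-- The relation on subgroups with `H → K` iff `H ≤ K` and `K` lies at most `d H` steps above `H`. -/
def chainRel (d : Fin m → ℕ) : Set (Subgroup G × Subgroup G) :=
  {P | c P.1 ≤ c P.2 ∧ (c P.2 : ℕ) ≤ c P.1 + d (c P.1)}

theorem mem_chainRel {d : Fin m → ℕ} {H K : Subgroup G} :
    (H, K) ∈ chainRel c d ↔ c H ≤ c K ∧ (c K : ℕ) ≤ c H + d (c H) :=
  Iff.rfl

theorem map_conj_eq (g : G) (H : Subgroup G) :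
    Subgroup.map (MulAut.conj g).toMonoidHom H = H := by
  have : (MulAut.conj g).toMonoidHom = MonoidHom.id G := by
    ext x
    simp
  rw [this, Subgroup.map_id]

theorem isTransferSystem_chainRel {d : Fin m → ℕ}
    (hd : ∀ i j : Fin m, i < j → (j : ℕ) ≤ i + d i → (j : ℕ) + d j ≤ i + d i) :
    IsTransferSystem (chainRel c d) := by
  refine ⟨fun P hP => c.le_iff_le.1 hP.1, fun H => ⟨le_rfl, by simp⟩, fun H K L hHK hKL => ?_,
    fun H K hHK g => by simpa only [map_conj_eq] using hHK, fun H K L hHK hLK => ?_⟩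
  · rw [mem_chainRel] at *
    refine ⟨hHK.1.trans hKL.1, ?_⟩
    rcases hHK.1.eq_or_lt with h | h
    · rw [h]
      exact hKL.2
    · exact hKL.2.trans (hd _ _ h hHK.2)
  · rw [mem_chainRel] at *
    have hLK' : c L ≤ c K := c.le_iff_le.2 hLK
    rw [OrderIso.map_inf]
    rcases le_total (c H) (c L) with h | h
    · rw [inf_eq_left.2 h]
      exact ⟨h, (Fin.le_def.1 hLK').trans hHK.2⟩
    · rw [inf_eq_right.2 h]
      exact ⟨le_rfl, by simp⟩

theorem exists_eq_chainRel {T : Set (Subgroup G × Subgroup G)} (hT : IsTransferSystem T) :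
    ∃ d : Fin m → ℕ, (∀ i : Fin m, (i : ℕ) + d i < m) ∧
      (∀ i j : Fin m, i < j → (j : ℕ) ≤ i + d i → (j : ℕ) + d j ≤ i + d i) ∧
      T = chainRel c d := by
  obtain ⟨hle, hrefl, htrans, -, hres⟩ := hT
  have hmax (i : Fin m) : ∃ k : Fin m, i ≤ k ∧ (c.symm i, c.symm k) ∈ T ∧
      ∀ j, (c.symm i, c.symm j) ∈ T → j ≤ k := by
    obtain ⟨k, hk, hk'⟩ := (Set.toFinite {j : Fin m | (c.symm i, c.symm j) ∈ T}).exists_maximal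
      ⟨i, hrefl _⟩
    have hmem : ∀ j, (c.symm i, c.symm j) ∈ T → j ≤ k := fun j hj =>
      (le_total j k).elim id fun h => hk' hj h
    exact ⟨k, hmem i (hrefl _), hk, hmem⟩
  choose k hik hkT hkmax using hmax
  have hiff (H K : Subgroup G) : (H, K) ∈ T ↔ c H ≤ c K ∧ c K ≤ k (c H) := by
    constructor
    · exact fun h => ⟨c.le_iff_le.2 (hle _ h), hkmax _ _ (by simpa using h)⟩
    · rintro ⟨h1, h2⟩
      have h1' := c.le_iff_le.1 h1
      have := hres _ _ K (hkT (c H)) (by rwa [c.le_symm_apply])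
      rwa [c.symm_apply_apply, inf_eq_left.2 h1'] at this
  refine ⟨fun i => k i - i, fun i => ?_, fun i j hij hj => ?_, ?_⟩
  · have := Fin.le_def.1 (hik i)
    dsimp only
    omega
  · dsimp only at hj ⊢
    have hi := Fin.le_def.1 (hik i)
    have hj' := Fin.le_def.1 (hik j)
    have hjT : (c.symm i, c.symm j) ∈ T := (hiff _ _).2 (by
      simp only [c.apply_symm_apply]
      exact ⟨hij.le, Fin.le_def.2 (by omega)⟩)
    have := Fin.le_def.1 (hkmax i _ (htrans _ _ _ hjT (hkT j)))
    omega
  · ext ⟨H, K⟩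
    rw [hiff, mem_chainRel]
    have := Fin.le_def.1 (hik (c H))
    rw [Fin.le_def (a := c K)]
    refine and_congr_right fun _ => ?_
    omega

theorem chainRel_subset_iff {d e : Fin m → ℕ} (hd : ∀ i : Fin m, (i : ℕ) + d i < m) :
    chainRel c d ⊆ chainRel c e ↔ ∀ i, d i ≤ e i := by
  constructor
  · intro h i
    have := @h (c.symm i, c.symm ⟨i + d i, hd i⟩) (by simp [mem_chainRel, Fin.le_def])
    simpa [mem_chainRel, Fin.le_def] using this
  · rintro h ⟨H, K⟩ hHK
    rw [mem_chainRel] at *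
    have := h (c H)
    exact ⟨hHK.1, by omega⟩

theorem compatiblePair_chainRel_iff {d e : Fin m → ℕ} (hd : ∀ i : Fin m, (i : ℕ) + d i < m)
    (he : ∀ i j : Fin m, i < j → (j : ℕ) ≤ i + e i → (j : ℕ) + e j ≤ i + e i) :
    CompatiblePair (chainRel c d) (chainRel c e) ↔ ∀ i, d i ≤ e i ∧
      ∀ j : Fin m, i < j → (j : ℕ) ≤ i + d i → (i : ℕ) + d i ≤ j + e j := by
  rw [CompatiblePair, chainRel_subset_iff c hd]
  constructor
  · rintro ⟨hde, h⟩ i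
    refine ⟨hde i, fun j hij hj => ?_⟩
    have hij' := Fin.lt_def.1 hij
    have := h (c.symm ⟨i + d i, hd i⟩) (c.symm i) (c.symm j)
      (c.symm.le_iff_le.2 (by simp [Fin.le_def])) (c.symm.le_iff_le.2 hj)
      (by simp [mem_chainRel, Fin.le_def])
      (by rw [inf_eq_left.2 (c.symm.le_iff_le.2 hij.le)]; simp [mem_chainRel])
    simpa [mem_chainRel, Fin.le_def] using this.2
  · intro h
    refine ⟨fun i => (h i).1, fun A B C hBA hCA hBAT hBC => ?_⟩
    rcases le_or_gt (c B) (c C) with hBC' | hBC'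
    · rw [mem_chainRel] at *
      refine ⟨c.le_iff_le.2 hCA, ?_⟩
      rcases hBC'.eq_or_lt with heq | hlt
      · rw [← heq]
        have := (h (c B)).1
        omega
      · have hCA' := Fin.le_def.1 (c.le_iff_le.2 hCA)
        have := (h (c B)).2 (c C) hlt (by omega)
        omega
    · rw [inf_eq_right.2 (c.lt_iff_lt.1 hBC').le] at hBC
      exact (isTransferSystem_chainRel c he).2.2.1 _ _ _ hBC
        ((chainRel_subset_iff c hd).2 (fun i => (h i).1) hBAT)

end Chain

theorem card_compatiblePairs_of_orderIso {G : Type*} [CommGroup G] {m : ℕ}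
    (c : Subgroup G ≃o Fin m) :
    Nat.card {P : Set (Subgroup G × Subgroup G) × Set (Subgroup G × Subgroup G) //
      IsTransferSystem P.1 ∧ IsTransferSystem P.2 ∧ CompatiblePair P.1 P.2} =
      #(bracketPairs m) := by
  rw [← Nat.subtype_card (bracketPairs m) mem_bracketPairs]
  symm
  have hinj {d d' : Fin m → ℕ} (hd : ∀ i : Fin m, (i : ℕ) + d i < m) (hd' : ∀ i : Fin m, (i : ℕ) + d' i < m)
      (h : chainRel c d = chainRel c d') : d = d' :=
    funext fun i => le_antisymm ((chainRel_subset_iff c hd).1 h.le i)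
      ((chainRel_subset_iff c hd').1 h.ge i)
  have key (d e : Fin m → ℕ) : IsBracketPair (fun i => (d i, e i)) ↔
      (∀ i : Fin m, (i : ℕ) + d i < m) ∧ (∀ i : Fin m, (i : ℕ) + e i < m) ∧
      (∀ i j : Fin m, i < j → (j : ℕ) ≤ i + d i → (j : ℕ) + d j ≤ i + d i) ∧
      (∀ i j : Fin m, i < j → (j : ℕ) ≤ i + e i → (j : ℕ) + e j ≤ i + e i) ∧
      ∀ i, d i ≤ e i ∧ ∀ j : Fin m, i < j → (j : ℕ) ≤ i + d i → (i : ℕ) + d i ≤ j + e j := by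
    unfold IsBracketPair
    constructor
    · intro h
      refine ⟨fun i => ?_, fun i => (h i).2.1, fun i j h1 h2 => ((h i).2.2.1 j h1 h2).1,
        fun i j h1 h2 => (h i).2.2.2 j h1 h2,
        fun i => ⟨(h i).1, fun j h1 h2 => ((h i).2.2.1 j h1 h2).2⟩⟩
      obtain ⟨h1, h2, -⟩ := h i
      simp only at h1 h2
      omega
    · rintro ⟨-, h2, h3, h4, h5⟩ i
      exact ⟨(h5 i).1, h2 i, fun j hij hj => ⟨h3 i j hij hj, (h5 i).2 j hij hj⟩, h4 i⟩
  refine Nat.card_eq_of_bijective (fun u => ⟨(chainRel c fun i => (u.1 i).1,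
    chainRel c fun i => (u.1 i).2), ?_⟩) ⟨?_, ?_⟩
  · obtain ⟨h1, h2, h3, h4, h5⟩ := (key _ _).1 u.2
    exact ⟨isTransferSystem_chainRel c h3, isTransferSystem_chainRel c h4,
      (compatiblePair_chainRel_iff c h1 h4).2 h5⟩
  · rintro ⟨u, hu⟩ ⟨v, hv⟩ huv
    obtain ⟨h1, h2, -⟩ := (key _ _).1 hu
    obtain ⟨k1, k2, -⟩ := (key _ _).1 hv
    simp only [Subtype.mk.injEq, Prod.mk.injEq] at huv
    have e1 := hinj h1 k1 huv.1
    have e2 := hinj h2 k2 huv.2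
    exact Subtype.ext (funext fun i => Prod.ext (congrFun e1 i) (congrFun e2 i))
  · rintro ⟨⟨T, T'⟩, hT, hT', hTT'⟩
    obtain ⟨d, h1, h3, rfl⟩ := exists_eq_chainRel c hT
    obtain ⟨e, h2, h4, rfl⟩ := exists_eq_chainRel c hT'
    exact ⟨⟨fun i => (d i, e i), (key d e).2
      ⟨h1, h2, h3, h4, (compatiblePair_chainRel_iff c h1 h4).1 hTT'⟩⟩, rfl⟩

/-- The subgroups of a cyclic group of order `p ^ n` form a chain of length `n`. -/
theorem nonempty_subgroup_orderIso_fin {G : Type*} [CommGroup G] [IsCyclic G] {p n : ℕ}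
    (hp : p.Prime) (hG : Nat.card G = p ^ n) : Nonempty (Subgroup G ≃o Fin (n + 1)) := by
  have : Finite G := Nat.finite_of_card_ne_zero (by rw [hG]; exact (pow_pos hp.pos n).ne')
  let φ : Fin (n + 1) → Subgroup G := fun k => (powMonoidHom (p ^ (k : ℕ)) : G →* G).ker
  have hcard (k : Fin (n + 1)) : Nat.card (φ k) = p ^ (k : ℕ) := by
    rw [IsCyclic.card_powMonoidHom_ker, hG]
    exact Nat.gcd_eq_right (pow_dvd_pow p (by omega))
  have hmono : StrictMono φ := by
    refine Monotone.strictMono_of_injective (fun i j hij x hx => ?_) fun i j hij => ?_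
    · obtain ⟨a, ha⟩ := pow_dvd_pow p (Fin.le_def.1 hij)
      simp only [φ, MonoidHom.mem_ker, powMonoidHom_apply] at hx ⊢
      rw [ha, pow_mul, hx, one_pow]
    · exact Fin.ext (Nat.pow_right_injective hp.two_le (by simp only [← hcard, hij]))
  have hsurj : Function.Surjective φ := by
    intro H
    obtain ⟨k, hk, hH⟩ := (Nat.dvd_prime_pow hp).1 (hG ▸ H.card_subgroup_dvd_card)
    refine ⟨⟨k, by omega⟩, (Subgroup.eq_of_le_of_card_ge (fun x hx => ?_) ?_).symm⟩
    · simp only [φ, MonoidHom.mem_ker, powMonoidHom_apply]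
      rw [← hH]
      exact congrArg Subtype.val (pow_card_eq_one' (x := (⟨x, hx⟩ : H)))
    · rw [hcard, hH]
  exact ⟨(hmono.orderIsoOfSurjective φ hsurj).symm⟩

/-- The number of compatible pairs of transfer systems for `C_{p^n}` equals the
Fuss–Catalan number `A_{n+1}(3,1) = (1/(3n+4)) * binom(3n+4, n+1)`
(stated here in multiplied-out form). -/
theorem card_compatible_pairs_cyclic_prime_pow (p n : ℕ) (hp : p.Prime) :
    Nat.card {P : Set (Subgroup (Multiplicative (ZMod (p ^ n))) ×
          Subgroup (Multiplicative (ZMod (p ^ n)))) ×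
        Set (Subgroup (Multiplicative (ZMod (p ^ n))) ×
          Subgroup (Multiplicative (ZMod (p ^ n)))) //
        IsTransferSystem P.1 ∧ IsTransferSystem P.2 ∧ CompatiblePair P.1 P.2} *
      (3 * n + 4) = Nat.choose (3 * n + 4) (n + 1) := by
  have : NeZero (p ^ n) := ⟨(pow_pos hp.pos n).ne'⟩
  obtain ⟨c⟩ := nonempty_subgroup_orderIso_fin (G := Multiplicative (ZMod (p ^ n))) (n := n) hp
    (by simp)
  rw [card_compatiblePairs_of_orderIso c, card_bracketPairs]
  simpa [mul_add, add_assoc] using raney_mul 1 (n + 1)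
end

section
/- For every prime p and every natural number n, the number of flat transfer systems for the cyclic group C_{p^n} equals the partial sum of Catalan numbers ∑_{k=0}^{n} Catalan(k). -/
/-- `F` is the minimal fibrant subgroup of the transfer system `T`:
the minimal element of `{H : (H, G) ∈ T}`. -/
def IsMinimalFibrant {G : Type*} [Group G] (T : Set (Subgroup G × Subgroup G))
    (F : Subgroup G) : Prop :=
  (F, ⊤) ∈ T ∧ ∀ H : Subgroup G, (H, ⊤) ∈ T → F ≤ H

/-- A transfer system is flat if it restricts trivially below its minimal fibrant
subgroup: there is no pair `(H, K) ∈ T` with `H < K ≤ F`. -/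
def IsFlat {G : Type*} [Group G] (T : Set (Subgroup G × Subgroup G)) : Prop :=
  ∀ F : Subgroup G, IsMinimalFibrant T F →
    ¬∃ H K : Subgroup G, (H, K) ∈ T ∧ H < K ∧ K ≤ F

/-- `IsReach m d` says that `d` records a transfer system on the chain `0 < 1 < ⋯ < m - 1`:
there is a transfer from `a` to `b` exactly when `a ≤ b ≤ d a`. -/
structure IsReach (m : ℕ) (d : ℕ → ℕ) : Prop where
  le : ∀ a, a ≤ d a
  eq_self : ∀ a, m ≤ a → d a = a
  lt : ∀ a, a < m → d a < m
  trans : ∀ a b, a ≤ b → b ≤ d a → d b ≤ d a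

/-- Put a transfer system on a chain of length `f` below a point `f` that reaches the top `m`,
and a transfer system on a chain of length `m - f` strictly above `f`. -/
def glue (m f : ℕ) (d₁ d₂ : ℕ → ℕ) (a : ℕ) : ℕ :=
  if a < f then d₁ a else if a = f then m else f + 1 + d₂ (a - (f + 1))

theorem isReach_glue {m f : ℕ} {d₁ d₂ : ℕ → ℕ} (hf : f ≤ m) (h₁ : IsReach f d₁)
    (h₂ : IsReach (m - f) d₂) : IsReach (m + 1) (glue m f d₁ d₂) where
  le a := by
    have := h₁.le a
    have := h₂.le (a - (f + 1))
    unfold glue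
    split_ifs <;> omega
  eq_self a ha := by
    have := h₂.eq_self (a - (f + 1))
    unfold glue
    split_ifs <;> omega
  lt a ha := by
    have := h₁.lt a
    have := h₂.lt (a - (f + 1))
    unfold glue
    split_ifs <;> omega
  trans a b hab hb := by
    have := h₁.lt a
    have := h₁.trans a b
    have := h₂.le (a - (f + 1))
    have := h₂.trans (a - (f + 1)) (b - (f + 1))
    have := h₂.lt (b - (f + 1))
    unfold glue at *
    split_ifs at * <;> omega

theorem glue_lt {m f : ℕ} {d₁ d₂ : ℕ → ℕ} (hf : f ≤ m) (h₁ : IsReach f d₁) {a : ℕ} (ha : a < f) :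
    glue m f d₁ d₂ a < m := by
  have := h₁.lt a ha
  rw [glue, if_pos ha]
  omega

theorem glue_self (m f : ℕ) (d₁ d₂ : ℕ → ℕ) : glue m f d₁ d₂ f = m := by
  simp [glue]

theorem glue_index_injective {m f f' : ℕ} {d₁ d₂ d₁' d₂' : ℕ → ℕ} (hf : f ≤ m) (hf' : f' ≤ m)
    (h₁ : IsReach f d₁) (h₁' : IsReach f' d₁')
    (h : glue m f d₁ d₂ = glue m f' d₁' d₂') : f = f' := by
  have e := glue_self m f d₁ d₂
  have e' := glue_self m f' d₁' d₂'
  rcases lt_trichotomy f f' with hlt | heq | hlt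
  · have := glue_lt (d₂ := d₂') hf' h₁' hlt
    rw [h] at e
    omega
  · exact heq
  · have := glue_lt (d₂ := d₂) hf h₁ hlt
    rw [← h] at e'
    omega

theorem glue_lower_injective {m f : ℕ} {d₁ d₂ d₁' d₂' : ℕ → ℕ} (h₁ : IsReach f d₁)
    (h₁' : IsReach f d₁') (h : glue m f d₁ d₂ = glue m f d₁' d₂') : d₁ = d₁' := by
  funext a
  by_cases ha : a < f
  · simpa [glue, ha] using congrFun h a
  · rw [h₁.eq_self a (by omega), h₁'.eq_self a (by omega)]

theorem glue_upper_injective {m f : ℕ} {d₁ d₂ d₁' d₂' : ℕ → ℕ}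
    (h : glue m f d₁ d₂ = glue m f d₁' d₂') : d₂ = d₂' := by
  funext a
  have := congrFun h (a + (f + 1))
  unfold glue at this
  rw [if_neg (by omega), if_neg (by omega), if_neg (by omega), if_neg (by omega),
    Nat.add_sub_cancel] at this
  omega

theorem IsReach.exists_least_top {m : ℕ} {d : ℕ → ℕ} (h : IsReach (m + 1) d) :
    ∃ f ≤ m, d f = m ∧ ∀ a < f, d a ≠ m := by
  have hm : d m = m := by
    have := h.le m
    have := h.lt m
    omega
  classical
  have hex : ∃ f, d f = m := ⟨m, hm⟩
  exact ⟨Nat.find hex, Nat.find_min' hex hm, Nat.find_spec hex, fun a ha => Nat.find_min hex ha⟩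

theorem IsReach.lt_of_lt_least_top {m f : ℕ} {d : ℕ → ℕ} (h : IsReach (m + 1) d) (hf : f ≤ m)
    (hdf : d f = m) (hmin : ∀ a < f, d a ≠ m) {a : ℕ} (ha : a < f) : d a < f := by
  by_contra hcon
  have := h.trans a f ha.le (by omega)
  have := h.lt a (by omega)
  have := hmin a ha
  omega

theorem IsReach.lower {m f : ℕ} {d : ℕ → ℕ} (h : IsReach (m + 1) d) (hf : f ≤ m)
    (hdf : d f = m) (hmin : ∀ a < f, d a ≠ m) : IsReach f (fun a => if a < f then d a else a) where
  le a := by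
    have := h.le a
    split_ifs <;> omega
  eq_self a ha := if_neg (by omega)
  lt a ha := by
    rw [if_pos ha]
    exact h.lt_of_lt_least_top hf hdf hmin ha
  trans a b hab hb := by
    have := h.trans a b hab
    have := fun ha => h.lt_of_lt_least_top hf hdf hmin (a := a) ha
    split_ifs at * <;> omega

theorem IsReach.upper {m f : ℕ} {d : ℕ → ℕ} (h : IsReach (m + 1) d) (hf : f ≤ m) :
    IsReach (m - f) (fun a => d (a + (f + 1)) - (f + 1)) where
  le a := by
    have := h.le (a + (f + 1))
    omega
  eq_self a ha := by
    have := h.eq_self (a + (f + 1))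
    omega
  lt a ha := by
    have := h.lt (a + (f + 1))
    omega
  trans a b hab hb := by
    have := h.trans (a + (f + 1)) (b + (f + 1))
    have := h.le (a + (f + 1))
    omega

theorem IsReach.glue_eq {m f : ℕ} {d : ℕ → ℕ} (h : IsReach (m + 1) d) (hdf : d f = m) :
    glue m f (fun a => if a < f then d a else a) (fun a => d (a + (f + 1)) - (f + 1)) = d := by
  funext a
  unfold glue
  split_ifs with h₁ h₂
  · exact if_pos h₁
  · rw [h₂, hdf]
  · have := h.le a
    dsimp only
    rw [Nat.sub_add_cancel (by omega)]
    omega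

theorem isReach_id (m : ℕ) : IsReach m id where
  le _ := le_rfl
  eq_self _ _ := rfl
  lt _ h := h
  trans _ _ _ h := h

/-- Transfer systems on a chain of length `m + 1`, split at the least point reaching the top. -/
noncomputable def reachSuccEquiv (m : ℕ) :
    (Σ f : Fin (m + 1), {d // IsReach f d} × {d // IsReach (m - f) d}) ≃
      {d // IsReach (m + 1) d} :=
  Equiv.ofBijective
    (fun x => ⟨glue m x.1 x.2.1 x.2.2,
      isReach_glue (Nat.le_of_lt_succ x.1.2) x.2.1.2 x.2.2.2⟩) <| by
    constructor
    · rintro ⟨⟨f, hf⟩, ⟨d₁, h₁⟩, ⟨d₂, h₂⟩⟩ ⟨⟨f', hf'⟩, ⟨d₁', h₁'⟩, ⟨d₂', h₂'⟩⟩ h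
      have h := congrArg Subtype.val h
      dsimp only at h
      obtain rfl := glue_index_injective (Nat.le_of_lt_succ hf) (Nat.le_of_lt_succ hf') h₁ h₁' h
      obtain rfl := glue_lower_injective h₁ h₁' h
      obtain rfl := glue_upper_injective h
      rfl
    · rintro ⟨d, h⟩
      obtain ⟨f, hf, hdf, hmin⟩ := h.exists_least_top
      exact ⟨⟨⟨f, Nat.lt_succ_of_le hf⟩, ⟨_, h.lower hf hdf hmin⟩, ⟨_, h.upper hf⟩⟩,
        Subtype.ext (h.glue_eq hdf)⟩

theorem finite_and_card_reach (m : ℕ) :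
    Finite {d // IsReach m d} ∧ Nat.card {d // IsReach m d} = catalan m := by
  induction m using Nat.strong_induction_on with
  | _ m ih =>
    cases m with
    | zero =>
      have : Unique {d // IsReach 0 d} :=
        { default := ⟨id, isReach_id 0⟩
          uniq := fun d => Subtype.ext (funext fun a => d.2.eq_self a a.zero_le) }
      exact ⟨inferInstance, by simp⟩
    | succ m =>
      have h₁ (f : Fin (m + 1)) := ih f f.2
      have h₂ (f : Fin (m + 1)) := ih (m - f) (by omega)
      have _ (f : Fin (m + 1)) := (h₁ f).1
      have _ (f : Fin (m + 1)) := (h₂ f).1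
      refine ⟨Finite.of_equiv _ (reachSuccEquiv m), ?_⟩
      rw [← Nat.card_congr (reachSuccEquiv m), Nat.card_sigma, catalan_succ]
      exact Finset.sum_congr rfl fun f _ => by rw [Nat.card_prod, (h₁ f).2, (h₂ f).2]

/-- Flatness of a transfer system on the chain `0 < ⋯ < n`: there is no nontrivial transfer
below the least point reaching `n`. -/
def IsFlatReach (n : ℕ) (d : ℕ → ℕ) : Prop :=
  ∀ f, d f = n → (∀ a < f, d a ≠ n) → ∀ a < f, d a = a

theorem isFlatReach_glue {n f : ℕ} {d₂ : ℕ → ℕ} :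
    IsFlatReach n (glue n f id d₂) := by
  intro g _ hmin a ha
  have : g ≤ f := by
    by_contra hlt
    exact hmin f (by omega) (glue_self ..)
  rw [glue, if_pos (by omega), id]

/-- A flat transfer system is determined by its behaviour strictly above the least point
reaching the top. -/
noncomputable def flatReachEquiv (n : ℕ) :
    (Σ f : Fin (n + 1), {d // IsReach (n - f) d}) ≃
      {d // IsReach (n + 1) d ∧ IsFlatReach n d} :=
  Equiv.ofBijective
    (fun x => ⟨glue n x.1 id x.2,
      isReach_glue (Nat.le_of_lt_succ x.1.2) (isReach_id _) x.2.2,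
      isFlatReach_glue⟩) <| by
    constructor
    · rintro ⟨⟨f, hf⟩, ⟨d₂, h₂⟩⟩ ⟨⟨f', hf'⟩, ⟨d₂', h₂'⟩⟩ h
      have h := congrArg Subtype.val h
      dsimp only at h
      obtain rfl := glue_index_injective (Nat.le_of_lt_succ hf) (Nat.le_of_lt_succ hf')
        (isReach_id _) (isReach_id _) h
      obtain rfl := glue_upper_injective h
      rfl
    · rintro ⟨d, h, hflat⟩
      obtain ⟨f, hf, hdf, hmin⟩ := h.exists_least_top
      refine ⟨⟨⟨f, Nat.lt_succ_of_le hf⟩, ⟨_, h.upper hf⟩⟩, Subtype.ext ?_⟩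
      have hid : (fun a => if a < f then d a else a) = id := by
        funext a
        split_ifs with ha
        · exact hflat f hdf hmin a ha
        · rfl
      have := h.glue_eq hdf
      rwa [hid] at this

theorem card_flatReach (n : ℕ) :
    Nat.card {d // IsReach (n + 1) d ∧ IsFlatReach n d} =
      ∑ k ∈ Finset.range (n + 1), catalan k := by
  have _ (f : Fin (n + 1)) := (finite_and_card_reach (n - f)).1
  rw [← Nat.card_congr (flatReachEquiv n), Nat.card_sigma,
    ← Finset.sum_range_reflect, Finset.sum_range]
  exact Finset.sum_congr rfl fun f _ => by
    rw [(finite_and_card_reach (n - f)).2, Nat.add_sub_cancel]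

theorem Subgroup.pow_natCard_eq_one_of_mem {G : Type*} [Group G] {H : Subgroup G} {x : G}
    (hx : x ∈ H) : x ^ Nat.card H = 1 :=
  congrArg Subtype.val (pow_card_eq_one' (x := (⟨x, hx⟩ : H)))

/-- In a finite cyclic group, inclusion of subgroups is divisibility of orders. -/
theorem Subgroup.le_iff_card_dvd_of_isCyclic {G : Type*} [CommGroup G] [IsCyclic G] [Finite G]
    {H K : Subgroup G} : H ≤ K ↔ Nat.card H ∣ Nat.card K := by
  refine ⟨Subgroup.card_dvd_of_le, fun hdvd => ?_⟩
  have hK : K = (powMonoidHom (Nat.card K) : G →* G).ker := by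
    refine Subgroup.eq_of_le_of_card_ge (fun x hx => ?_) ?_
    · rw [MonoidHom.mem_ker, powMonoidHom_apply]
      exact Subgroup.pow_natCard_eq_one_of_mem hx
    · rw [IsCyclic.card_powMonoidHom_ker]
      exact Nat.gcd_le_right _ Nat.card_pos
  intro x hx
  rw [hK, MonoidHom.mem_ker, powMonoidHom_apply]
  obtain ⟨c, hc⟩ := hdvd
  rw [hc, pow_mul, Subgroup.pow_natCard_eq_one_of_mem hx, one_pow]

/-- The subgroups of a cyclic group of order `p ^ n` form a chain of length `n + 1`. -/
theorem exists_subgroup_orderIso {G : Type*} [CommGroup G] [IsCyclic G] [Finite G] {p n : ℕ}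
    (hp : p.Prime) (hG : Nat.card G = p ^ n) : Nonempty (Subgroup G ≃o Fin (n + 1)) := by
  have := Fact.mk hp
  have hsub (k : Fin (n + 1)) : ∃ K : Subgroup G, Nat.card K = p ^ (k : ℕ) :=
    Sylow.exists_subgroup_card_pow_prime p (hG ▸ pow_dvd_pow p (Nat.le_of_lt_succ k.2))
  choose s hs using hsub
  have hle (a b : Fin (n + 1)) : s a ≤ s b ↔ a ≤ b := by
    rw [Subgroup.le_iff_card_dvd_of_isCyclic, hs, hs, Nat.pow_dvd_pow_iff_le_right hp.one_lt,
      Fin.le_def]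
  have hsurj : Function.Surjective s := fun K => by
    obtain ⟨k, hk, hcard⟩ := (Nat.dvd_prime_pow hp).1 (hG ▸ K.card_subgroup_dvd_card)
    refine ⟨⟨k, Nat.lt_succ_of_le hk⟩, le_antisymm ?_ ?_⟩ <;>
      rw [Subgroup.le_iff_card_dvd_of_isCyclic, hs, hcard]
  exact ⟨(RelIso.ofSurjective (OrderEmbedding.ofMapLEIff s hle) hsurj).symm⟩

/-- The set of pairs of subgroups recorded by `d`, for a chain of subgroups indexed by `o`. -/
def transferOfReach {G : Type*} [Group G] {n : ℕ} (o : Subgroup G ≃o Fin (n + 1)) (d : ℕ → ℕ) :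
    Set (Subgroup G × Subgroup G) :=
  {P | P.1 ≤ P.2 ∧ (o P.2 : ℕ) ≤ d (o P.1)}

section Chain

variable {G : Type*} [CommGroup G] {n : ℕ} (o : Subgroup G ≃o Fin (n + 1))

theorem isTransferSystem_transferOfReach {d : ℕ → ℕ} (h : IsReach (n + 1) d) :
    IsTransferSystem (transferOfReach o d) := by
  refine ⟨fun P hP => hP.1, fun H => ⟨le_rfl, h.le _⟩, fun H K L hHK hKL => ?_,
    fun H K hHK g => ?_, fun H K L hHK hLK => ?_⟩
  · exact ⟨hHK.1.trans hKL.1, hKL.2.trans (h.trans _ _ (o.monotone hHK.1) hHK.2)⟩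
  · have hconj (H : Subgroup G) : Subgroup.map (MulAut.conj g).toMonoidHom H = H := by
      have : (MulAut.conj g).toMonoidHom = MonoidHom.id G := by
        ext x
        simp
      rw [this, Subgroup.map_id]
    rwa [hconj, hconj]
  · have hor : H ≤ L ∨ L ≤ H := by
      rw [← o.le_iff_le, ← o.le_iff_le]
      exact le_total _ _
    rcases hor with hHL | hLH
    · rw [inf_eq_left.2 hHL]
      exact ⟨hHL, le_trans (o.monotone hLK) hHK.2⟩
    · rw [inf_eq_right.2 hLH]
      exact ⟨le_rfl, h.le _⟩

theorem mem_transferOfReach_top {d : ℕ → ℕ} (h : IsReach (n + 1) d) (H : Subgroup G) :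
    (H, ⊤) ∈ transferOfReach o d ↔ d (o H) = n := by
  have htop : ((o ⊤ : Fin (n + 1)) : ℕ) = n := by
    rw [o.map_top]
    rfl
  have hlt := h.lt _ (o H).2
  constructor
  · intro hH
    have := hH.2
    dsimp only at this
    omega
  · intro hH
    refine ⟨le_top, ?_⟩
    dsimp only
    omega

theorem isFlat_transferOfReach_iff {d : ℕ → ℕ} (h : IsReach (n + 1) d) :
    IsFlat (transferOfReach o d) ↔ IsFlatReach n d := by
  constructor
  · intro hflat f hf hmin a ha
    by_contra hne
    have hda := h.le a
    have hfn : f < n + 1 := by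
      by_contra hcon
      have := h.eq_self f (by omega)
      omega
    refine hflat (o.symm ⟨f, hfn⟩) ⟨?_, fun H hH => ?_⟩
      ⟨o.symm ⟨a, by omega⟩, o.symm ⟨a + 1, by omega⟩, ⟨?_, ?_⟩, ?_, ?_⟩
    · rw [mem_transferOfReach_top o h, o.apply_symm_apply]
      exact hf
    · rw [mem_transferOfReach_top o h] at hH
      rw [o.symm_apply_le, Fin.le_def]
      by_contra hlt
      exact hmin _ (not_le.1 hlt) hH
    · simp [Fin.le_def]
    · simp only [o.apply_symm_apply]
      omega
    · simp [Fin.lt_def]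
    · simpa [Fin.le_def] using ha
  · rintro hflat F ⟨hF, hmin⟩ ⟨H, K, hHK, hlt, hKF⟩
    rw [mem_transferOfReach_top o h] at hF
    have hHK' : (o H : ℕ) < o K := o.strictMono hlt
    have hHF : (o H : ℕ) < o F := o.strictMono (hlt.trans_le hKF)
    have := hflat _ hF (fun a ha hda => ?_) _ hHF
    · have := hHK.2
      dsimp only at this
      omega
    · have ha' : a < n + 1 := ha.trans (o F).2
      have hle := hmin (o.symm ⟨a, ha'⟩) (by
        rw [mem_transferOfReach_top o h, o.apply_symm_apply]
        exact hda)
      rw [o.le_symm_apply, Fin.le_def] at hle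
      exact absurd ha (not_lt.2 hle)

theorem transferOfReach_injective {d d' : ℕ → ℕ} (h : IsReach (n + 1) d)
    (h' : IsReach (n + 1) d') (heq : transferOfReach o d = transferOfReach o d') : d = d' := by
  have key {d d' : ℕ → ℕ} (h : IsReach (n + 1) d)
      (heq : transferOfReach o d = transferOfReach o d') (a : ℕ) (ha : a < n + 1) :
      d a ≤ d' a := by
    have hmem : (o.symm ⟨a, ha⟩, o.symm ⟨d a, h.lt a ha⟩) ∈ transferOfReach o d := by
      refine ⟨?_, ?_⟩
      · simpa [Fin.le_def] using h.le a
      · simp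
    rw [heq] at hmem
    simpa using hmem.2
  funext a
  by_cases ha : a < n + 1
  · exact le_antisymm (key h heq a ha) (key h' heq.symm a ha)
  · rw [h.eq_self a (by omega), h'.eq_self a (by omega)]

theorem exists_transferOfReach_eq {T : Set (Subgroup G × Subgroup G)} (hT : IsTransferSystem T) :
    ∃ d, IsReach (n + 1) d ∧ transferOfReach o d = T := by
  classical
  obtain ⟨hle, hrefl, htrans, -, hres⟩ := hT
  let s (a : ℕ) : Subgroup G := o.symm (Fin.ofNat (n + 1) a)
  let d (a : ℕ) : ℕ := if a ≤ n then Nat.findGreatest (fun b => (s a, s b) ∈ T) n else a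
  have hs (H : Subgroup G) : s (o H) = H := by simp [s]
  have hs_le {a b : ℕ} (ha : a ≤ b) (hb : b ≤ n) : s a ≤ s b := by
    simp only [s, o.symm.le_iff_le, Fin.le_def, Fin.val_ofNat]
    rwa [Nat.mod_eq_of_lt (by omega), Nat.mod_eq_of_lt (by omega)]
  have hd_le {a : ℕ} (ha : a ≤ n) : d a ≤ n := by
    simp only [d, if_pos ha]
    exact Nat.findGreatest_le n
  have hd_mem {a : ℕ} (ha : a ≤ n) : (s a, s (d a)) ∈ T := by
    simp only [d, if_pos ha]
    exact Nat.findGreatest_spec (P := fun b => (s a, s b) ∈ T) ha (hrefl _)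
  have hmem {a b : ℕ} (hab : a ≤ b) (hb : b ≤ n) : (s a, s b) ∈ T ↔ b ≤ d a := by
    constructor
    · intro h
      simp only [d, if_pos (hab.trans hb)]
      exact Nat.le_findGreatest hb h
    · intro h
      have := hres _ _ _ (hd_mem (hab.trans hb)) (hs_le h (hd_le (hab.trans hb)))
      rwa [inf_eq_left.2 (hs_le hab hb)] at this
  have hself {a : ℕ} (ha : n < a) : d a = a := if_neg (by omega)
  have hd_ge (a : ℕ) : a ≤ d a := by
    by_cases ha : a ≤ n
    · exact (hmem le_rfl ha).1 (hrefl _)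
    · rw [hself (by omega)]
  refine ⟨d, ⟨hd_ge, fun a ha => hself ha, fun a ha => ?_, fun a b hab hb => ?_⟩, ?_⟩
  · exact Nat.lt_succ_of_le (hd_le (Nat.le_of_lt_succ ha))
  · by_cases ha : a ≤ n
    · have hbn := hb.trans (hd_le ha)
      exact (hmem (hab.trans (hd_ge b)) (hd_le hbn)).1
        (htrans _ _ _ ((hmem hab hbn).2 hb) (hd_mem hbn))
    · have := hself (a := a) (by omega)
      obtain rfl : a = b := by omega
      exact le_rfl
  · ext ⟨H, K⟩
    have key (hHK : H ≤ K) : (H, K) ∈ T ↔ (o K : ℕ) ≤ d (o H) := by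
      rw [← hmem (o.monotone hHK) (Nat.le_of_lt_succ (o K).2), hs, hs]
    exact ⟨fun h => (key h.1).2 h.2, fun h => ⟨hle _ h, (key (hle _ h)).1 h⟩⟩

/-- Flat transfer systems on a group whose subgroups form a chain. -/
noncomputable def flatTransferEquiv :
    {d // IsReach (n + 1) d ∧ IsFlatReach n d} ≃
      {T : Set (Subgroup G × Subgroup G) // IsTransferSystem T ∧ IsFlat T} :=
  Equiv.ofBijective
    (fun d => ⟨transferOfReach o d.1, isTransferSystem_transferOfReach o d.2.1,
      (isFlat_transferOfReach_iff o d.2.1).2 d.2.2⟩) <| by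
    constructor
    · rintro ⟨d, h⟩ ⟨d', h'⟩ heq
      exact Subtype.ext (transferOfReach_injective o h.1 h'.1 (congrArg Subtype.val heq))
    · rintro ⟨T, hT, hflat⟩
      obtain ⟨d, h, rfl⟩ := exists_transferOfReach_eq o hT
      exact ⟨⟨d, h, (isFlat_transferOfReach_iff o h).1 hflat⟩, rfl⟩

end Chain

/-- The number of flat transfer systems for `C_{p^n}` equals the partial sum of
Catalan numbers `∑_{k=0}^{n} Catalan(k)`. -/
theorem card_flat_transferSystems_cyclic_prime_pow (p n : ℕ) (hp : p.Prime) :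
    Nat.card {T : Set (Subgroup (Multiplicative (ZMod (p ^ n))) ×
        Subgroup (Multiplicative (ZMod (p ^ n)))) // IsTransferSystem T ∧ IsFlat T} =
      ∑ k ∈ Finset.range (n + 1), catalan k := by
  have : NeZero (p ^ n) := ⟨pow_ne_zero n hp.ne_zero⟩
  obtain ⟨o⟩ := exists_subgroup_orderIso (G := Multiplicative (ZMod (p ^ n))) (n := n) hp
    (by simp)
  rw [← Nat.card_congr (flatTransferEquiv o), card_flatReach]
end
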